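/- Let n ≥ 1 and 1 ≤ k ≤ n. Let Ψ be a nonzero vector in (ℂ²)^⊗(2n+1) satisfying H_{2n+1}Ψ = E₀Ψ, where H_{2n+1} is the periodic XXZ Hamiltonian at Δ = −1/2 and E₀ is the smallest eigenvalue of H_{2n+1}, and satisfying SᶻΨ = −(1/2)Ψ. Then the emptiness formation probabilities E(k) are nonzero and E(k−1)/E(k) = [(2k−2)!·(2k−1)!·(2n+k)!·(n−k)!] / [(k−1)!·(3k−2)!·(2n−k+1)!·(n+k−1)!]. -/

import Mathlib

noncomputable section

/-- Spin configurations of a chain of length `N`; `true` = spin up `↑`. -/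
abbrev Cfg (N : ℕ) := Fin N → Bool

/-- Pauli matrix `σ^x` in the basis `(↑,↓)`. -/
def sigmaX : Matrix Bool Bool ℂ := Matrix.of fun b c => if b = c then 0 else 1

/-- Pauli matrix `σ^y` in the basis `(↑,↓)`. -/
def sigmaY : Matrix Bool Bool ℂ :=
  Matrix.of fun b c => if b = c then 0 else if b then -Complex.I else Complex.I

/-- Pauli matrix `σ^z` in the basis `(↑,↓)`. -/
def sigmaZ : Matrix Bool Bool ℂ :=
  Matrix.of fun b c => if b = c then (if b then 1 else -1) else 0

/-- `σ⁺ = σ^x + i σ^y`. -/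
def sigmaP : Matrix Bool Bool ℂ := sigmaX + Complex.I • sigmaY

/-- `σ⁻ = σ^x − i σ^y`. -/
def sigmaM : Matrix Bool Bool ℂ := sigmaX - Complex.I • sigmaY

/-- A one-site operator `A` acting on the `i`-th tensor factor of `(ℂ²)^{⊗N}`. -/
def localOp (N : ℕ) (i : Fin N) (A : Matrix Bool Bool ℂ) : Matrix (Cfg N) (Cfg N) ℂ :=
  Matrix.of fun f g =>
    A (f i) (g i) * ∏ j ∈ Finset.univ.erase i, (if f j = g j then (1 : ℂ) else 0)

/-- The cyclic successor `i+1` of a site index (mod `N`). -/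
def cyc (N : ℕ) (i : Fin N) : Fin N :=
  ⟨(i.val + 1) % N, Nat.mod_lt _ (by have := i.isLt; omega)⟩

/-- Periodic XXZ Hamiltonian at `Δ = −1/2`:
`H_N = −(1/2)·Σ_{i=1}^{N} (σ^x_i σ^x_{i+1} + σ^y_i σ^y_{i+1} − (1/2) σ^z_i σ^z_{i+1})`,
site indices mod `N`. -/
def Hper (N : ℕ) : Matrix (Cfg N) (Cfg N) ℂ :=
  (-(1/2) : ℂ) • ∑ i : Fin N,
    (localOp N i sigmaX * localOp N (cyc N i) sigmaX
      + localOp N i sigmaY * localOp N (cyc N i) sigmaY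
      - (1/2 : ℂ) • (localOp N i sigmaZ * localOp N (cyc N i) sigmaZ))

/-- Total spin `Sᶻ = (1/2)·Σ_i σ^z_i`. -/
def Sz (N : ℕ) : Matrix (Cfg N) (Cfg N) ℂ := (1/2 : ℂ) • ∑ i : Fin N, localOp N i sigmaZ

/-- Projector onto spin up at site `i`: `p_i⁺ = (1 + σ^z_i)/2`. -/
def pUp (N : ℕ) (i : Fin N) : Matrix (Cfg N) (Cfg N) ℂ := (1/2 : ℂ) • (1 + localOp N i sigmaZ)

/-- The product `Π_{i=1}^{k} p_i⁺` of projectors onto spin up at the first `k` sites. -/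
def projProd (N k : ℕ) : Matrix (Cfg N) (Cfg N) ℂ :=
  (((List.finRange N).filter fun i : Fin N => decide (i.val < k)).map (pUp N)).prod

/-- Standard Hermitian inner product on `(ℂ²)^{⊗N}`. -/
def hermInner {N : ℕ} (v w : Cfg N → ℂ) : ℂ := ∑ f, (starRingEnd ℂ) (v f) * w f

/-- Emptiness formation probability `E(k) = ⟨Ψ, Π_{i=1}^k p_i⁺ Ψ⟩ / ⟨Ψ, Ψ⟩`. -/
def EFP {N : ℕ} (Ψ : Cfg N → ℂ) (k : ℕ) : ℂ :=
  hermInner Ψ ((projProd N k).mulVec Ψ) / hermInner Ψ Ψ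

section Polynomials

open MvPolynomial

/-- A primitive cube root of unity, the spectral parameter of the chain at `Δ = −1/2`. -/
def qc : ℂ := -1/2 + (Real.sqrt 3 / 2 : ℝ) * Complex.I

lemma qc_rel : qc ^ 2 + qc + 1 = 0 := by
  have h3 : ((Real.sqrt 3 : ℝ) : ℂ) ^ 2 = 3 := by
    rw [← Complex.ofReal_pow, Real.sq_sqrt (by norm_num)]; norm_num
  unfold qc
  push_cast
  linear_combination (1/4 : ℂ) * Complex.I ^ 2 * h3 + (3/4 : ℂ) * Complex.I_sq

lemma qc_cube : qc ^ 3 = 1 := by linear_combination (qc - 1) * qc_rel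

lemma qc_ne_zero : qc ≠ 0 := by
  intro h; have := qc_rel; rw [h] at this; norm_num at this

/-- The polynomial ring in the inhomogeneities. -/
abbrev Pol := MvPolynomial ℕ ℂ

/-- The adjacent transposition of `i` and `i + 1`. -/
abbrev sw (i : ℕ) : Equiv.Perm ℕ := Equiv.swap i (i + 1)

lemma dvd_rename_swap_sub (i j : ℕ) (f : Pol) :
    (X j - X i : Pol) ∣ rename (Equiv.swap i j) f - f := by
  rw [← Ideal.mem_span_singleton, ← Ideal.Quotient.eq]
  have : ((Ideal.Quotient.mkₐ ℂ (Ideal.span {(X j - X i : Pol)})).comp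
      (rename (Equiv.swap i j))) = Ideal.Quotient.mkₐ ℂ (Ideal.span {(X j - X i : Pol)}) := by
    apply MvPolynomial.algHom_ext
    intro k
    have hij : (Ideal.Quotient.mkₐ ℂ (Ideal.span {(X j - X i : Pol)})) (X j)
        = (Ideal.Quotient.mkₐ ℂ (Ideal.span {(X j - X i : Pol)})) (X i) := by
      simp only [Ideal.Quotient.mkₐ_eq_mk]
      rw [Ideal.Quotient.eq]
      exact Ideal.mem_span_singleton_self _
    simp only [AlgHom.comp_apply, rename_X]
    by_cases h1 : k = i
    · subst h1; rw [Equiv.swap_apply_left, hij]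
    · by_cases h2 : k = j
      · subst h2; rw [Equiv.swap_apply_right, hij]
      · rw [Equiv.swap_apply_of_ne_of_ne h1 h2]
  have h := DFunLike.congr_fun this f
  simpa using h

lemma exists_hecke (i : ℕ) (f : Pol) : ∃ g : Pol,
    (X (i + 1) - X i) * g =
      (C qc * X i - C (qc ^ 2) * X (i + 1)) * rename (sw i) f - C (qc - qc ^ 2) * X (i + 1) * f := by
  obtain ⟨h, hh⟩ := dvd_rename_swap_sub i (i + 1) f
  refine ⟨C (qc - qc ^ 2) * X (i + 1) * h - C qc * rename (sw i) f, ?_⟩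
  have : rename (sw i) f = f + (X (i + 1) - X i) * h := by rw [← hh]; ring
  rw [this]
  simp only [C_sub]
  ring

/-- The Demazure–Lusztig type operator acting on polynomials. -/
def heckeT (i : ℕ) (f : Pol) : Pol := (exists_hecke i f).choose

lemma heckeT_spec (i : ℕ) (f : Pol) :
    (X (i + 1) - X i) * heckeT i f =
      (C qc * X i - C (qc ^ 2) * X (i + 1)) * rename (sw i) f - C (qc - qc ^ 2) * X (i + 1) * f :=
  (exists_hecke i f).choose_spec

lemma heckeT_eval (i : ℕ) (f : Pol) (z : ℕ → ℂ) :
    (z (i + 1) - z i) * eval z (heckeT i f) =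
      (qc * z i - qc ^ 2 * z (i + 1)) * eval (z ∘ sw i) f - (qc - qc ^ 2) * z (i + 1) * eval z f := by
  have := congrArg (eval z) (heckeT_spec i f)
  simpa [eval_rename] using this

lemma pol_ext_of_ne (D : Pol) (hD : D ≠ 0) {P Q : Pol}
    (h : ∀ z : ℕ → ℂ, eval z D ≠ 0 → eval z P = eval z Q) : P = Q := by
  have : D * (P - Q) = 0 := by
    apply MvPolynomial.funext
    intro z
    by_cases hz : eval z D = 0
    · simp [hz]
    · simp [h z hz]
  rcases mul_eq_zero.1 this with h | h
  · exact absurd h hD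
  · exact sub_eq_zero.1 h

lemma X_sub_X_ne_zero {i j : ℕ} (h : i ≠ j) : (X i - X j : Pol) ≠ 0 := by
  rw [sub_ne_zero]
  exact fun h' => h (X_injective h')

lemma heckeT_smul (i : ℕ) (c : ℂ) (f : Pol) : heckeT i (C c * f) = C c * heckeT i f := by
  apply mul_left_cancel₀ (X_sub_X_ne_zero (show i + 1 ≠ i by omega))
  rw [heckeT_spec, mul_left_comm (X (i + 1) - X i) (C c), heckeT_spec]
  simp only [map_mul, rename_C]
  ring

lemma heckeT_eval' (i : ℕ) (f : Pol) (z : ℕ → ℂ) (h : z (i + 1) - z i ≠ 0) :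
    eval z (heckeT i f) =
      ((qc * z i - qc ^ 2 * z (i + 1)) * eval (z ∘ sw i) f
        - (qc - qc ^ 2) * z (i + 1) * eval z f) / (z (i + 1) - z i) := by
  rw [eq_div_iff h, mul_comm, heckeT_eval]

lemma heckeT_comm (i j : ℕ) (h : i + 2 ≤ j) (f : Pol) :
    heckeT i (heckeT j f) = heckeT j (heckeT i f) := by
  apply pol_ext_of_ne ((X (i + 1) - X i) * (X (j + 1) - X j))
    (mul_ne_zero (X_sub_X_ne_zero (by omega)) (X_sub_X_ne_zero (by omega)))
  intro z hz
  simp only [map_mul, map_sub, eval_X] at hz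
  have h1 := left_ne_zero_of_mul hz
  have h2 := right_ne_zero_of_mul hz
  have e1 : (z ∘ sw i) j = z j := by
    simp only [Function.comp]; rw [Equiv.swap_apply_of_ne_of_ne] <;> omega
  have e2 : (z ∘ sw i) (j + 1) = z (j + 1) := by
    simp only [Function.comp]; rw [Equiv.swap_apply_of_ne_of_ne] <;> omega
  have e3 : (z ∘ sw j) i = z i := by
    simp only [Function.comp]; rw [Equiv.swap_apply_of_ne_of_ne] <;> omega
  have e4 : (z ∘ sw j) (i + 1) = z (i + 1) := by
    simp only [Function.comp]; rw [Equiv.swap_apply_of_ne_of_ne] <;> omega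
  have e5 : (z ∘ sw j) ∘ sw i = (z ∘ sw i) ∘ sw j := by
    have : (sw j) * (sw i) = (sw i) * (sw j) := by
      apply Equiv.Perm.Disjoint.commute
      intro x
      by_cases hx : x = j ∨ x = j + 1
      · right; rw [Equiv.swap_apply_of_ne_of_ne] <;> omega
      · left; rw [Equiv.swap_apply_of_ne_of_ne] <;> omega
    funext x
    have := congrArg (fun p => z (p x)) this
    simpa using this
  rw [heckeT_eval' i _ z h1, heckeT_eval' j _ z h2, heckeT_eval' j _ z h2, heckeT_eval' i _ z h1,
    heckeT_eval' j _ (z ∘ sw i) (by rw [e1, e2]; exact h2),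
    heckeT_eval' i _ (z ∘ sw j) (by rw [e3, e4]; exact h1), e1, e2, e3, e4, e5]
  field_simp
  ring

lemma heckeT_braid (i : ℕ) (f : Pol) :
    heckeT i (heckeT (i + 1) (heckeT i f)) = heckeT (i + 1) (heckeT i (heckeT (i + 1) f)) := by
  apply pol_ext_of_ne ((X (i + 1) - X i) * ((X (i + 1 + 1) - X (i + 1)) * (X (i + 1 + 1) - X i)))
    (mul_ne_zero (X_sub_X_ne_zero (by omega)) (mul_ne_zero (X_sub_X_ne_zero (by omega))
      (X_sub_X_ne_zero (by omega))))
  intro z hz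
  simp only [map_mul, map_sub, eval_X] at hz
  have h1 := left_ne_zero_of_mul hz
  have h2 := left_ne_zero_of_mul (right_ne_zero_of_mul hz)
  have h3 := right_ne_zero_of_mul (right_ne_zero_of_mul hz)
  have a1 : ∀ y : ℕ → ℂ, (y ∘ sw i) i = y (i + 1) := fun y => by simp
  have a2 : ∀ y : ℕ → ℂ, (y ∘ sw i) (i + 1) = y i := fun y => by simp
  have a3 : ∀ y : ℕ → ℂ, (y ∘ sw i) (i + 1 + 1) = y (i + 1 + 1) := fun y => by
    simp only [Function.comp]; rw [Equiv.swap_apply_of_ne_of_ne] <;> omega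
  have b1 : ∀ y : ℕ → ℂ, (y ∘ sw (i + 1)) i = y i := fun y => by
    simp only [Function.comp]; rw [Equiv.swap_apply_of_ne_of_ne] <;> omega
  have b2 : ∀ y : ℕ → ℂ, (y ∘ sw (i + 1)) (i + 1) = y (i + 1 + 1) := fun y => by simp
  have b3 : ∀ y : ℕ → ℂ, (y ∘ sw (i + 1)) (i + 1 + 1) = y (i + 1) := fun y => by simp
  have c1 : ∀ y : ℕ → ℂ, (y ∘ sw i) ∘ sw i = y := fun y => by funext x; simp
  have c2 : ∀ y : ℕ → ℂ, (y ∘ sw (i + 1)) ∘ sw (i + 1) = y := fun y => by funext x; simp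
  have c3 : ((z ∘ sw (i + 1)) ∘ sw i) ∘ sw (i + 1) = ((z ∘ sw i) ∘ sw (i + 1)) ∘ sw i := by
    funext x
    simp only [Function.comp]
    congr 1
    simp only [Equiv.swap_apply_def]
    split_ifs <;> omega
  have n1 : z i - z (i + 1) ≠ 0 := by rw [← neg_sub]; exact neg_ne_zero.2 h1
  have n2 : z (i + 1) - z (i + 1 + 1) ≠ 0 := by rw [← neg_sub]; exact neg_ne_zero.2 h2
  have n3 : z i - z (i + 1 + 1) ≠ 0 := by rw [← neg_sub]; exact neg_ne_zero.2 h3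
  have q3 := qc_rel
  simp (disch := simp only [a1, a2, a3, b1, b2, b3, ne_eq]; assumption) only
    [heckeT_eval' i, heckeT_eval' (i + 1), a1, a2, a3, b1, b2, b3, c1, c2, c3]
  generalize eval z f = f0
  generalize eval (z ∘ sw i) f = f1
  generalize eval (z ∘ sw (i + 1)) f = f2
  generalize eval ((z ∘ sw i) ∘ sw (i + 1)) f = f3
  generalize eval ((z ∘ sw (i + 1)) ∘ sw i) f = f4
  generalize eval (((z ∘ sw i) ∘ sw (i + 1)) ∘ sw i) f = f5
  generalize z (i + 1 + 1) = u at *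
  generalize z (i + 1) = v at *
  generalize z i = w at *
  have e1 : w - v = -(v - w) := by ring
  have e2 : v - u = -(u - v) := by ring
  rw [e1, e2]
  field_simp
  ring

/-- Total position of the down spins among the first `N` sites. -/
def wt (N : ℕ) (α : ℕ → Bool) : ℕ := ∑ i ∈ Finset.range N, if α i then 0 else i

lemma wt_swap (N i : ℕ) (α : ℕ → Bool) (hi : i + 1 < N) (h1 : α i = true)
    (h2 : α (i + 1) = false) : wt N α = wt N (α ∘ sw i) + 1 := by
  have key : ∀ β : ℕ → Bool, wt N β = (∑ j ∈ ((Finset.range N).erase i).erase (i + 1),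
      if β j then 0 else j) + (if β (i + 1) then 0 else i + 1) + (if β i then 0 else i) := by
    intro β
    unfold wt
    rw [← Finset.sum_erase_add _ _ (show i ∈ Finset.range N by simp; omega),
      ← Finset.sum_erase_add _ _ (show i + 1 ∈ (Finset.range N).erase i by simp; omega)]
  rw [key, key (α ∘ sw i)]
  have : (∑ j ∈ ((Finset.range N).erase i).erase (i + 1), if (α ∘ sw i) j then 0 else j)
      = ∑ j ∈ ((Finset.range N).erase i).erase (i + 1), if α j then 0 else j := by
    apply Finset.sum_congr rfl
    intro j hj
    simp only [Finset.mem_erase] at hj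
    have e : (α ∘ sw i) j = α j := by
      simp only [Function.comp]; rw [Equiv.swap_apply_of_ne_of_ne hj.2.1 hj.1]
    simp only [e]
  rw [this]
  simp [h1, h2]
  omega

/-- The product component attached to sorted configurations. -/
def basePol (N : ℕ) (α : ℕ → Bool) : Pol :=
  ∏ i ∈ Finset.range N, ∏ j ∈ Finset.range N,
    if i < j ∧ α i = α j then C qc * X i - C (qc ^ 2) * X j else 1

open Classical in
/-- Components of the inhomogeneous ground state, by recursion on the number of inversions. -/
def phiAux (N : ℕ) : ℕ → (ℕ → Bool) → Pol
  | 0, α => basePol N α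
  | m + 1, α =>
    if h : ∃ i, i + 1 < N ∧ α i = true ∧ α (i + 1) = false then
      heckeT h.choose (phiAux N m (α ∘ sw h.choose))
    else basePol N α

/-- Components of the inhomogeneous ground state. -/
def phiPol (N : ℕ) (α : ℕ → Bool) : Pol := phiAux N (wt N α) α

lemma phiPol_sorted (N : ℕ) (α : ℕ → Bool)
    (h : ¬ ∃ i, i + 1 < N ∧ α i = true ∧ α (i + 1) = false) : phiPol N α = basePol N α := by
  unfold phiPol
  cases wt N α with
  | zero => rfl
  | succ m => rw [phiAux, dif_neg h]

lemma phiPol_step (N : ℕ) (α : ℕ → Bool)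
    (h : ∃ i, i + 1 < N ∧ α i = true ∧ α (i + 1) = false) :
    ∃ i, i + 1 < N ∧ α i = true ∧ α (i + 1) = false ∧
      phiPol N α = heckeT i (phiPol N (α ∘ sw i)) := by
  classical
  refine ⟨h.choose, h.choose_spec.1, h.choose_spec.2.1, h.choose_spec.2.2, ?_⟩
  have := wt_swap N _ α h.choose_spec.1 h.choose_spec.2.1 h.choose_spec.2.2
  unfold phiPol
  rw [this, phiAux, dif_pos h]

lemma comp_sw_sw_comm (α : ℕ → Bool) (i j : ℕ) (h : i + 2 ≤ j ∨ j + 2 ≤ i) :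
    (α ∘ sw i) ∘ sw j = (α ∘ sw j) ∘ sw i := by
  funext x
  simp only [Function.comp]
  congr 1
  simp only [Equiv.swap_apply_def]
  split_ifs <;> omega

lemma heckeT_comm' (i j : ℕ) (h : i + 2 ≤ j ∨ j + 2 ≤ i) (f : Pol) :
    heckeT i (heckeT j f) = heckeT j (heckeT i f) := by
  rcases h with h | h
  · exact heckeT_comm i j h f
  · exact (heckeT_comm j i h f).symm

lemma comp_sw_of_ne (α : ℕ → Bool) (i j : ℕ) (h1 : j ≠ i) (h2 : j ≠ i + 1) :
    (α ∘ sw i) j = α j := by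
  simp only [Function.comp]
  rw [Equiv.swap_apply_of_ne_of_ne h1 h2]

lemma comp_sw_left (α : ℕ → Bool) (i : ℕ) : (α ∘ sw i) i = α (i + 1) := by simp

lemma comp_sw_right (α : ℕ → Bool) (i : ℕ) : (α ∘ sw i) (i + 1) = α i := by simp

/-- Being fixed by the Hecke operator up to `q²` from the explicit exchange identity. -/
lemma heckeT_eq_of_aligned (i : ℕ) (f : Pol)
    (h : (C qc * X i - C (qc ^ 2) * X (i + 1)) * rename (sw i) f
      = (C qc * X (i + 1) - C (qc ^ 2) * X i) * f) : heckeT i f = C (qc ^ 2) * f := by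
  apply mul_left_cancel₀ (X_sub_X_ne_zero (show i + 1 ≠ i by omega))
  rw [heckeT_spec, h, C_sub]
  ring

lemma basePol_aligned (N i : ℕ) (α : ℕ → Bool) (hi : i + 1 < N) (h : α i = α (i + 1)) :
    heckeT i (basePol N α) = C (qc ^ 2) * basePol N α := by
  apply heckeT_eq_of_aligned
  set F : ℕ → ℕ → Pol := fun a b =>
    if a < b ∧ α a = α b then C qc * X a - C (qc ^ 2) * X b else 1 with hF
  have hα : ∀ a, α (sw i a) = α a := by
    intro a
    simp only [Equiv.swap_apply_def]
    split_ifs with h1 h2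
    · rw [h1, h]
    · rw [h2, h]
    · rfl
  have hb : basePol N α = ∏ p ∈ Finset.range N ×ˢ Finset.range N, F p.1 p.2 := by
    rw [Finset.prod_product]; rfl
  have hmem : (i, i + 1) ∈ Finset.range N ×ˢ Finset.range N := by simp; omega
  have hmaps : ∀ a, a ∈ Finset.range N → sw i a ∈ Finset.range N := by
    intro a ha
    simp only [Equiv.swap_apply_def, Finset.mem_range] at ha ⊢
    split_ifs <;> omega
  have hF1 : F i (i + 1) = C qc * X i - C (qc ^ 2) * X (i + 1) := by simp [hF, h]
  rw [hb, ← Finset.mul_prod_erase _ _ hmem, map_mul, map_prod]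
  have hren : rename (sw i) (F i (i + 1)) = C qc * X (i + 1) - C (qc ^ 2) * X i := by
    rw [hF1]; simp
  have hrest : ∏ p ∈ (Finset.range N ×ˢ Finset.range N).erase (i, i + 1),
      rename (sw i) (F p.1 p.2) = ∏ p ∈ (Finset.range N ×ˢ Finset.range N).erase (i, i + 1),
        F p.1 p.2 := by
    let g : ℕ × ℕ → ℕ × ℕ := fun p => if p = (i + 1, i) then p else (sw i p.1, sw i p.2)
    have hsw : ∀ a, sw i (sw i a) = a := fun a => Equiv.swap_apply_self _ _ a
    have hne : ∀ p : ℕ × ℕ, p ≠ (i, i + 1) → p ≠ (i + 1, i) →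
        (sw i p.1, sw i p.2) ≠ (i, i + 1) ∧ (sw i p.1, sw i p.2) ≠ (i + 1, i) := by
      intro p h1 h2
      constructor
      · intro h3
        have h4 := congrArg (fun p => (sw i p.1, sw i p.2)) h3
        simp at h4
        exact h2 h4
      · intro h3
        have h4 := congrArg (fun p => (sw i p.1, sw i p.2)) h3
        simp at h4
        exact h1 h4
    apply Finset.prod_nbij' g g
    · intro p hp
      simp only [Finset.mem_erase, Finset.mem_product] at hp ⊢
      simp only [g]
      split_ifs with h1
      · exact hp
      · exact ⟨(hne p hp.1 h1).1, hmaps _ hp.2.1, hmaps _ hp.2.2⟩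
    · intro p hp
      simp only [Finset.mem_erase, Finset.mem_product] at hp ⊢
      simp only [g]
      split_ifs with h1
      · exact hp
      · exact ⟨(hne p hp.1 h1).1, hmaps _ hp.2.1, hmaps _ hp.2.2⟩
    · intro p hp
      simp only [Finset.mem_erase] at hp
      simp only [g]
      by_cases h1 : p = (i + 1, i)
      · simp [h1]
      · rw [if_neg h1, if_neg (hne p hp.1 h1).2, hsw, hsw]
    · intro p hp
      simp only [Finset.mem_erase] at hp
      simp only [g]
      by_cases h1 : p = (i + 1, i)
      · simp [h1]
      · rw [if_neg h1, if_neg (hne p hp.1 h1).2, hsw, hsw]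
    · intro p hp
      simp only [Finset.mem_erase] at hp
      simp only [g]
      by_cases h1 : p = (i + 1, i)
      · simp [h1, hF]
      · rw [if_neg h1]
        simp only [hF, hα]
        have hlt : sw i p.1 < sw i p.2 ↔ p.1 < p.2 := by
          have h2 := hp.1
          simp only [ne_eq, Prod.ext_iff] at h1 h2
          simp only [Equiv.swap_apply_def]
          split_ifs <;> omega
        by_cases hc : p.1 < p.2 ∧ α p.1 = α p.2
        · rw [if_pos hc, if_pos ⟨hlt.2 hc.1, hc.2⟩]; simp
        · rw [if_neg hc, if_neg (by rw [hlt]; exact hc)]; simp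
  rw [hren, hrest, hF1]
  ring

theorem phiPol_exchange (N : ℕ) : ∀ m : ℕ, ∀ α : ℕ → Bool, wt N α = m →
    (∀ i, i + 1 < N → α i = true → α (i + 1) = false →
      phiPol N α = heckeT i (phiPol N (α ∘ sw i))) ∧
    (∀ i, i + 1 < N → α i = α (i + 1) → heckeT i (phiPol N α) = C (qc ^ 2) * phiPol N α) := by
  intro m
  induction m using Nat.strong_induction_on with
  | _ m ih =>
  intro α hm
  have IHa : ∀ β : ℕ → Bool, wt N β < m → ∀ i, i + 1 < N → β i = true → β (i + 1) = false →
      phiPol N β = heckeT i (phiPol N (β ∘ sw i)) := fun β hβ => (ih _ hβ β rfl).1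
  have IHb : ∀ β : ℕ → Bool, wt N β < m → ∀ i, i + 1 < N → β i = β (i + 1) →
      heckeT i (phiPol N β) = C (qc ^ 2) * phiPol N β := fun β hβ => (ih _ hβ β rfl).2
  have hA : ∀ i, i + 1 < N → α i = true → α (i + 1) = false →
      phiPol N α = heckeT i (phiPol N (α ∘ sw i)) := by
    intro i hi h1 h2
    obtain ⟨j, hj, h3, h4, h5⟩ := phiPol_step N α ⟨i, hi, h1, h2⟩
    by_cases hij : i = j
    · subst hij; exact h5
    have hfar : i + 2 ≤ j ∨ j + 2 ≤ i := by
      by_contra hcon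
      have : j = i + 1 ∨ i = j + 1 := by omega
      rcases this with h | h
      · subst h; rw [h2] at h3; exact absurd h3 (by simp)
      · subst h; rw [h1] at h4; exact absurd h4 (by simp)
    have w1 := wt_swap N i α hi h1 h2
    have w2 := wt_swap N j α hj h3 h4
    have e1 := IHa (α ∘ sw i) (by omega) j hj
      (by rw [comp_sw_of_ne _ _ _ (by omega) (by omega), h3])
      (by rw [comp_sw_of_ne _ _ _ (by omega) (by omega), h4])
    have e2 := IHa (α ∘ sw j) (by omega) i hi
      (by rw [comp_sw_of_ne _ _ _ (by omega) (by omega), h1])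
      (by rw [comp_sw_of_ne _ _ _ (by omega) (by omega), h2])
    rw [h5, e2, e1, comp_sw_sw_comm α i j hfar, heckeT_comm' i j hfar]
  refine ⟨hA, ?_⟩
  intro i hi hal
  by_cases hd : ∃ j, j + 1 < N ∧ α j = true ∧ α (j + 1) = false
  swap
  · rw [phiPol_sorted N α hd]
    exact basePol_aligned N i α hi hal
  obtain ⟨j, hj, h3, h4⟩ := hd
  have w := wt_swap N j α hj h3 h4
  rw [hA j hj h3 h4]
  by_cases hfar : i + 2 ≤ j ∨ j + 2 ≤ i
  · rw [heckeT_comm' i j hfar, IHb (α ∘ sw j) (by omega) i hi, heckeT_smul]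
    rw [comp_sw_of_ne _ _ _ (by omega) (by omega), comp_sw_of_ne _ _ _ (by omega) (by omega), hal]
  have : j = i ∨ j = i + 1 ∨ i = j + 1 := by omega
  rcases this with h | h | h
  · subst h; rw [h3, h4] at hal; exact absurd hal (by simp)
  · subst h
    have g1 : (α ∘ sw (i + 1)) i = true := by
      rw [comp_sw_of_ne _ _ _ (by omega) (by omega), hal, h3]
    have g2 : (α ∘ sw (i + 1)) (i + 1) = false := by rw [comp_sw_left, h4]
    have w2 := wt_swap N i (α ∘ sw (i + 1)) hi g1 g2
    rw [IHa (α ∘ sw (i + 1)) (by omega) i hi g1 g2, heckeT_braid,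
      IHb ((α ∘ sw (i + 1)) ∘ sw i) (by omega) (i + 1) hj, heckeT_smul, heckeT_smul]
    rw [comp_sw_right, g1, comp_sw_of_ne _ _ _ (by omega) (by omega), comp_sw_right, h3]
  · subst h
    have g1 : (α ∘ sw j) (j + 1) = true := by rw [comp_sw_right, h3]
    have g2 : (α ∘ sw j) (j + 1 + 1) = false := by
      rw [comp_sw_of_ne _ _ _ (by omega) (by omega), ← hal, h4]
    have w2 := wt_swap N (j + 1) (α ∘ sw j) hi g1 g2
    rw [IHa (α ∘ sw j) (by omega) (j + 1) hi g1 g2, ← heckeT_braid,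
      IHb ((α ∘ sw j) ∘ sw (j + 1)) (by omega) j hj, heckeT_smul, heckeT_smul]
    rw [comp_sw_left, g2, comp_sw_of_ne _ _ _ (by omega) (by omega), comp_sw_left, h4]

/-- Degree bound in each variable separately. -/
lemma heckeT_degreeOf (d i : ℕ) (f : Pol) (hf : ∀ j, degreeOf j f ≤ d) (j : ℕ) :
    degreeOf j (heckeT i f) ≤ d := by
  by_cases h0 : heckeT i f = 0
  · simp [h0]
  have hren : ∀ j, degreeOf j (rename (sw i) f) ≤ d := by
    intro j
    have := degreeOf_rename_of_injective (p := f) (sw i).injective (sw i j)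
    rw [Equiv.swap_apply_self] at this
    rw [this]; exact hf _
  have h1 := congrArg (degreeOf j) (heckeT_spec i f)
  rw [degreeOf_mul_eq (X_sub_X_ne_zero (by omega)) h0] at h1
  have hX : ∀ k, degreeOf j (X k : Pol) = if j = k then 1 else 0 := fun k => by
    rw [degreeOf_X]
  have hCX : ∀ (c : ℂ) k, degreeOf j (C c * X k : Pol) ≤ if j = k then 1 else 0 := fun c k => by
    rw [← hX k]; exact degreeOf_C_mul_le _ _ _
  have hn1 : degreeOf j ((C qc * X i - C (qc ^ 2) * X (i + 1)) * rename (sw i) f) ≤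
      (if j = i ∨ j = i + 1 then 1 else 0) + d := by
    refine (degreeOf_mul_le _ _ _).trans (add_le_add ?_ (hren j))
    refine (degreeOf_sub_le _ _ _).trans (max_le ((hCX _ _).trans ?_) ((hCX _ _).trans ?_)) <;>
      split_ifs <;> omega
  have hn2 : degreeOf j (C (qc - qc ^ 2) * X (i + 1) * f) ≤
      (if j = i ∨ j = i + 1 then 1 else 0) + d := by
    refine (degreeOf_mul_le _ _ _).trans (add_le_add ((hCX _ _).trans ?_) (hf j))
    split_ifs <;> omega
  have hn := (degreeOf_sub_le j _ _).trans (max_le hn1 hn2)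
  rw [← h1] at hn
  by_cases hj : j = i ∨ j = i + 1
  · rw [if_pos hj] at hn
    have : 1 ≤ degreeOf j (X (i + 1) - X i : Pol) := by
      by_contra hlt
      have h0 : degreeOf j (X (i + 1) - X i : Pol) = 0 := by omega
      rcases hj with rfl | rfl
      · have := degreeOf_add_le j (X (j + 1) : Pol) (-(X (j + 1) - X j))
        rw [show (X (j + 1) + -(X (j + 1) - X j) : Pol) = X j by ring, degreeOf_neg, h0, hX, hX] at this
        simp at this
      · have := degreeOf_add_le (i + 1) (X (i + 1) - X i : Pol) (X i)
        rw [show ((X (i + 1) - X i) + X i : Pol) = X (i + 1) by ring, h0, hX, hX] at this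
        simp at this
    omega
  · rw [if_neg hj] at hn
    omega

lemma basePol_degreeOf (N d : ℕ) (α : ℕ → Bool)
    (h : ∀ s : Bool, ((Finset.range N).filter (fun i => α i = s)).card ≤ d + 1) (j : ℕ) :
    degreeOf j (basePol N α) ≤ d := by
  have hfac : ∀ a b : ℕ, degreeOf j (if a < b ∧ α a = α b then
      (C qc * X a - C (qc ^ 2) * X b : Pol) else 1) ≤
      if a < b ∧ α a = α b ∧ (j = a ∨ j = b) then 1 else 0 := by
    intro a b
    by_cases hab : a < b ∧ α a = α b
    · rw [if_pos hab]
      refine (degreeOf_sub_le _ _ _).trans (max_le ((degreeOf_C_mul_le _ _ _).trans ?_)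
        ((degreeOf_C_mul_le _ _ _).trans ?_)) <;> rw [degreeOf_X] <;> split_ifs <;> simp_all
    · rw [if_neg hab]; simp
  have h1 : degreeOf j (basePol N α) ≤ ∑ a ∈ Finset.range N, ∑ b ∈ Finset.range N,
      if a < b ∧ α a = α b ∧ (j = a ∨ j = b) then 1 else 0 := by
    refine (degreeOf_prod_le _ _ _).trans (Finset.sum_le_sum fun a _ => ?_)
    exact (degreeOf_prod_le _ _ _).trans (Finset.sum_le_sum fun b _ => hfac a b)
  refine h1.trans ?_
  rw [← Finset.sum_product', ← Finset.card_filter]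
  by_cases hj : j < N
  swap
  · rw [Finset.card_eq_zero.2]
    · omega
    · ext p
      simp only [Finset.mem_filter, Finset.mem_product, Finset.mem_range]
      constructor
      · rintro ⟨h1, h2⟩; omega
      · intro h; simp at h
  have h2 : (((Finset.range N).filter (fun i => α i = α j)).erase j).card ≤ d := by
    rw [Finset.card_erase_of_mem (by simp [hj])]
    have := h (α j)
    omega
  refine le_trans ?_ h2
  apply Finset.card_le_card_of_injOn (fun p : ℕ × ℕ => p.1 + p.2 - j)
  · intro p hp
    simp only [Finset.coe_filter, Finset.mem_product, Finset.mem_range, Set.mem_ofPred_eq] at hp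
    simp only [Finset.coe_erase, Finset.coe_filter, Finset.mem_range, Set.mem_sdiff,
      Set.mem_ofPred_eq, Set.mem_singleton_iff]
    obtain ⟨⟨g1, g2⟩, g3, g4, h5⟩ := hp
    rcases h5 with h5 | h5
    · subst h5
      rw [show p.1 + p.2 - p.1 = p.2 by omega]
      exact ⟨⟨g2, g4.symm⟩, by omega⟩
    · subst h5
      rw [show p.1 + p.2 - p.2 = p.1 by omega]
      exact ⟨⟨g1, g4⟩, by omega⟩
  · intro p hp p' hp' heq
    simp only [Finset.coe_filter, Finset.mem_product, Finset.mem_range, Set.mem_ofPred_eq] at hp hp'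
    simp only at heq
    apply Prod.ext <;> omega

lemma phiPol_degreeOf (N d : ℕ) : ∀ m : ℕ, ∀ α : ℕ → Bool, wt N α = m →
    (∀ s : Bool, ((Finset.range N).filter (fun i => α i = s)).card ≤ d + 1) →
    ∀ j, degreeOf j (phiPol N α) ≤ d := by
  intro m
  induction m using Nat.strong_induction_on with
  | _ m ih =>
  intro α hm h
  by_cases hd : ∃ i, i + 1 < N ∧ α i = true ∧ α (i + 1) = false
  swap
  · rw [phiPol_sorted N α hd]
    exact basePol_degreeOf N d α h
  obtain ⟨i, hi, h1, h2, h3⟩ := phiPol_step N α hd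
  rw [h3]
  have w := wt_swap N i α hi h1 h2
  apply heckeT_degreeOf
  apply ih (wt N (α ∘ sw i)) (by omega) _ rfl
  intro s
  refine le_trans (le_of_eq ?_) (h s)
  have hmaps : ∀ a, a < N → sw i a < N := by
    intro a ha
    simp only [Equiv.swap_apply_def]
    split_ifs <;> omega
  apply Finset.card_nbij' (sw i) (sw i)
  · intro a ha; simp at ha ⊢; exact ⟨hmaps a ha.1, ha.2⟩
  · intro a ha; simp at ha ⊢; exact ⟨hmaps a ha.1, ha.2⟩
  · intro a _; simp
  · intro a _; simp

/-- Being a polynomial function of degree at most `d`. -/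
def PolyDeg (d : ℕ) (g : ℂ → ℂ) : Prop :=
  ∃ p : Polynomial ℂ, p.natDegree ≤ d ∧ ∀ t, g t = p.eval t

lemma polyDeg_const (d : ℕ) (c : ℂ) : PolyDeg d fun _ => c :=
  ⟨Polynomial.C c, by simp, fun t => by simp⟩

lemma PolyDeg.mono {d e : ℕ} (h : d ≤ e) {g : ℂ → ℂ} (hg : PolyDeg d g) : PolyDeg e g := by
  obtain ⟨p, hp, hp'⟩ := hg
  exact ⟨p, hp.trans h, hp'⟩

lemma PolyDeg.add {d : ℕ} {f g : ℂ → ℂ} (hf : PolyDeg d f) (hg : PolyDeg d g) :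
    PolyDeg d fun t => f t + g t := by
  obtain ⟨p, hp, hp'⟩ := hf
  obtain ⟨r, hr, hr'⟩ := hg
  exact ⟨p + r, (Polynomial.natDegree_add_le _ _).trans (max_le hp hr),
    fun t => by simp only [hp', hr', Polynomial.eval_add]⟩

lemma PolyDeg.mul {d e : ℕ} {f g : ℂ → ℂ} (hf : PolyDeg d f) (hg : PolyDeg e g) :
    PolyDeg (d + e) fun t => f t * g t := by
  obtain ⟨p, hp, hp'⟩ := hf
  obtain ⟨r, hr, hr'⟩ := hg
  exact ⟨p * r, Polynomial.natDegree_mul_le.trans (add_le_add hp hr),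
    fun t => by simp only [hp', hr', Polynomial.eval_mul]⟩

lemma PolyDeg.const_mul {d : ℕ} {g : ℂ → ℂ} (c : ℂ) (hg : PolyDeg d g) :
    PolyDeg d fun t => c * g t := by
  have := (polyDeg_const 0 c).mul hg
  rwa [zero_add] at this

lemma PolyDeg.sub {d : ℕ} {f g : ℂ → ℂ} (hf : PolyDeg d f) (hg : PolyDeg d g) :
    PolyDeg d fun t => f t - g t := by
  have := hf.add (hg.const_mul (-1))
  simpa [sub_eq_add_neg] using this

lemma polyDeg_affine (a b : ℂ) : PolyDeg 1 fun t => a * t + b :=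
  ⟨Polynomial.C a * Polynomial.X + Polynomial.C b, Polynomial.natDegree_linear_le,
    fun t => by simp⟩

lemma PolyDeg.eq_zero_of_roots {d : ℕ} {g : ℂ → ℂ} (hg : PolyDeg d g) (S : Finset ℂ)
    (hS : d < S.card) (h : ∀ t ∈ S, g t = 0) (t : ℂ) : g t = 0 := by
  obtain ⟨p, hp, hp'⟩ := hg
  have : p = 0 := Polynomial.eq_zero_of_natDegree_lt_card_of_eval_eq_zero' p S
    (fun i hi => by rw [← hp']; exact h i hi) (by omega)
  rw [hp', this, Polynomial.eval_zero]

lemma PolyDeg.eq_zero_of_cofinite {d : ℕ} {g : ℂ → ℂ} (hg : PolyDeg d g) (S : Set ℂ)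
    (hS : S.Finite) (h : ∀ t, t ∉ S → g t = 0) (t : ℂ) : g t = 0 := by
  have hinf : (Sᶜ).Infinite := hS.infinite_compl
  obtain ⟨T, hT, hc⟩ := hinf.exists_subset_card_eq (d + 1)
  exact hg.eq_zero_of_roots T (by omega) (fun i hi => h i (hT hi)) t

/-- Components of the inhomogeneous ground state, indexed by words. -/
def phi (w : List Bool) (zs : List ℂ) : ℂ :=
  eval (fun i => zs.getD i 0) (phiPol w.length (fun i => w.getD i false))

lemma getD_swap {β : Type*} (A B : List β) (a b d : β) :
    (fun i => (A ++ a :: b :: B).getD i d) ∘ sw A.length = fun i => (A ++ b :: a :: B).getD i d := by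
  funext i
  simp only [Function.comp]
  rcases lt_trichotomy i A.length with h | h | h
  · rw [Equiv.swap_apply_of_ne_of_ne (by omega) (by omega)]
    rw [List.getD_append _ _ _ _ h, List.getD_append _ _ _ _ h]
  · subst h
    rw [Equiv.swap_apply_left, List.getD_append_right _ _ _ _ (by omega),
      List.getD_append_right _ _ _ _ (by omega)]
    simp
  · obtain ⟨k, rfl⟩ : ∃ k, i = A.length + 1 + k := ⟨i - A.length - 1, by omega⟩
    cases k with
    | zero =>
      rw [add_zero, Equiv.swap_apply_right, List.getD_append_right _ _ _ _ (by omega),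
        List.getD_append_right _ _ _ _ (by omega)]
      simp
    | succ k =>
      rw [Equiv.swap_apply_of_ne_of_ne (by omega) (by omega),
        List.getD_append_right _ _ _ _ (by omega), List.getD_append_right _ _ _ _ (by omega)]
      rw [show A.length + 1 + (k + 1) - A.length = k + 2 by omega]
      simp

lemma getD_append_at {β : Type*} (A B : List β) (a d : β) :
    (A ++ a :: B).getD A.length d = a := by
  rw [List.getD_append_right _ _ _ _ (by omega)]; simp

lemma getD_append_at_succ {β : Type*} (A B : List β) (a b d : β) :
    (A ++ a :: b :: B).getD (A.length + 1) d = b := by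
  rw [List.getD_append_right _ _ _ _ (by omega)]; simp

theorem phi_exch_aligned (U V : List Bool) (s : Bool) (A B : List ℂ) (a b : ℂ)
    (h : U.length = A.length) :
    (qc * a - qc ^ 2 * b) * phi (U ++ s :: s :: V) (A ++ b :: a :: B) =
      (qc * b - qc ^ 2 * a) * phi (U ++ s :: s :: V) (A ++ a :: b :: B) := by
  have h1 := (phiPol_exchange (U ++ s :: s :: V).length _
    (fun i => (U ++ s :: s :: V).getD i false) rfl).2 U.length (by simp)
    (by simp only [getD_append_at, getD_append_at_succ])
  have h2 := heckeT_eval U.length (phiPol (U ++ s :: s :: V).length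
    (fun i => (U ++ s :: s :: V).getD i false)) (fun i => (A ++ a :: b :: B).getD i 0)
  rw [h1, h, getD_swap] at h2
  simp only [getD_append_at, getD_append_at_succ, map_mul, eval_C] at h2
  unfold phi
  linear_combination -h2

theorem phi_exch_ft (U V : List Bool) (A B : List ℂ) (a b : ℂ)
    (h : U.length = A.length) :
    (qc * a - qc ^ 2 * b) * phi (U ++ false :: true :: V) (A ++ b :: a :: B) =
      (b - a) * phi (U ++ true :: false :: V) (A ++ a :: b :: B)
      + (qc - qc ^ 2) * b * phi (U ++ false :: true :: V) (A ++ a :: b :: B) := by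
  have h1 := (phiPol_exchange (U ++ true :: false :: V).length _
    (fun i => (U ++ true :: false :: V).getD i false) rfl).1 U.length (by simp)
    (by simp only [getD_append_at]) (by simp only [getD_append_at_succ])
  have h2 := heckeT_eval U.length (phiPol (U ++ true :: false :: V).length
    ((fun i => (U ++ true :: false :: V).getD i false) ∘ sw U.length))
    (fun i => (A ++ a :: b :: B).getD i 0)
  rw [← h1, getD_swap U, h, getD_swap A] at h2
  simp only [getD_append_at, getD_append_at_succ] at h2
  unfold phi
  rw [show (U ++ false :: true :: V).length = (U ++ true :: false :: V).length by simp]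
  linear_combination -h2

lemma natDegree_aeval_le (f : Pol) (j : ℕ) (z : ℕ → ℂ) :
    (aeval (fun i => if i = j then (Polynomial.X : Polynomial ℂ) else Polynomial.C (z i)) f).natDegree
      ≤ degreeOf j f := by
  rw [aeval_def, eval₂_eq]
  apply Polynomial.natDegree_sum_le_of_forall_le
  intro d hd
  have h1 : d j ≤ degreeOf j f := monomial_le_degreeOf j hd
  refine Polynomial.natDegree_mul_le.trans ?_
  have h2 : (algebraMap ℂ (Polynomial ℂ) (coeff d f)).natDegree = 0 := Polynomial.natDegree_C _
  rw [h2, zero_add]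
  refine (Polynomial.natDegree_prod_le _ _).trans ?_
  have h3 : ∀ i ∈ d.support, ((if i = j then (Polynomial.X : Polynomial ℂ)
      else Polynomial.C (z i)) ^ d i).natDegree ≤ if i = j then d j else 0 := by
    intro i _
    by_cases hij : i = j
    · subst hij; simp
    · rw [if_neg hij, if_neg hij, ← Polynomial.C_pow, Polynomial.natDegree_C]
  refine (Finset.sum_le_sum h3).trans ?_
  rw [Finset.sum_ite_eq']
  split_ifs <;> omega

lemma card_filter_getD (w : List Bool) (s : Bool) :
    ((Finset.range w.length).filter (fun i => w.getD i false = s)).card = w.count s := by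
  induction w with
  | nil => simp
  | cons t w ih =>
    rw [List.length_cons, Finset.card_filter, Finset.sum_range_succ', List.count_cons, ← ih,
      Finset.card_filter]
    simp

theorem phi_polyDeg (w : List Bool) (d : ℕ) (h : ∀ s, w.count s ≤ d + 1) (A B : List ℂ) :
    PolyDeg d fun t => phi w (A ++ t :: B) := by
  refine ⟨aeval (fun i => if i = A.length then (Polynomial.X : Polynomial ℂ)
    else Polynomial.C ((A ++ 0 :: B).getD i 0)) (phiPol w.length fun i => w.getD i false),
    (natDegree_aeval_le _ _ _).trans ?_, ?_⟩
  · exact phiPol_degreeOf _ d _ _ rfl (fun s => by rw [card_filter_getD]; exact h s) _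
  · intro t
    unfold phi
    simp only []
    rw [aeval_def, polynomial_eval_eval₂, ← eval₂_id]
    congr 1
    · ext x; simp
    · funext i
      rcases lt_trichotomy i A.length with h | h | h
      · rw [if_neg (by omega), List.getD_append _ _ _ _ h, List.getD_append _ _ _ _ h]; simp
      · subst h
        rw [getD_append_at]; simp
      · rw [if_neg (by omega), List.getD_append_right _ _ _ _ (by omega),
          List.getD_append_right _ _ _ _ (by omega)]
        obtain ⟨k, hk⟩ : ∃ k, i - A.length = k + 1 := ⟨i - A.length - 1, by omega⟩
        rw [hk]; simp

/-- Product of `q x - q² y` over ordered pairs of entries. -/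
def qvan : List ℂ → ℂ
  | [] => 1
  | x :: l => (l.map fun y => qc * x - qc ^ 2 * y).prod * qvan l

lemma eval_basePol_cons (w : List Bool) (s : Bool) (x : ℂ) (l : List ℂ) :
    eval (fun i => (x :: l).getD i 0) (basePol (s :: w).length fun i => (s :: w).getD i false) =
      (∏ j ∈ Finset.range w.length, if s = w.getD j false then qc * x - qc ^ 2 * l.getD j 0 else 1) *
      eval (fun i => l.getD i 0) (basePol w.length fun i => w.getD i false) := by
  unfold basePol
  rw [List.length_cons, Finset.prod_range_succ', mul_comm, map_mul]
  congr 1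
  · rw [Finset.prod_range_succ', map_mul, map_prod]
    simp only [lt_self_iff_false, false_and, if_false, map_one, mul_one]
    apply Finset.prod_congr rfl
    intro j _
    simp only [Nat.zero_lt_succ, true_and, List.getD_cons_zero, List.getD_cons_succ]
    split_ifs <;> simp
  · rw [map_prod, map_prod]
    apply Finset.prod_congr rfl
    intro i _
    rw [Finset.prod_range_succ', map_mul, map_prod, map_prod]
    simp only [Nat.not_lt_zero, false_and, if_false, map_one, mul_one]
    apply Finset.prod_congr rfl
    intro j _
    simp only [List.getD_cons_succ, add_lt_add_iff_right]
    split_ifs <;> simp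

lemma prod_range_getD (l : List ℂ) (g : ℂ → ℂ) :
    ∏ j ∈ Finset.range l.length, g (l.getD j 0) = (l.map g).prod := by
  induction l with
  | nil => simp
  | cons x l ih =>
    rw [List.length_cons, Finset.prod_range_succ', List.map_cons, List.prod_cons, ← ih, mul_comm]
    simp

lemma eval_basePol_true (l : List ℂ) :
    eval (fun i => l.getD i 0) (basePol (List.replicate l.length true).length
      fun i => (List.replicate l.length true).getD i false) = qvan l := by
  induction l with
  | nil => simp [basePol, qvan]
  | cons x l ih =>
    rw [List.length_cons, List.replicate_succ, eval_basePol_cons, ih, qvan,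
      ← prod_range_getD, List.length_replicate]
    congr 1
    apply Finset.prod_congr rfl
    intro j hj
    rw [Finset.mem_range] at hj
    rw [if_pos (by rw [List.getD_replicate _ hj])]

lemma eval_basePol_sorted (A B : List ℂ) :
    eval (fun i => (A ++ B).getD i 0)
      (basePol (List.replicate A.length false ++ List.replicate B.length true).length
      fun i => (List.replicate A.length false ++ List.replicate B.length true).getD i false)
      = qvan A * qvan B := by
  induction A with
  | nil => simpa [qvan] using eval_basePol_true B
  | cons x l ih =>
    rw [List.length_cons, List.replicate_succ, List.cons_append, List.cons_append,
      eval_basePol_cons, ih, qvan, ← prod_range_getD, mul_assoc]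
    congr 1
    rw [List.length_append, List.length_replicate, List.length_replicate, Finset.prod_range_add]
    rw [Finset.prod_congr rfl (g := fun j => qc * x - qc ^ 2 * l.getD j 0)]
    · refine (congrArg _ ?_).trans (mul_one _)
      apply Finset.prod_eq_one
      intro j hj
      rw [Finset.mem_range] at hj
      rw [if_neg]
      rw [List.getD_append_right _ _ _ _ (by simp), List.length_replicate,
        Nat.add_sub_cancel_left, List.getD_replicate _ hj]
      simp
    · intro j hj
      rw [Finset.mem_range] at hj
      rw [List.getD_append _ _ _ _ (by simpa using hj), List.getD_append _ _ _ _ hj,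
        List.getD_replicate _ hj]
      simp

theorem phi_sorted (A B : List ℂ) :
    phi (List.replicate A.length false ++ List.replicate B.length true) (A ++ B)
      = qvan A * qvan B := by
  rw [← eval_basePol_sorted]
  unfold phi
  rw [phiPol_sorted]
  rintro ⟨i, h1, h2, h3⟩
  simp only [List.length_append, List.length_replicate] at h1
  by_cases hi : i < A.length
  · rw [List.getD_append _ _ _ _ (by simpa using hi), List.getD_replicate _ hi] at h2
    exact absurd h2 (by simp)
  · rw [List.getD_append_right _ _ _ _ (by simp; omega), List.length_replicate,
      List.getD_replicate _ (by omega)] at h3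
    exact absurd h3 (by simp)

end Polynomials

theorem phi_exch_tf (U V : List Bool) (A B : List ℂ) (a b : ℂ) (h : U.length = A.length) :
    (qc * a - qc ^ 2 * b) * phi (U ++ true :: false :: V) (A ++ b :: a :: B) =
      (b - a) * phi (U ++ false :: true :: V) (A ++ a :: b :: B)
      + (qc - qc ^ 2) * a * phi (U ++ true :: false :: V) (A ++ a :: b :: B) := by
  by_cases hab : a = b
  · subst hab; ring
  have h1 := phi_exch_ft U V A B a b h
  have h2 := phi_exch_ft U V A B b a h
  apply mul_left_cancel₀ (sub_ne_zero.2 hab)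
  have q3 := qc_rel
  generalize phi (U ++ false :: true :: V) (A ++ a :: b :: B) = F1 at *
  generalize phi (U ++ false :: true :: V) (A ++ b :: a :: B) = F2 at *
  generalize phi (U ++ true :: false :: V) (A ++ a :: b :: B) = T1 at *
  generalize phi (U ++ true :: false :: V) (A ++ b :: a :: B) = T2 at *
  generalize qc = q at *
  grind

/-- Nonzero entries with pairwise distinct cubes. -/
def Gen (l : List ℂ) : Prop := l.Pairwise (fun x y => x ^ 3 ≠ y ^ 3) ∧ ∀ x ∈ l, x ≠ 0

lemma Gen.perm {l l' : List ℂ} (h : l.Perm l') (hl : Gen l) : Gen l' :=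
  ⟨(h.pairwise_iff (fun h => h.symm)).1 hl.1, fun x hx => hl.2 x (h.mem_iff.2 hx)⟩

lemma gen_cons {a : ℂ} {l : List ℂ} :
    Gen (a :: l) ↔ a ≠ 0 ∧ (∀ x ∈ l, a ^ 3 ≠ x ^ 3) ∧ Gen l := by
  unfold Gen
  simp only [List.pairwise_cons, List.mem_cons, forall_eq_or_imp]
  tauto

lemma Gen.append_right {l l' : List ℂ} (h : Gen (l ++ l')) : Gen l' :=
  ⟨(List.pairwise_append.1 h.1).2.1, fun x hx => h.2 x (List.mem_append_right _ hx)⟩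

lemma cube_ne {x z : ℂ} (h : z ^ 3 ≠ x ^ 3) : z - x ≠ 0 ∧ z - qc ^ 2 * x ≠ 0 ∧ z - qc * x ≠ 0 := by
  have key : z ^ 3 - x ^ 3 = (z - x) * ((z - qc ^ 2 * x) * (z - qc * x)) := by
    have := qc_rel
    generalize qc = q at *
    grind
  have h1 : (z - x) * ((z - qc ^ 2 * x) * (z - qc * x)) ≠ 0 := by
    rw [← key]; exact sub_ne_zero.2 h
  exact ⟨left_ne_zero_of_mul h1, left_ne_zero_of_mul (right_ne_zero_of_mul h1),
    right_ne_zero_of_mul (right_ne_zero_of_mul h1)⟩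

lemma phi_pair_aligned (U V : List Bool) (s : Bool) (A B : List ℂ) (a : ℂ) (ha : a ≠ 0)
    (h : U.length = A.length) :
    phi (U ++ s :: s :: V) (A ++ a :: (qc ^ 2 * a) :: B) = 0 := by
  have h1 := phi_exch_aligned U V s A B a (qc ^ 2 * a) h
  have e : qc * a - qc ^ 2 * (qc ^ 2 * a) = 0 := by linear_combination (-qc * a) * qc_cube
  rw [e, zero_mul] at h1
  have e2 : qc * (qc ^ 2 * a) - qc ^ 2 * a = (1 - qc ^ 2) * a := by
    linear_combination a * qc_cube
  rw [e2] at h1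
  have : (1 - qc ^ 2) * a ≠ 0 := by
    apply mul_ne_zero _ ha
    intro h0
    have h1 : (3 : ℂ) = 0 := by linear_combination (1 - qc) * h0 + (2 - qc) * qc_rel
    norm_num at h1
  exact (mul_eq_zero.1 h1.symm).resolve_left this

lemma phi_pair_tf (U V : List Bool) (A B : List ℂ) (a : ℂ) (ha : a ≠ 0)
    (h : U.length = A.length) :
    phi (U ++ true :: false :: V) (A ++ a :: (qc ^ 2 * a) :: B) =
      -qc * phi (U ++ false :: true :: V) (A ++ a :: (qc ^ 2 * a) :: B) := by
  have h1 := phi_exch_ft U V A B a (qc ^ 2 * a) h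
  have q3 := qc_rel
  generalize phi (U ++ true :: false :: V) (A ++ a :: (qc ^ 2 * a) :: B) = T at *
  generalize phi (U ++ false :: true :: V) (A ++ a :: (qc ^ 2 * a) :: B) = F at *
  generalize phi (U ++ false :: true :: V) (A ++ (qc ^ 2 * a) :: a :: B) = F2 at *
  apply mul_left_cancel₀ ha
  generalize qc = q at *
  grind

/-- Moving a pair through a neighbouring site. -/
lemma phi_pair_move (U V : List Bool) (t : Bool) (A B : List ℂ) (x z : ℂ) (hz : z ≠ 0)
    (hx : z ^ 3 ≠ x ^ 3) (h : U.length = A.length) :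
    phi (U ++ false :: true :: t :: V) (A ++ z :: (qc ^ 2 * z) :: x :: B) =
      phi (U ++ t :: false :: true :: V) (A ++ x :: z :: (qc ^ 2 * z) :: B) := by
  have q3 := qc_rel
  obtain ⟨n1, n2, n3⟩ := cube_ne hx
  obtain ⟨n1', n2', n3'⟩ := cube_ne hx.symm
  have hq := qc_ne_zero
  have m1 : qc * x - qc ^ 2 * z ≠ 0 := by
    rw [show qc * x - qc ^ 2 * z = qc * (x - qc * z) by ring]; exact mul_ne_zero hq n3'
  have m2 : qc * x - qc ^ 2 * (qc ^ 2 * z) ≠ 0 := by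
    rw [show qc * x - qc ^ 2 * (qc ^ 2 * z) = qc * (x - z) by
      linear_combination (-z * qc) * qc_cube]; exact mul_ne_zero hq n1'
  have len1 : ∀ (s : Bool) (y : ℂ), (U ++ [s]).length = (A ++ [y]).length := by
    intro s y; simp [h]
  cases t with
  | false =>
    have a1 := phi_pair_aligned (U ++ [true]) V false (A ++ [x]) B z hz (len1 _ _)
    have aT := phi_pair_tf (U ++ [false]) V (A ++ [x]) B z hz (len1 _ _)
    have s1 := phi_exch_aligned U (true :: V) false A ((qc ^ 2 * z) :: B) x z h
    have s2 := phi_exch_ft U (false :: V) A ((qc ^ 2 * z) :: B) x z h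
    have s3 := phi_exch_tf (U ++ [false]) V (A ++ [z]) B x (qc ^ 2 * z) (len1 _ _)
    simp only [List.append_assoc, List.cons_append, List.nil_append] at *
    rw [a1] at s2
    rw [aT] at s2
    have s4 := phi_exch_ft (U ++ [false]) V (A ++ [z]) B x (qc ^ 2 * z) (len1 _ _)
    simp only [List.append_assoc, List.cons_append, List.nil_append] at s4
    apply mul_left_cancel₀ (mul_ne_zero m1 m2)
    generalize phi (U ++ false :: true :: false :: V) (A ++ z :: qc ^ 2 * z :: x :: B) = G at *
    generalize phi (U ++ false :: false :: true :: V) (A ++ x :: z :: qc ^ 2 * z :: B) = p at *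
    generalize phi (U ++ false :: false :: true :: V) (A ++ z :: x :: qc ^ 2 * z :: B) = p1 at *
    generalize phi (U ++ false :: true :: false :: V) (A ++ z :: x :: qc ^ 2 * z :: B) = p2 at *
    clear a1 aT s4
    generalize qc = q at *
    have e1 : (q * x - q ^ 2 * z) * ((q * x - q ^ 2 * (q ^ 2 * z)) * G) =
      (q ^ 2 * z - x) * ((q * z - q ^ 2 * x) * p) + (q - q ^ 2) * x *
        ((q - q ^ 2) * z * (-q * p)) := by
      rw [s3]
      linear_combination (q ^ 2 * z - x) * s1 + (q - q ^ 2) * x * s2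
    rw [mul_assoc, e1]
    clear * - q3
    grind
  | true =>
    have a1 := phi_pair_aligned (U ++ [false]) V true (A ++ [x]) B z hz (len1 _ _)
    have s2 := phi_exch_ft U (true :: V) A ((qc ^ 2 * z) :: B) x z h
    have s3 := phi_exch_aligned (U ++ [false]) V true (A ++ [z]) B x (qc ^ 2 * z) (len1 _ _)
    simp only [List.append_assoc, List.cons_append, List.nil_append] at *
    rw [a1] at s2
    apply mul_left_cancel₀ (mul_ne_zero m1 m2)
    generalize phi (U ++ false :: true :: true :: V) (A ++ z :: qc ^ 2 * z :: x :: B) = G at *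
    generalize phi (U ++ true :: false :: true :: V) (A ++ x :: z :: qc ^ 2 * z :: B) = p at *
    generalize phi (U ++ false :: true :: true :: V) (A ++ z :: x :: qc ^ 2 * z :: B) = p1 at *
    clear a1
    generalize qc = q at *
    have e1 : (q * x - q ^ 2 * z) * ((q * x - q ^ 2 * (q ^ 2 * z)) * G) =
      (q * (q ^ 2 * z) - q ^ 2 * x) * ((z - x) * p) := by
      rw [s3]
      linear_combination (q * (q ^ 2 * z) - q ^ 2 * x) * s2
    rw [mul_assoc, e1]
    clear * - q3
    grind

lemma phi_pair_move_list : ∀ (U W V : List Bool) (A C B : List ℂ) (z : ℂ), z ≠ 0 →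
    (∀ x ∈ A, z ^ 3 ≠ x ^ 3) → W.length = C.length → U.length = A.length →
    phi (W ++ false :: true :: (U ++ V)) (C ++ z :: (qc ^ 2 * z) :: (A ++ B)) =
      phi (W ++ (U ++ false :: true :: V)) (C ++ (A ++ z :: (qc ^ 2 * z) :: B)) := by
  intro U
  induction U with
  | nil =>
    intro W V A C B z _ _ _ h
    rw [List.length_nil, eq_comm, List.length_eq_zero_iff] at h
    subst h
    rfl
  | cons t U ih =>
    intro W V A C B z hz hA h1 h2
    cases A with
    | nil => simp at h2
    | cons x A =>
      have h3 := ih (W ++ [t]) V A (C ++ [x]) B z hz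
        (fun y hy => hA y (List.mem_cons_of_mem _ hy)) (by simp [h1]) (by simpa using h2)
      have h4 := phi_pair_move W (U ++ V) t C (A ++ B) x z hz (hA x (List.mem_cons_self)) h1
      simp only [List.append_assoc, List.cons_append, List.nil_append] at *
      rw [h4, h3]

/-- Number of inversions of a word. -/
def invw : List Bool → ℕ
  | [] => 0
  | true :: w => invw w + w.count false
  | false :: w => invw w

lemma invw_swap (U V : List Bool) :
    invw (U ++ true :: false :: V) = invw (U ++ false :: true :: V) + 1 := by
  induction U with
  | nil => simp [invw]; omega
  | cons s U ih =>
    cases s with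
    | false => simpa [invw] using ih
    | true => simp only [List.cons_append, invw, ih]; simp [List.count_append]; omega

lemma sorted_or_descent (w : List Bool) :
    (∃ d u, w = List.replicate d false ++ List.replicate u true) ∨
      ∃ U V, w = U ++ true :: false :: V := by
  induction w with
  | nil => exact Or.inl ⟨0, 0, rfl⟩
  | cons s w ih =>
    rcases ih with ⟨d, u, rfl⟩ | ⟨U, V, rfl⟩
    · cases s with
      | false => exact Or.inl ⟨d + 1, u, by simp [List.replicate_succ]⟩
      | true =>
        cases d with
        | zero => exact Or.inl ⟨0, u + 1, by simp [List.replicate_succ]⟩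
        | succ d => exact Or.inr ⟨[], List.replicate d false ++ List.replicate u true, by
            simp [List.replicate_succ]⟩
    · exact Or.inr ⟨s :: U, V, by simp⟩

theorem word_induction {P : List Bool → Prop}
    (hs : ∀ d u, P (List.replicate d false ++ List.replicate u true))
    (step : ∀ U V, P (U ++ false :: true :: V) → P (U ++ true :: false :: V)) :
    ∀ w, P w := by
  have : ∀ m w, invw w = m → P w := by
    intro m
    induction m with
    | zero =>
      intro w hw
      rcases sorted_or_descent w with ⟨d, u, rfl⟩ | ⟨U, V, rfl⟩
      · exact hs d u
      · rw [invw_swap] at hw; omega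
    | succ m ih =>
      intro w hw
      rcases sorted_or_descent w with ⟨d, u, rfl⟩ | ⟨U, V, rfl⟩
      · exact hs d u
      · rw [invw_swap] at hw
        exact step U V (ih _ (by omega))
  exact fun w => this _ w rfl

lemma split_length {U V : List Bool} {B : List ℂ} {s t : Bool}
    (h : B.length = (U ++ s :: t :: V).length) :
    ∃ A a b B', B = A ++ a :: b :: B' ∧ U.length = A.length ∧ V.length = B'.length := by
  refine ⟨B.take U.length, ?_⟩
  have h1 : (B.drop U.length).length = V.length + 2 := by
    rw [List.length_drop, h]; simp
  match hd : B.drop U.length, h1 with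
  | a :: b :: B', h1 =>
    refine ⟨a, b, B', ?_, ?_, ?_⟩
    · rw [← hd, List.take_append_drop]
    · rw [List.length_take, h]; simp
    · simpa using h1.symm

lemma qvan_append (A B : List ℂ) : qvan (A ++ B) =
    qvan A * (A.map fun x => (B.map fun y => qc * x - qc ^ 2 * y).prod).prod * qvan B := by
  induction A with
  | nil => simp [qvan]
  | cons x A ih =>
    simp only [List.cons_append, qvan, ih, List.map_append, List.prod_append, List.map_cons,
      List.prod_cons]
    ring

/-- The factor `∏ (z - q a)`. -/
def pairFac (a : ℂ) (l : List ℂ) : ℂ := (l.map fun z => z - qc * a).prod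

/-- The constant in the pair recursion. -/
def pairCst (w : List Bool) : ℂ := qc ^ w.count false * (-qc ^ 2) ^ w.count true

lemma pairFac_perm (a : ℂ) {l l' : List ℂ} (h : l.Perm l') : pairFac a l = pairFac a l' :=
  (h.map _).prod_eq

lemma pairCst_perm {l l' : List Bool} (h : l.Perm l') : pairCst l = pairCst l' := by
  unfold pairCst; rw [h.count_eq, h.count_eq]

lemma prod_map_const_mul (c : ℂ) (f : ℂ → ℂ) (l : List ℂ) :
    (l.map fun x => c * f x).prod = c ^ l.length * (l.map f).prod := by
  induction l with
  | nil => simp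
  | cons x l ih => simp only [List.map_cons, List.prod_cons, ih, List.length_cons]; ring

lemma phi_pair_sorted (a : ℂ) (Z Z' : List ℂ) :
    phi (List.replicate Z.length false ++ false :: true :: List.replicate Z'.length true)
      (Z ++ a :: (qc ^ 2 * a) :: Z') =
    pairCst (List.replicate Z.length false ++ List.replicate Z'.length true) *
      pairFac a (Z ++ Z') *
      phi (List.replicate Z.length false ++ List.replicate Z'.length true) (Z ++ Z') := by
  have e1 : List.replicate Z.length false ++ false :: true :: List.replicate Z'.length true =
      List.replicate (Z ++ [a]).length false ++ List.replicate ((qc ^ 2 * a) :: Z').length true := by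
    rw [List.length_append, List.length_singleton, List.replicate_succ', List.length_cons,
      List.replicate_succ]
    simp
  rw [e1, show Z ++ a :: (qc ^ 2 * a) :: Z' = (Z ++ [a]) ++ ((qc ^ 2 * a) :: Z') by simp,
    phi_sorted, phi_sorted, qvan_append, qvan, qvan, qvan]
  have e2 : (Z'.map fun y => qc * (qc ^ 2 * a) - qc ^ 2 * y) =
      Z'.map fun y => (-qc ^ 2) * (y - qc * a) := by
    apply List.map_congr_left
    intro y _
    ring
  have e3 : (Z.map fun x => ([a].map fun y => qc * x - qc ^ 2 * y).prod) =
      Z.map fun x => qc * (x - qc * a) := by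
    apply List.map_congr_left
    intro y _
    simp
    ring
  rw [e2, e3, prod_map_const_mul, prod_map_const_mul]
  unfold pairCst pairFac
  simp [List.count_append, List.count_replicate]
  ring

theorem phi_pair_zero : ∀ (V : List Bool) (a : ℂ) (B : List ℂ), B.length = V.length →
    Gen (a :: B) → phi (false :: true :: V) (a :: (qc ^ 2 * a) :: B) =
      pairCst V * pairFac a B * phi V B := by
  intro V
  induction V using word_induction with
  | hs d u =>
    intro a B hB hG
    rw [gen_cons] at hG
    have hB' : B = B.take d ++ B.drop d := (List.take_append_drop d B).symm
    simp only [List.length_append, List.length_replicate] at hB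
    have hl1 : (B.take d).length = d := by rw [List.length_take]; omega
    have hl2 : (B.drop d).length = u := by rw [List.length_drop]; omega
    have h1 := phi_pair_move_list (List.replicate d false) [] (List.replicate u true)
      (B.take d) [] (B.drop d) a hG.1 (fun x hx => hG.2.1 x (List.mem_of_mem_take hx)) rfl
      (by simp [hl1])
    simp only [List.nil_append] at h1
    rw [List.take_append_drop] at h1
    rw [h1]
    have h2 := phi_pair_sorted a (B.take d) (B.drop d)
    rw [hl1, hl2, List.take_append_drop] at h2
    exact h2
  | step U V ih =>
    intro a B hB hG
    obtain ⟨A, x, y, B', rfl, h1, h2⟩ := split_length hB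
    have hperm : (A ++ x :: y :: B').Perm (A ++ y :: x :: B') :=
      List.Perm.append_left _ (List.Perm.swap _ _ _)
    have hG' : Gen (a :: (A ++ y :: x :: B')) := hG.perm (hperm.cons a)
    have i1 := ih a (A ++ x :: y :: B') (by simp [h1, h2]) hG
    have i2 := ih a (A ++ y :: x :: B') (by simp [h1, h2]) hG'
    rw [← pairFac_perm a hperm] at i2
    have hxy : y - x ≠ 0 := by
      have h3 := (gen_cons.1 (Gen.append_right (gen_cons.1 hG).2.2)).2.1 y (by simp)
      exact (cube_ne h3.symm).1
    have hc : pairCst (U ++ true :: false :: V) = pairCst (U ++ false :: true :: V) :=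
      pairCst_perm (List.Perm.append_left _ (List.Perm.swap _ _ _))
    have x1 := phi_exch_ft U V A B' x y h1
    have x2 := phi_exch_ft (false :: true :: U) V (a :: (qc ^ 2 * a) :: A) B' x y (by simp [h1])
    simp only [List.cons_append] at x2
    apply mul_left_cancel₀ hxy
    rw [i1, i2] at x2
    rw [hc]
    linear_combination (-1 : ℂ) * x2 + pairCst (U ++ false :: true :: V)
      * pairFac a (A ++ x :: y :: B') * x1

/-- Pair recursion at an arbitrary place. -/
theorem phi_pair (U V : List Bool) (A B : List ℂ) (a : ℂ) (hU : U.length = A.length)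
    (hV : V.length = B.length) (hG : Gen (a :: (A ++ B))) :
    phi (U ++ false :: true :: V) (A ++ a :: (qc ^ 2 * a) :: B) =
      pairCst (U ++ V) * pairFac a (A ++ B) * phi (U ++ V) (A ++ B) := by
  have h1 := phi_pair_move_list U [] V A [] B a (gen_cons.1 hG).1
    (fun x hx => (gen_cons.1 hG).2.1 x (by simp [hx])) rfl hU
  simp only [List.nil_append] at h1
  rw [← h1, phi_pair_zero _ _ _ (by simp [hU, hV]) hG]

/-- A function on lists that is polynomial of bounded degree in each entry and vanishes at
generic lists vanishes identically. -/
lemma eq_zero_of_gen {N : ℕ} {g : List ℂ → ℂ}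
    (hp : ∀ A B, A.length + 1 + B.length = N → ∃ d, PolyDeg d fun t => g (A ++ t :: B))
    (hg : ∀ l, l.length = N → Gen l → g l = 0) (l : List ℂ) (hl : l.length = N) : g l = 0 := by
  have key : ∀ A B : List ℂ, A.length + B.length = N → Gen B → g (A ++ B) = 0 := by
    intro A
    induction A using List.reverseRecOn with
    | nil => intro B h hB; exact hg _ (by simpa using h) hB
    | append_singleton A t ih =>
      intro B h hB
      have h' : A.length + 1 + B.length = N := by simpa using h
      rw [List.append_assoc, List.singleton_append]
      set S : Set ℂ := {t : ℂ | t = 0 ∨ ∃ x ∈ B, t ^ 3 = x ^ 3} with hS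
      have hfin : S.Finite := by
        have h1 : ∀ c : ℂ, {t : ℂ | t ^ 3 = c}.Finite := by
          intro c
          have := (Polynomial.nthRoots 3 c).toFinset.finite_toSet
          refine this.subset ?_
          intro t ht
          simp only [Set.mem_ofPred_eq] at ht
          simp [Polynomial.mem_nthRoots, ht]
        have h2 : S = {0} ∪ ⋃ x ∈ B.toFinset, {t : ℂ | t ^ 3 = x ^ 3} := by
          ext t; simp [hS]
        rw [h2]
        exact (Set.finite_singleton _).union
          (Set.Finite.biUnion (B.toFinset.finite_toSet) fun x _ => h1 _)
      obtain ⟨d, hd⟩ := hp A B h'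
      refine hd.eq_zero_of_cofinite S hfin ?_ t
      intro t ht
      apply ih (t :: B) (by simp; omega)
      rw [gen_cons]
      simp only [hS, Set.mem_ofPred_eq, not_or, not_exists, not_and] at ht
      exact ⟨ht.1, ht.2, hB⟩
  simpa using key l [] (by simpa using hl) ⟨List.Pairwise.nil, by simp⟩

lemma count_lem {w : List Bool} : w.count true + w.count false = w.length := by
  induction w with
  | nil => simp
  | cons s w ih => cases s <;> simp <;> omega

/-- The defect of cyclic invariance. -/
def cycDef (t : Bool) (x : ℂ) (w : List Bool) (A : List ℂ) : ℂ :=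
  phi (t :: w) (x :: A) - phi (w ++ [t]) (A ++ [x])

/-- The defect vanishes on all words with `n` up spins and `n + 1` down spins. -/
def CycVan (n : ℕ) (x : ℂ) (A : List ℂ) : Prop :=
  ∀ (t : Bool) (w : List Bool), (t :: w).count true = n → (t :: w).count false = n + 1 →
    cycDef t x w A = 0

lemma CycVan.swap {n : ℕ} {x : ℂ} {A B : List ℂ} {a b : ℂ} (h : CycVan n x (A ++ a :: b :: B))
    (hl : A.length + B.length + 2 = 2 * n) (hab : qc * a - qc ^ 2 * b ≠ 0) :
    CycVan n x (A ++ b :: a :: B) := by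
  intro t w h1 h2
  have hlen : (A ++ a :: b :: B).length = w.length := by
    have := count_lem (w := t :: w)
    simp only [List.length_append, List.length_cons] at this ⊢
    omega
  obtain ⟨U, s, s', V, rfl, hU, hV⟩ : ∃ U s s' V, w = U ++ s :: s' :: V ∧ U.length = A.length ∧
      V.length = B.length := by
    refine ⟨w.take A.length, ?_⟩
    have h1 : (w.drop A.length).length = B.length + 2 := by
      rw [List.length_drop, ← hlen]; simp
    match hd : w.drop A.length, h1 with
    | a :: b :: B', h1 =>
      refine ⟨a, b, B', ?_, ?_, ?_⟩
      · rw [← hd, List.take_append_drop]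
      · rw [List.length_take, ← hlen]; simp
      · simpa using h1
  have key := h t (U ++ s :: s' :: V) h1 h2
  have key' := h t (U ++ s' :: s :: V)
    (by rw [← h1]; exact ((List.Perm.append_left _ (List.Perm.swap _ _ _)).cons _).count_eq _)
    (by rw [← h2]; exact ((List.Perm.append_left _ (List.Perm.swap _ _ _)).cons _).count_eq _)
  unfold cycDef at *
  apply (mul_eq_zero.1 _).resolve_left hab
  cases s <;> cases s'
  · have e1 := phi_exch_aligned (t :: U) V false (x :: A) B a b (by simp [hU])
    have e2 := phi_exch_aligned U (V ++ [t]) false A (B ++ [x]) a b hU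
    simp only [List.append_assoc, List.cons_append] at *
    linear_combination e1 - e2 + (qc * b - qc ^ 2 * a) * key
  · have e1 := phi_exch_ft (t :: U) V (x :: A) B a b (by simp [hU])
    have e2 := phi_exch_ft U (V ++ [t]) A (B ++ [x]) a b hU
    simp only [List.append_assoc, List.cons_append] at *
    linear_combination e1 - e2 + (b - a) * key' + (qc - qc ^ 2) * b * key
  · have e1 := phi_exch_tf (t :: U) V (x :: A) B a b (by simp [hU])
    have e2 := phi_exch_tf U (V ++ [t]) A (B ++ [x]) a b hU
    simp only [List.append_assoc, List.cons_append] at *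
    linear_combination e1 - e2 + (b - a) * key' + (qc - qc ^ 2) * a * key
  · have e1 := phi_exch_aligned (t :: U) V true (x :: A) B a b (by simp [hU])
    have e2 := phi_exch_aligned U (V ++ [t]) true A (B ++ [x]) a b hU
    simp only [List.append_assoc, List.cons_append] at *
    linear_combination e1 - e2 + (qc * b - qc ^ 2 * a) * key

lemma cycVan_pair {n : ℕ} (hn : 1 ≤ n) {x a : ℂ} {B : List ℂ} (hB : B.length + 2 = 2 * n)
    (hG : Gen (x :: a :: B)) (ih : CycVan (n - 1) x B) :
    CycVan n x (a :: (qc ^ 2 * a) :: B) := by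
  intro t w h1 h2
  have hlen : B.length + 2 = w.length := by
    have := count_lem (w := t :: w)
    simp only [List.length_cons] at this
    omega
  have hG1 : Gen (a :: (x :: B)) := hG.perm (List.Perm.swap _ _ _)
  have hG2 : Gen (a :: (B ++ [x])) := hG1.perm (List.Perm.cons _ (by
    simpa using (List.perm_append_comm (l₁ := [x]) (l₂ := B))))
  have ha : a ≠ 0 := (gen_cons.1 hG1).1
  obtain ⟨s, s', V, rfl⟩ : ∃ s s' V, w = s :: s' :: V := by
    match w, hlen with
    | s :: s' :: V, _ => exact ⟨s, s', V, rfl⟩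
  have hV : V.length = B.length := by simp at hlen; exact hlen.symm
  unfold cycDef
  have hft : (t :: V).count true = n - 1 → (t :: V).count false = n - 1 + 1 →
      phi ([t] ++ false :: true :: V) ([x] ++ a :: (qc ^ 2 * a) :: B) =
      phi ([] ++ false :: true :: (V ++ [t])) ([] ++ a :: (qc ^ 2 * a) :: (B ++ [x])) := by
    intro c1 c2
    rw [phi_pair [t] V [x] B a rfl hV hG1, phi_pair [] (V ++ [t]) [] (B ++ [x]) a rfl
      (by simp [hV]) hG2]
    have i1 := ih t V c1 c2
    unfold cycDef at i1
    have p1 : (t :: V).Perm (V ++ [t]) := by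
      simpa using (List.perm_append_comm (l₁ := [t]) (l₂ := V))
    have p2 : (x :: B).Perm (B ++ [x]) := by
      simpa using (List.perm_append_comm (l₁ := [x]) (l₂ := B))
    simp only [List.cons_append, List.nil_append]
    rw [pairCst_perm p1, pairFac_perm a p2, sub_eq_zero.1 i1]
  cases s <;> cases s'
  · have e1 := phi_pair_aligned [t] V false [x] B a ha rfl
    have e2 := phi_pair_aligned [] (V ++ [t]) false [] (B ++ [x]) a ha rfl
    simp only [List.cons_append, List.nil_append] at *
    rw [e1, e2, sub_zero]
  · have := hft (by simp [List.count_cons] at h1 ⊢; omega) (by simp [List.count_cons] at h2 ⊢; omega)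
    simp only [List.cons_append, List.nil_append] at *
    rw [this, sub_self]
  · have e1 := phi_pair_tf [t] V [x] B a ha rfl
    have e2 := phi_pair_tf [] (V ++ [t]) [] (B ++ [x]) a ha rfl
    have := hft (by simp [List.count_cons] at h1 ⊢; omega) (by simp [List.count_cons] at h2 ⊢; omega)
    simp only [List.cons_append, List.nil_append] at *
    rw [e1, e2, this, sub_self]
  · have e1 := phi_pair_aligned [t] V true [x] B a ha rfl
    have e2 := phi_pair_aligned [] (V ++ [t]) true [] (B ++ [x]) a ha rfl
    simp only [List.cons_append, List.nil_append] at *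
    rw [e1, e2, sub_zero]

lemma cycVan_pair_far {n : ℕ} (hn : 1 ≤ n) {x a : ℂ} : ∀ (A C B : List ℂ),
    C.length + A.length + B.length + 2 = 2 * n → Gen (x :: a :: (C ++ A ++ B)) →
    CycVan n x (a :: C ++ (qc ^ 2 * a) :: A ++ B) →
    CycVan n x (a :: C ++ A ++ (qc ^ 2 * a) :: B) := by
  intro A
  induction A with
  | nil => intro C B _ _ h; simpa using h
  | cons y A ih =>
    intro C B hl hG h
    have hne : qc * (qc ^ 2 * a) - qc ^ 2 * y ≠ 0 := by
      have h1 := (gen_cons.1 (gen_cons.1 hG).2.2).2.1 y (by simp)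
      have h2 := (cube_ne h1).2.1
      rwa [show qc * (qc ^ 2 * a) - qc ^ 2 * y = a - qc ^ 2 * y by
        linear_combination a * qc_cube]
    have h3 : CycVan n x ((a :: C) ++ (qc ^ 2 * a) :: y :: (A ++ B)) := by
      simpa [List.append_assoc] using h
    have h4 := h3.swap (by simp at hl ⊢; omega) hne
    have h5 := ih (C ++ [y]) B (by simp at hl ⊢; omega) (by simpa [List.append_assoc] using hG)
      (by simpa [List.append_assoc] using h4)
    simpa [List.append_assoc] using h5

lemma cycVan_gen_one {x y z : ℂ} (hG : Gen [x, y, z]) : CycVan 1 x [y, z] := by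
  have key : ∀ x y z : ℂ, Gen [x, y, z] → phi [false, false, true] [x, y, z] = qc * x - qc ^ 2 * y ∧
      phi [false, true, false] [x, y, z] = qc * z - qc ^ 2 * x ∧
      phi [true, false, false] [x, y, z] = qc * y - qc ^ 2 * z := by
    intro x y z hG
    have h1 : ∀ x y z : ℂ, phi [false, false, true] [x, y, z] = qc * x - qc ^ 2 * y := by
      intro x y z
      have := phi_sorted [x, y] [z]
      simpa [qvan, List.replicate_succ] using this
    have h2 : ∀ x y z : ℂ, z - y ≠ 0 → phi [false, true, false] [x, y, z] = qc * z - qc ^ 2 * x := by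
      intro x y z hzy
      have := phi_exch_ft [false] [] [x] [] y z rfl
      simp only [List.cons_append, List.nil_append] at this
      rw [h1, h1] at this
      apply mul_left_cancel₀ hzy
      have q3 := qc_rel
      generalize qc = q at *
      clear hG
      grind
    have g1 := gen_cons.1 hG
    have g2 := gen_cons.1 g1.2.2
    have d1 := (cube_ne (g2.2.1 z (by simp)).symm).1
    have d2 := (cube_ne (g1.2.1 z (by simp)).symm).1
    have d3 := (cube_ne (g1.2.1 y (by simp)).symm).1
    refine ⟨h1 x y z, h2 x y z d1, ?_⟩
    have := phi_exch_ft [] [false] [] [z] x y rfl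
    simp only [List.nil_append] at this
    rw [h2 _ _ _ d1, h2 _ _ _ d2] at this
    apply mul_left_cancel₀ d3
    have q3 := qc_rel
    generalize qc = q at *
    clear h1 h2 hG g1 g2 d1 d2 d3
    grind
  have hG' : Gen [y, z, x] := hG.perm (by
    simpa using (List.perm_append_comm (l₁ := [x]) (l₂ := [y, z])))
  obtain ⟨k1, k2, k3⟩ := key x y z hG
  obtain ⟨k4, k5, k6⟩ := key y z x hG'
  intro t w h1 h2
  have hlen := count_lem (w := t :: w)
  rw [h1, h2] at hlen
  unfold cycDef
  match w, hlen with
  | [s, s'], _ =>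
    cases t <;> cases s <;> cases s' <;> simp at h1 h2 ⊢
    · rw [k1, k5, sub_self]
    · rw [k2, k6, sub_self]
    · rw [k3, k4, sub_self]

theorem cycVan_gen : ∀ (n : ℕ) (x : ℂ) (A : List ℂ), A.length = 2 * n → Gen (x :: A) →
    CycVan n x A := by
  intro n
  induction n with
  | zero =>
    intro x A hA _ t w h1 h2
    have hlen := count_lem (w := t :: w)
    rw [h1, h2] at hlen
    have hw : w = [] := by simpa using hlen
    have hA' : A = [] := by simpa using hA
    subst hw; subst hA'
    unfold cycDef
    simp
  | succ n ih =>
    intro x A hA hG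
    rcases Nat.eq_zero_or_pos n with rfl | hn
    · match A, hA with
      | [y, z], _ => exact cycVan_gen_one hG
    obtain ⟨a, C, rfl⟩ : ∃ a C, A = a :: C := by
      match A, hA with
      | a :: C, _ => exact ⟨a, C, rfl⟩
    have hC : C.length = 2 * n + 1 := by simp at hA; omega
    intro t w h1 h2
    have hcnt : ∀ s, (t :: w).count s ≤ n + 1 + 1 := by intro s; cases s <;> omega
    have hcnt' : ∀ s, (w ++ [t]).count s ≤ n + 1 + 1 := by
      intro s
      refine le_trans (le_of_eq ?_) (hcnt s)
      exact (List.perm_append_comm (l₁ := w) (l₂ := [t])).count_eq s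
    have hpoly : PolyDeg (n + 1) fun a => cycDef t x w (a :: C) := by
      unfold cycDef
      exact (phi_polyDeg (t :: w) (n + 1) hcnt [x] C).sub
        (phi_polyDeg (w ++ [t]) (n + 1) hcnt' [] (C ++ [x]))
    have hGx := gen_cons.1 hG
    have hGC := gen_cons.1 hGx.2.2
    have hinj : Set.InjOn (fun y => qc * y) (C.toFinset : Set ℂ) := by
      intro y _ y' _ h
      exact mul_left_cancel₀ qc_ne_zero h
    have hnd : C.Nodup := by
      refine hGC.2.2.1.imp ?_
      intro y y' h h'
      exact h (by rw [h'])
    refine hpoly.eq_zero_of_roots (C.toFinset.image fun y => qc * y) ?_ ?_ a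
    · rw [Finset.card_image_of_injOn hinj, List.toFinset_card_of_nodup hnd, hC]
      omega
    · intro r hr
      rw [Finset.mem_image] at hr
      obtain ⟨y, hy, rfl⟩ := hr
      rw [List.mem_toFinset] at hy
      obtain ⟨C0, C1, rfl⟩ := List.append_of_mem hy
      have e : qc ^ 2 * (qc * y) = y := by linear_combination y * qc_cube
      have hcu : (qc * y) ^ 3 = y ^ 3 := by linear_combination y ^ 3 * qc_cube
      have hperm : (C0 ++ y :: C1).Perm (y :: (C0 ++ C1)) := List.perm_middle
      have hG3 : Gen (x :: (y :: (C0 ++ C1))) := by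
        have : Gen (x :: (C0 ++ y :: C1)) := by
          rw [gen_cons]
          exact ⟨hGx.1, fun z hz => hGx.2.1 z (List.mem_cons_of_mem _ hz), hGC.2.2⟩
        exact this.perm (hperm.cons x)
      have hG4 : Gen (x :: (qc * y) :: (C0 ++ C1)) := by
        rw [gen_cons, gen_cons] at hG3 ⊢
        refine ⟨hG3.1, ?_, mul_ne_zero qc_ne_zero hG3.2.2.1, ?_, hG3.2.2.2.2⟩
        · intro z hz
          rcases List.mem_cons.1 hz with rfl | hz
          · rw [hcu]; exact hG3.2.1 y (by simp)
          · exact hG3.2.1 z (List.mem_cons_of_mem _ hz)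
        · intro z hz
          rw [hcu]; exact hG3.2.2.2.1 z hz
      have hl : (C0 ++ C1).length + 2 = 2 * (n + 1) := by simp at hC ⊢; omega
      have hG5 : Gen (x :: (C0 ++ C1)) := by
        rw [gen_cons] at hG4 ⊢
        exact ⟨hG4.1, fun z hz => hG4.2.1 z (List.mem_cons_of_mem _ hz),
          (gen_cons.1 hG4.2.2).2.2⟩
      have h3 := cycVan_pair (n := n + 1) (by omega) hl hG4
        (ih x (C0 ++ C1) (by omega) hG5)
      have h4 := cycVan_pair_far (n := n + 1) (by omega) C0 [] C1
        (by simp at hl ⊢; omega) (by simpa using hG4) (by simpa using h3)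
      rw [e] at h4
      exact h4 t w h1 h2

/-- Cyclic invariance of the inhomogeneous ground state. -/
theorem phi_cyclic (n : ℕ) (t : Bool) (w : List Bool) (x : ℂ) (A : List ℂ)
    (h1 : (t :: w).count true = n) (h2 : (t :: w).count false = n + 1) (hA : A.length = 2 * n) :
    phi (t :: w) (x :: A) = phi (w ++ [t]) (A ++ [x]) := by
  have hcnt : ∀ s, (t :: w).count s ≤ n + 1 := by intro s; cases s <;> omega
  have hcnt' : ∀ s, (w ++ [t]).count s ≤ n + 1 := by
    intro s
    refine le_trans (le_of_eq ?_) (hcnt s)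
    exact (List.perm_append_comm (l₁ := w) (l₂ := [t])).count_eq s
  have := eq_zero_of_gen (N := 2 * n + 1)
    (g := fun l => phi (t :: w) l - phi (w ++ [t]) (l.rotate 1)) ?_ ?_ (x :: A) (by simp [hA])
  · simpa [sub_eq_zero, List.rotate_cons_succ] using this
  · intro A B _
    refine ⟨n, ?_⟩
    refine (phi_polyDeg (t :: w) n hcnt A B).sub ?_
    cases A with
    | nil => simpa [List.rotate_cons_succ] using phi_polyDeg (w ++ [t]) n hcnt' B []
    | cons y A =>
      simpa [List.rotate_cons_succ, List.append_assoc] using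
        phi_polyDeg (w ++ [t]) n hcnt' A (B ++ [y])
  · intro l hl hG
    match l, hl with
    | x :: A, hl =>
      have := cycVan_gen n x A (by simpa using hl) hG t w h1 h2
      simpa [cycDef, List.rotate_cons_succ] using this

/-- The homogeneous components, all spectral parameters being `1`. -/
def homPhi (w : List Bool) : ℂ := phi w (List.replicate w.length 1)

/-- Derivative of the components in the first spectral parameter at the homogeneous point. -/
def dPhi (w : List Bool) : ℂ := deriv (fun t => phi w (t :: List.replicate (w.length - 1) 1)) 1

/-- The energy density on the first two letters of a word, shifted so as to vanish when summed
over all rotations for the ground state. -/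
def bond {R : Type*} [Field R] (f : List Bool → R) : List Bool → R
  | s :: s' :: v => if s = s' then -f (s :: s' :: v) else f (s' :: s :: v) - f (s :: s' :: v) / 2
  | _ => 0

lemma PolyDeg.differentiable {d : ℕ} {g : ℂ → ℂ} (hg : PolyDeg d g) : Differentiable ℂ g := by
  obtain ⟨p, -, hp⟩ := hg
  rw [show g = fun t => p.eval t from funext hp]
  exact p.differentiable

lemma phi_differentiable (w : List Bool) (A B : List ℂ) :
    Differentiable ℂ fun t => phi w (A ++ t :: B) :=
  (phi_polyDeg w w.length (fun _ => (List.count_le_length).trans (Nat.le_succ _)) A B).differentiable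

lemma homPhi_rotate {n : ℕ} {w : List Bool} (h1 : w.count true = n) (h2 : w.count false = n + 1) :
    homPhi (w.rotate 1) = homPhi w := by
  have hl := count_lem (w := w)
  match w with
  | [] => simp at h2
  | t :: w =>
    simp only [List.length_cons] at hl
    have := phi_cyclic n t w 1 (List.replicate (2 * n) 1) h1 h2 (by simp)
    have e : ∀ m : ℕ, m = 2 * n + 1 → phi (w ++ [t]) (List.replicate m (1 : ℂ)) =
        phi (t :: w) (List.replicate m 1) := by
      rintro _ rfl
      rw [List.replicate_succ, this, ← List.replicate_succ', List.replicate_succ]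
    simp only [homPhi, List.rotate_cons_succ, List.rotate_zero, List.length_append,
      List.length_cons, List.length_nil]
    exact e _ (by omega)

lemma dPhi_rotate {n : ℕ} {s s' : Bool} {v : List Bool} (h1 : (s :: s' :: v).count true = n)
    (h2 : (s :: s' :: v).count false = n + 1) :
    dPhi ((s :: s' :: v).rotate 1) =
      deriv (fun t => phi (s :: s' :: v) (1 :: t :: List.replicate v.length 1)) 1 := by
  have hl := count_lem (w := s :: s' :: v)
  simp only [List.length_cons] at hl
  rw [dPhi]
  congr 1
  funext t
  rw [phi_cyclic n s (s' :: v) 1 (t :: List.replicate v.length 1) h1 h2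
    (by simp; omega)]
  simp [List.replicate_succ']

lemma homPhi_bond_eq {n : ℕ} {s s' : Bool} {v : List Bool}
    (h1 : (s :: s' :: v).count true = n) (h2 : (s :: s' :: v).count false = n + 1) :
    bond homPhi (s :: s' :: v) =
      ((qc - qc ^ 2) * dPhi (s :: s' :: v) +
        (qc - qc ^ 2) / 2 * (if s = true then 1 else 0) * homPhi (s :: s' :: v)) -
      ((qc - qc ^ 2) * dPhi ((s :: s' :: v).rotate 1) +
        (qc - qc ^ 2) / 2 * (if s' = true then 1 else 0) * homPhi (s :: s' :: v)) := by
  rw [dPhi_rotate h1 h2, dPhi]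
  simp only [List.length_cons, Nat.add_sub_cancel, List.replicate_succ]
  set L := List.replicate v.length (1 : ℂ) with hL
  have hP : ∀ a b, homPhi (a :: b :: v) = phi (a :: b :: v) (1 :: 1 :: L) := by
    intro a b; simp [homPhi, List.replicate_succ, hL]
  have hf : ∀ a b, HasDerivAt (fun t => phi (a :: b :: v) (t :: 1 :: L))
      (deriv (fun t => phi (a :: b :: v) (t :: 1 :: L)) 1) 1 :=
    fun a b => (phi_differentiable (a :: b :: v) [] (1 :: L) 1).hasDerivAt
  have hg : ∀ a b, HasDerivAt (fun t => phi (a :: b :: v) (1 :: t :: L))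
      (deriv (fun t => phi (a :: b :: v) (1 :: t :: L)) 1) 1 :=
    fun a b => (phi_differentiable (a :: b :: v) [1] L 1).hasDerivAt
  have hlin : ∀ a b : ℂ, HasDerivAt (fun t : ℂ => a * t + b) a 1 := fun a b => by
    simpa using ((hasDerivAt_id (1 : ℂ)).const_mul a).add_const b
  simp only [bond]
  have q3 := qc_rel
  have hleft : HasDerivAt (fun t => (qc * t + -qc ^ 2) * phi (s :: s' :: v) (1 :: t :: L))
      _ 1 := (hlin qc (-qc ^ 2)).mul (hg s s')
  by_cases hs : s = s'
  · subst hs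
    rw [if_pos rfl]
    have hright : HasDerivAt (fun t => (-qc ^ 2 * t + qc) * phi (s :: s :: v) (t :: 1 :: L))
      _ 1 := (hlin (-qc ^ 2) qc).mul (hf s s)
    have heq : (fun t => (qc * t + -qc ^ 2) * phi (s :: s :: v) (1 :: t :: L)) =
        fun t => (-qc ^ 2 * t + qc) * phi (s :: s :: v) (t :: 1 :: L) := by
      funext t
      have := phi_exch_aligned [] v s [] L t 1 rfl
      simp only [List.nil_append] at this
      linear_combination this
    rw [heq] at hleft
    have := hleft.unique hright
    simp only [hP] at *
    linear_combination this - phi (s :: s :: v) (1 :: 1 :: L) * q3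
  · rw [if_neg hs]
    cases s <;> cases s' <;> simp only [not_true, Bool.false_eq_true, if_true, if_false] at hs ⊢
    · have hright : HasDerivAt (fun t => (-1 * t + 1) * phi (true :: false :: v) (t :: 1 :: L) +
        (qc - qc ^ 2) * phi (false :: true :: v) (t :: 1 :: L)) _ 1 :=
        ((hlin (-1) 1).mul (hf true false)).add ((hf false true).const_mul (qc - qc ^ 2))
      have heq : (fun t => (qc * t + -qc ^ 2) * phi (false :: true :: v) (1 :: t :: L)) =
          fun t => (-1 * t + 1) * phi (true :: false :: v) (t :: 1 :: L) +
        (qc - qc ^ 2) * phi (false :: true :: v) (t :: 1 :: L) := by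
        funext t
        have := phi_exch_ft [] v [] L t 1 rfl
        simp only [List.nil_append] at this
        linear_combination this
      rw [heq] at hleft
      have := hleft.unique hright
      simp only [hP] at *
      linear_combination this - phi (false :: true :: v) (1 :: 1 :: L) * q3 / 2
    · have hright : HasDerivAt (fun t => (-1 * t + 1) * phi (false :: true :: v) (t :: 1 :: L) +
        ((qc - qc ^ 2) * t + 0) * phi (true :: false :: v) (t :: 1 :: L)) _ 1 :=
        ((hlin (-1) 1).mul (hf false true)).add ((hlin (qc - qc ^ 2) 0).mul (hf true false))
      have heq : (fun t => (qc * t + -qc ^ 2) * phi (true :: false :: v) (1 :: t :: L)) =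
          fun t => (-1 * t + 1) * phi (false :: true :: v) (t :: 1 :: L) +
        ((qc - qc ^ 2) * t + 0) * phi (true :: false :: v) (t :: 1 :: L) := by
        funext t
        have := phi_exch_tf [] v [] L t 1 rfl
        simp only [List.nil_append] at this
        linear_combination this
      rw [heq] at hleft
      have := hleft.unique hright
      simp only [hP] at *
      linear_combination this - phi (true :: false :: v) (1 :: 1 :: L) * q3 / 2

lemma homPhi_rotate_iter {n : ℕ} {w : List Bool} (h1 : w.count true = n)
    (h2 : w.count false = n + 1) (j : ℕ) : homPhi (w.rotate j) = homPhi w := by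
  induction j with
  | zero => simp
  | succ j ih =>
    rw [← List.rotate_rotate, homPhi_rotate (n := n), ih]
    · rw [(List.rotate_perm w j).count_eq, h1]
    · rw [(List.rotate_perm w j).count_eq, h2]

/-- The homogeneous components satisfy the eigenvalue equation. -/
lemma homPhi_eigen {n : ℕ} (hn : 1 ≤ n) {w : List Bool} (h1 : w.count true = n)
    (h2 : w.count false = n + 1) :
    ∑ j ∈ Finset.range w.length, bond homPhi (w.rotate j) = 0 := by
  set G : List Bool → ℂ := fun u => (qc - qc ^ 2) * dPhi u +
    (qc - qc ^ 2) / 2 * (if u.headD false = true then 1 else 0) * homPhi u with hG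
  have key : ∀ j, bond homPhi (w.rotate j) = G (w.rotate j) - G (w.rotate (j + 1)) := by
    intro j
    have c1 : (w.rotate j).count true = n := by rw [(List.rotate_perm w j).count_eq, h1]
    have c2 : (w.rotate j).count false = n + 1 := by rw [(List.rotate_perm w j).count_eq, h2]
    rw [← List.rotate_rotate]
    generalize w.rotate j = u at *
    match u with
    | [] => simp at c2
    | [s] => have := count_lem (w := [s]); simp only [List.length_singleton] at this; omega
    | s :: s' :: v =>
      rw [homPhi_bond_eq c1 c2]
      simp only [hG, homPhi_rotate c1 c2]
      simp
  simp only [key]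
  rw [Finset.sum_range_sub' (fun j => G (w.rotate j))]
  simp

/-- The words of length `m`. -/
def words (m : ℕ) : Finset (List Bool) :=
  (Finset.univ : Finset (Fin m → Bool)).map ⟨List.ofFn, List.ofFn_injective⟩

@[simp] lemma mem_words {m : ℕ} {w : List Bool} : w ∈ words m ↔ w.length = m := by
  simp only [words, Finset.mem_map, Finset.mem_univ, true_and, Function.Embedding.coeFn_mk]
  constructor
  · rintro ⟨f, rfl⟩; simp
  · rintro rfl; exact ⟨w.get, List.ofFn_get w⟩

lemma sum_words_ofFn {R : Type*} [AddCommMonoid R] (m : ℕ) (f : List Bool → R) :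
    ∑ w ∈ words m, f w = ∑ α : Fin m → Bool, f (List.ofFn α) := by
  simp [words]

lemma sum_words_rotate {R : Type*} [AddCommMonoid R] (m j : ℕ) (f : List Bool → R) :
    ∑ w ∈ words m, f (w.rotate j) = ∑ w ∈ words m, f w := by
  have hinj : Set.InjOn (fun w : List Bool => w.rotate j) (words m) :=
    (List.rotate_injective j).injOn
  have hmaps : Set.MapsTo (fun w : List Bool => w.rotate j) (words m) (words m) := by
    intro w hw; simpa using hw
  exact Finset.sum_nbij (fun w => w.rotate j) hmaps hinj
    (Finset.surjOn_of_injOn_of_card_le _ hmaps hinj le_rfl) (fun _ _ => rfl)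

lemma sum_words_add {R : Type*} [AddCommMonoid R] (a b : ℕ) (f : List Bool → R) :
    ∑ w ∈ words (a + b), f w = ∑ x ∈ words a, ∑ y ∈ words b, f (x ++ y) := by
  rw [← Finset.sum_product']
  refine Finset.sum_nbij' (fun w => (w.take a, w.drop a)) (fun p => p.1 ++ p.2) ?_ ?_ ?_ ?_ ?_
  · intro w hw; simp at hw ⊢; omega
  · intro p hp; simp at hp ⊢; omega
  · intro w hw; simp
  · intro p hp; simp only [Finset.mem_product, mem_words] at hp; simp [← hp.1]
  · intro w hw; simp

lemma sum_words_one {R : Type*} [AddCommMonoid R] (f : List Bool → R) :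
    ∑ w ∈ words 1, f w = f [true] + f [false] := by
  rw [show words 1 = {[true], [false]} by
    ext w
    match w with
    | [] => simp
    | [true] => simp
    | [false] => simp
    | _ :: _ :: _ => simp, Finset.sum_pair (by simp)]

lemma sum_words_succ {R : Type*} [AddCommMonoid R] (m : ℕ) (f : List Bool → R) :
    ∑ w ∈ words (m + 1), f w =
      ∑ w ∈ words m, f (true :: w) + ∑ w ∈ words m, f (false :: w) := by
  rw [add_comm, sum_words_add, sum_words_one]; simp

lemma sum_words_snoc {R : Type*} [AddCommMonoid R] (m : ℕ) (f : List Bool → R) :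
    ∑ w ∈ words (m + 1), f w =
      ∑ w ∈ words m, f (w ++ [true]) + ∑ w ∈ words m, f (w ++ [false]) := by
  rw [sum_words_add, ← Finset.sum_add_distrib]
  simp [sum_words_one]

/-- Alternating sum over all rotations. -/
def altRot (M : ℕ) (f : List Bool → ℝ) (w : List Bool) : ℝ :=
  ∑ j ∈ Finset.range M, (-1) ^ j * f (w.rotate j)

lemma altRot_rotate {M : ℕ} (hM : Even M) (f : List Bool → ℝ) {w : List Bool}
    (hw : w.length = M) (j : ℕ) : altRot M f (w.rotate j) = (-1) ^ j * altRot M f w := by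
  have key : ∀ u : List Bool, u.length = M → altRot M f (u.rotate 1) = - altRot M f u := by
    intro u hu
    have h1 := Finset.sum_range_succ (fun j => (-1 : ℝ) ^ j * f (u.rotate j)) M
    have h2 := Finset.sum_range_succ' (fun j => (-1 : ℝ) ^ j * f (u.rotate j)) M
    rw [h1] at h2
    have h3 : u.rotate M = u := by rw [← hu, List.rotate_length]
    simp only [h3, hM.neg_one_pow, List.rotate_zero, pow_zero, one_mul, add_left_inj] at h2
    unfold altRot
    rw [h2, ← Finset.sum_neg_distrib]
    refine Finset.sum_congr rfl fun j _ => ?_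
    rw [List.rotate_rotate, add_comm 1 j]; ring
  induction j with
  | zero => simp
  | succ j ih =>
    rw [← List.rotate_rotate, key _ (by simpa using hw), ih]; ring

lemma sum_altRot_nonneg {M : ℕ} (hM : Even M) (hpos : 0 < M) (f : List Bool → ℝ) :
    0 ≤ ∑ w ∈ words M, f w * altRot M f w := by
  have h : ∑ w ∈ words M, altRot M f w ^ 2 = M * ∑ w ∈ words M, f w * altRot M f w := by
    have h1 : ∀ w ∈ words M, altRot M f w ^ 2 =
        ∑ j ∈ Finset.range M, f (w.rotate j) * altRot M f (w.rotate j) := by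
      intro w hw
      rw [sq]
      nth_rw 1 [altRot]
      rw [Finset.sum_mul]
      refine Finset.sum_congr rfl fun j _ => ?_
      rw [altRot_rotate hM f (by simpa using hw)]; ring
    rw [Finset.sum_congr rfl h1, Finset.sum_comm]
    simp only [sum_words_rotate M _ (fun w => f w * altRot M f w)]
    simp
  have h2 : 0 ≤ ∑ w ∈ words M, altRot M f w ^ 2 := Finset.sum_nonneg fun _ _ => sq_nonneg _
  rw [h] at h2
  exact nonneg_of_mul_nonneg_right h2 (by exact_mod_cast hpos)

/-- The supercharge density merging `↓ ↦ ↑↑`. -/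
def splitFun (P : List Bool → ℝ) : List Bool → ℝ
  | true :: true :: v => P (false :: v)
  | _ => 0

/-- The adjoint supercharge density `↑↑ ↦ ↓`. -/
def mergeFun (P : List Bool → ℝ) : List Bool → ℝ
  | false :: v => P (true :: true :: v)
  | _ => 0

lemma splitFun_cons_false (P : List Bool → ℝ) (v : List Bool) : splitFun P (false :: v) = 0 := by
  simp [splitFun]
lemma splitFun_true_false (P : List Bool → ℝ) (v : List Bool) :
    splitFun P (true :: false :: v) = 0 := by
  simp [splitFun]

lemma sum_splitFun (P : List Bool → ℝ) (m : ℕ) (hm : Even m)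
    (hP : ∀ w : List Bool, w.length = m + 3 → ∀ j, P (w.rotate j) = P w) :
    ∑ w ∈ words (m + 4), splitFun P w * altRot (m + 4) (splitFun P) w =
      ∑ v ∈ words (m + 2), P (false :: v) ^ 2
      - 2 * ∑ w ∈ words (m + 1), P (false :: true :: w) * P (true :: false :: w)
      + ∑ i ∈ Finset.range (m + 1), (-1) ^ i * ∑ x ∈ words i, ∑ y ∈ words (m - i),
          P (false :: x ++ true :: true :: y) * P (false :: y ++ true :: true :: x) := by
  rw [sum_words_succ, sum_words_succ]
  simp only [splitFun_cons_false, splitFun_true_false, zero_mul, Finset.sum_const_zero, add_zero]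
  simp only [splitFun]
  simp only [altRot, Finset.mul_sum]
  rw [Finset.sum_comm]
  rw [Finset.sum_range_succ, Finset.sum_range_succ', Finset.sum_range_succ']
  have e0 : ∑ v ∈ words (m + 2), P (false :: v) * ((-1) ^ 0 *
      splitFun P ((true :: true :: v).rotate 0)) = ∑ v ∈ words (m + 2), P (false :: v) ^ 2 := by
    refine Finset.sum_congr rfl fun v _ => ?_
    simp [splitFun]; ring
  have e1 : ∑ v ∈ words (m + 2), P (false :: v) * ((-1) ^ (0 + 1) *
      splitFun P ((true :: true :: v).rotate (0 + 1))) =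
      - ∑ w ∈ words (m + 1), P (false :: true :: w) * P (true :: false :: w) := by
    rw [sum_words_succ]
    simp only [zero_add, List.rotate_cons_succ, List.rotate_zero, List.cons_append, splitFun,
      mul_zero, Finset.sum_const_zero, add_zero]
    rw [← Finset.sum_neg_distrib]
    refine Finset.sum_congr rfl fun w hw => ?_
    rw [← hP (true :: false :: w) (by simpa using hw) 1]
    simp
  have e2 : ∑ v ∈ words (m + 2), P (false :: v) * ((-1) ^ (m + 3) *
      splitFun P ((true :: true :: v).rotate (m + 3))) =
      - ∑ w ∈ words (m + 1), P (false :: true :: w) * P (true :: false :: w) := by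
    have hr : ∀ w ∈ words (m + 1), ∀ s, (true :: true :: (w ++ [s])).rotate (m + 3) =
        s :: true :: true :: w := by
      intro w hw s
      rw [mem_words] at hw
      rw [show m + 3 = (true :: true :: w).length by simp [hw],
        show true :: true :: (w ++ [s]) = (true :: true :: w) ++ [s] by simp,
        List.rotate_append_length_eq]
      simp
    have hsgn : (-1 : ℝ) ^ (m + 3) = -1 := by
      rw [pow_add, hm.neg_one_pow]; norm_num
    rw [sum_words_snoc, hsgn]
    rw [Finset.sum_congr (s₁ := words (m + 1)) (g := fun _ => (0 : ℝ))
        (f := fun w => P (false :: (w ++ [false])) *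
          (-1 * splitFun P ((true :: true :: (w ++ [false])).rotate (m + 3)))) rfl fun w hw => by
        rw [hr w hw false, splitFun_cons_false]; simp]
    rw [Finset.sum_congr (s₁ := words (m + 1)) rfl fun w hw => by rw [hr w hw true]]
    rw [← Finset.sum_neg_distrib, Finset.sum_const_zero, add_zero]
    refine Finset.sum_congr rfl fun w hw => ?_
    rw [mem_words] at hw
    rw [← hP (true :: false :: w) (by simp [hw]) 1]
    simp [splitFun]; ring
  have e3 : ∀ i ∈ Finset.range (m + 1), ∑ v ∈ words (m + 2), P (false :: v) *
      ((-1) ^ (i + 1 + 1) * splitFun P ((true :: true :: v).rotate (i + 1 + 1))) =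
      (-1) ^ i * ∑ x ∈ words i, ∑ y ∈ words (m - i),
          P (false :: x ++ true :: true :: y) * P (false :: y ++ true :: true :: x) := by
    intro i hi
    rw [Finset.mem_range] at hi
    rw [show m + 2 = i + (m - i + 1 + 1) by omega, sum_words_add, Finset.mul_sum]
    refine Finset.sum_congr rfl fun x hx => ?_
    rw [mem_words] at hx
    have hr : ∀ y, (true :: true :: (x ++ y)).rotate (i + 1 + 1) = y ++ true :: true :: x := by
      intro y
      rw [show i + 1 + 1 = (true :: true :: x).length by simp [hx],
        show true :: true :: (x ++ y) = (true :: true :: x) ++ y by simp,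
        List.rotate_append_length_eq]
    simp only [hr]
    rw [sum_words_succ, sum_words_succ]
    simp only [List.cons_append, splitFun_cons_false, splitFun_true_false, mul_zero,
      Finset.sum_const_zero, add_zero]
    rw [Finset.mul_sum]
    refine Finset.sum_congr rfl fun y _ => ?_
    simp only [splitFun]
    ring
  rw [e0, e1, e2, Finset.sum_congr rfl e3]
  simp only [← Finset.mul_sum]
  ring

lemma sum_mergeFun (P : List Bool → ℝ) (m : ℕ)
    (hP : ∀ w : List Bool, w.length = m + 3 → ∀ j, P (w.rotate j) = P w) :
    ∑ w ∈ words (m + 2), mergeFun P w * altRot (m + 2) (mergeFun P) w =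
      ∑ w ∈ words (m + 1), P (true :: true :: w) ^ 2
      - ∑ i ∈ Finset.range (m + 1), (-1) ^ i * ∑ x ∈ words i, ∑ y ∈ words (m - i),
          P (false :: x ++ true :: true :: y) * P (false :: y ++ true :: true :: x) := by
  have ht : ∀ v, mergeFun P (true :: v) = 0 := fun v => by simp [mergeFun]
  rw [sum_words_succ]
  simp only [ht, zero_mul, Finset.sum_const_zero, zero_add]
  simp only [mergeFun, altRot, Finset.mul_sum]
  rw [Finset.sum_comm, Finset.sum_range_succ', add_comm, sub_eq_add_neg]
  congr 1
  · refine Finset.sum_congr rfl fun v _ => ?_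
    simp; ring
  rw [← Finset.sum_neg_distrib]
  refine Finset.sum_congr rfl fun i hi => ?_
  rw [Finset.mem_range] at hi
  rw [show m + 1 = i + (m - i + 1) by omega, sum_words_add, ← Finset.sum_neg_distrib]
  refine Finset.sum_congr rfl fun x hx => ?_
  rw [mem_words] at hx
  have hr : ∀ y, (false :: (x ++ y)).rotate (i + 1) = y ++ false :: x := by
    intro y
    rw [show i + 1 = (false :: x).length by simp [hx],
      show false :: (x ++ y) = (false :: x) ++ y by simp,
      List.rotate_append_length_eq]
  simp only [hr]
  rw [sum_words_succ]
  simp only [List.cons_append, mul_zero, Finset.sum_const_zero, zero_add]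
  rw [← Finset.sum_neg_distrib]
  refine Finset.sum_congr rfl fun y hy => ?_
  rw [mem_words] at hy
  have g1 : P (true :: true :: (x ++ false :: y)) = P (false :: (y ++ true :: true :: x)) := by
    rw [← hP (true :: true :: (x ++ false :: y)) (by simp [hx, hy]; omega)
      (true :: true :: x).length,
      show true :: true :: (x ++ false :: y) = (true :: true :: x) ++ (false :: y) by simp,
        List.rotate_append_length_eq]
    simp
  have g2 : P (true :: true :: (y ++ false :: x)) = P (false :: (x ++ true :: true :: y)) := by
    rw [← hP (true :: true :: (y ++ false :: x)) (by simp [hx, hy]; omega)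
      (true :: true :: y).length,
      show true :: true :: (y ++ false :: x) = (true :: true :: y) ++ (false :: x) by simp,
        List.rotate_append_length_eq]
    simp
  rw [g1, g2]; ring

/-- Positivity of the energy on rotation invariant states, from the lattice supersymmetry. -/
lemma susy_nonneg (P : List Bool → ℝ) (m : ℕ) (hm : Even m)
    (hP : ∀ w : List Bool, w.length = m + 3 → ∀ j, P (w.rotate j) = P w) :
    ∑ w ∈ words (m + 3), P w * bond P w ≤ 0 := by
  have h1 := sum_altRot_nonneg (M := m + 4) (hm.add (by decide)) (by omega) (splitFun P)
  have h2 := sum_altRot_nonneg (M := m + 2) (hm.add (by decide)) (by omega) (mergeFun P)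
  rw [sum_splitFun P m hm hP] at h1
  rw [sum_mergeFun P m hP] at h2
  have e1 : ∑ v ∈ words (m + 1), P (true :: false :: v) ^ 2 =
      ∑ v ∈ words (m + 1), P (false :: true :: v) ^ 2 := by
    have a := sum_words_rotate (m + 3) 1 (fun w => if w.headD false = true then P w ^ 2 else 0)
    simp only [sum_words_succ _ (fun w : List Bool => if w.headD false = true then P w ^ 2 else 0),
      sum_words_succ _ (fun w : List Bool => if (w.rotate 1).headD false = true then
        P (w.rotate 1) ^ 2 else 0)] at a
    simp only [sum_words_succ (m + 1)] at a
    have b : ∀ s s' : Bool, ∀ v ∈ words (m + 1), P ((s :: s' :: v).rotate 1) = P (s :: s' :: v) :=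
      fun s s' v hv => hP _ (by simpa using hv) 1
    have c : ∀ s s' : Bool, ∑ v ∈ words (m + 1), (if ((s :: s' :: v).rotate 1).headD false = true
        then P ((s :: s' :: v).rotate 1) ^ 2 else 0) =
        ∑ v ∈ words (m + 1), if s' = true then P (s :: s' :: v) ^ 2 else 0 := by
      intro s s'
      refine Finset.sum_congr rfl fun v hv => ?_
      rw [b s s' v hv]; simp
    rw [c, c, c, c] at a
    simp at a
    linarith
  rw [sum_words_succ (m + 2), sum_words_succ (m + 1), sum_words_succ (m + 1)]
  rw [sum_words_succ (m + 1)] at h1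
  simp only [bond, if_true, Bool.false_eq_true, Bool.true_eq_false, if_false, mul_sub, mul_neg,
    Finset.sum_sub_distrib, Finset.sum_neg_distrib]
  simp only [sq, mul_div_assoc', ← Finset.sum_div] at *
  have e2 : ∑ v ∈ words (m + 1), P (true :: false :: v) * P (false :: true :: v) =
      ∑ v ∈ words (m + 1), P (false :: true :: v) * P (true :: false :: v) :=
    Finset.sum_congr rfl fun v _ => mul_comm _ _
  rw [e2]
  linarith

section
variable {R : Type*} [Field R]

/-- The spin-exchange part of the energy density. -/
def exchPart (f : List Bool → R) : List Bool → R
  | s :: s' :: v => if s = s' then 0 else f (s' :: s :: v)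
  | _ => 0

/-- The diagonal part of the energy density. -/
def diagPart (R : Type*) [Field R] : List Bool → R
  | s :: s' :: _ => if s = s' then 1 else 1 / 2
  | _ => 0

lemma bond_eq (f : List Bool → R) (w : List Bool) :
    bond f w = exchPart f w - diagPart R w * f w := by
  match w with
  | [] => simp [bond, exchPart, diagPart]
  | [_] => simp [bond, exchPart, diagPart]
  | s :: s' :: v =>
    simp only [bond, exchPart, diagPart]
    split_ifs <;> ring

lemma bond_add_mul (f g : List Bool → R) (t : R) (w : List Bool) :
    bond (fun u => f u + t * g u) w = bond f w + t * bond g w := by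
  match w with
  | [] => simp [bond]
  | [_] => simp [bond]
  | s :: s' :: v =>
    simp only [bond]
    split_ifs <;> ring

lemma sum_bond_symm (f g : List Bool → R) (m : ℕ) :
    ∑ w ∈ words (m + 2), f w * bond g w = ∑ w ∈ words (m + 2), g w * bond f w := by
  simp only [sum_words_succ, ← Finset.sum_add_distrib]
  refine Finset.sum_congr rfl fun w _ => ?_
  simp only [bond, if_true, Bool.false_eq_true, Bool.true_eq_false, if_false]
  ring

end

/-- Absolute values of the homogeneous components in the sector of magnetisation `-1/2`. -/
def absPhi (n : ℕ) (w : List Bool) : ℝ :=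
  if w.count true = n ∧ w.count false = n + 1 then ‖homPhi w‖ else 0

lemma absPhi_nonneg (n : ℕ) (w : List Bool) : 0 ≤ absPhi n w := by
  unfold absPhi; split_ifs <;> simp

lemma absPhi_rotate (n : ℕ) (w : List Bool) (j : ℕ) : absPhi n (w.rotate j) = absPhi n w := by
  unfold absPhi
  rw [(List.rotate_perm w j).count_eq, (List.rotate_perm w j).count_eq]
  split_ifs with h
  · rw [homPhi_rotate_iter h.1 h.2]
  · rfl

lemma exchPart_absPhi (n : ℕ) (w : List Bool) (h1 : w.count true = n)
    (h2 : w.count false = n + 1) : exchPart (absPhi n) w = ‖exchPart homPhi w‖ := by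
  match w with
  | [] => simp [exchPart]
  | [_] => simp [exchPart]
  | s :: s' :: v =>
    simp only [exchPart]
    split_ifs
    · simp
    · rw [absPhi, if_pos]
      rw [(List.Perm.swap s s' v).count_eq, (List.Perm.swap s s' v).count_eq]
      exact ⟨h1, h2⟩

lemma diagPart_cast (w : List Bool) : ((diagPart ℝ w : ℝ) : ℂ) = diagPart ℂ w := by
  match w with
  | [] => simp [diagPart]
  | [_] => simp [diagPart]
  | s :: s' :: v => simp only [diagPart]; split_ifs <;> simp

lemma diagPart_nonneg (w : List Bool) : 0 ≤ diagPart ℝ w := by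
  match w with
  | [] => simp [diagPart]
  | [_] => simp [diagPart]
  | s :: s' :: v => simp only [diagPart]; split_ifs <;> norm_num

lemma bond_absPhi_nonneg {n : ℕ} (hn : 1 ≤ n) (w : List Bool) :
    0 ≤ ∑ j ∈ Finset.range w.length, bond (absPhi n) (w.rotate j) := by
  by_cases h : w.count true = n ∧ w.count false = n + 1
  · have hc : ∀ j, (w.rotate j).count true = n ∧ (w.rotate j).count false = n + 1 := fun j => by
      rw [(List.rotate_perm w j).count_eq, (List.rotate_perm w j).count_eq]; exact h
    have h0 := homPhi_eigen hn h.1 h.2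
    simp only [bond_eq, Finset.sum_sub_distrib, homPhi_rotate_iter h.1 h.2, absPhi_rotate,
      ← Finset.sum_mul] at h0 ⊢
    rw [sub_eq_zero] at h0
    rw [Finset.sum_congr rfl fun j _ => exchPart_absPhi n _ (hc j).1 (hc j).2]
    have h1 := norm_sum_le (Finset.range w.length) fun j => exchPart homPhi (w.rotate j)
    rw [h0, norm_mul] at h1
    have h2 : ‖∑ i ∈ Finset.range w.length, diagPart ℂ (w.rotate i)‖ =
        ∑ i ∈ Finset.range w.length, diagPart ℝ (w.rotate i) := by
      simp only [← diagPart_cast]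
      rw [← Complex.ofReal_sum, Complex.norm_real, Real.norm_of_nonneg]
      exact Finset.sum_nonneg fun _ _ => diagPart_nonneg _
    rw [h2] at h1
    rw [absPhi, if_pos h]
    linarith
  · refine le_of_eq (Finset.sum_eq_zero fun j _ => ?_).symm
    have hc : ¬ ((w.rotate j).count true = n ∧ (w.rotate j).count false = n + 1) := by
      rw [(List.rotate_perm w j).count_eq, (List.rotate_perm w j).count_eq]; exact h
    generalize w.rotate j = u at *
    match u with
    | [] => simp [bond]
    | [_] => simp [bond]
    | s :: s' :: v =>
      have hc' := hc
      rw [(List.Perm.swap s' s v).count_eq, (List.Perm.swap s' s v).count_eq] at hc'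
      simp [bond, absPhi, hc', hc]

/-- The absolute values of the components are again a ground state. -/
lemma absPhi_eigen {n : ℕ} (hn : 1 ≤ n) {w : List Bool} (hw : w.length = 2 * n + 1) :
    ∑ j ∈ Finset.range w.length, bond (absPhi n) (w.rotate j) = 0 := by
  obtain ⟨m, hm, rfl⟩ : ∃ m, Even m ∧ n = m / 2 + 1 := ⟨2 * (n - 1), by simp, by omega⟩
  have hN : 2 * (m / 2 + 1) + 1 = m + 3 := by obtain ⟨r, rfl⟩ := hm; omega
  set n := m / 2 + 1
  rw [hN] at hw
  set P := absPhi n with hP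
  set g : List Bool → ℝ := fun w => ∑ j ∈ Finset.range w.length, bond P (w.rotate j) with hg
  have g0 : ∀ w, 0 ≤ g w := bond_absPhi_nonneg hn
  have grot : ∀ w j, g (w.rotate j) = g w := by
    have : ∀ w, g (w.rotate 1) = g w := by
      intro w
      simp only [hg, List.length_rotate, List.rotate_rotate]
      have a := Finset.sum_range_succ (fun j => bond P (w.rotate j)) w.length
      have b := Finset.sum_range_succ' (fun j => bond P (w.rotate j)) w.length
      rw [a] at b
      simp only [List.rotate_length, List.rotate_zero, add_left_inj] at b
      rw [b]
      exact Finset.sum_congr rfl fun j _ => by rw [add_comm]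
    intro w j
    induction j with
    | zero => simp
    | succ j ih => rw [← List.rotate_rotate, this, ih]
  have key : ∀ f : List Bool → ℝ, (∀ w j, f (w.rotate j) = f w) →
      ∑ w ∈ words (m + 3), f w * g w = (m + 3 : ℕ) * ∑ w ∈ words (m + 3), f w * bond P w := by
    intro f hf
    have : ∀ w ∈ words (m + 3), f w * g w =
        ∑ j ∈ Finset.range (m + 3), f (w.rotate j) * bond P (w.rotate j) := by
      intro w hw
      rw [mem_words] at hw
      simp only [hg, hw, Finset.mul_sum, hf]
    rw [Finset.sum_congr rfl this, Finset.sum_comm]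
    simp only [sum_words_rotate _ _ fun w => f w * bond P w]
    simp
  have hpos : (0 : ℝ) < (m + 3 : ℕ) := by positivity
  have hPP : 0 ≤ ∑ w ∈ words (m + 3), P w * bond P w := by
    have := key P (absPhi_rotate n)
    have h2 : 0 ≤ ∑ w ∈ words (m + 3), P w * g w :=
      Finset.sum_nonneg fun w _ => mul_nonneg (absPhi_nonneg n w) (g0 w)
    rw [this] at h2
    exact nonneg_of_mul_nonneg_right h2 hpos
  set b := ∑ w ∈ words (m + 3), g w * bond P w with hb
  set c := ∑ w ∈ words (m + 3), g w * bond g w with hc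
  have hgg : ∑ w ∈ words (m + 3), g w * g w = (m + 3 : ℕ) * b := key g grot
  have b0 : 0 ≤ b := by
    have : 0 ≤ ∑ w ∈ words (m + 3), g w * g w := Finset.sum_nonneg fun w _ => mul_self_nonneg _
    rw [hgg] at this
    exact nonneg_of_mul_nonneg_right this hpos
  have hq : ∀ t : ℝ, 2 * b * t + c * t ^ 2 ≤ 0 := by
    intro t
    have h := susy_nonneg (fun u => P u + t * g u) m hm fun w _ j => by
      simp only [grot, hP, absPhi_rotate]
    simp only [bond_add_mul, add_mul, mul_add, Finset.sum_add_distrib] at h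
    have h1 : ∑ x ∈ words (m + 3), P x * (t * bond g x) = t * b := by
      rw [hb, sum_bond_symm, Finset.mul_sum]
      exact Finset.sum_congr rfl fun _ _ => by ring
    have h2 : ∑ x ∈ words (m + 3), t * g x * bond P x = t * b := by
      rw [hb, Finset.mul_sum]
      exact Finset.sum_congr rfl fun _ _ => by ring
    have h3 : ∑ x ∈ words (m + 3), t * g x * (t * bond g x) = t ^ 2 * c := by
      rw [hc, Finset.mul_sum]
      exact Finset.sum_congr rfl fun _ _ => by ring
    rw [h1, h2, h3] at h
    linarith
  have hbz : b = 0 := by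
    by_contra hne
    have hbp : 0 < b := lt_of_le_of_ne b0 (Ne.symm hne)
    have hcn : c ≤ 0 := by have := hq 1; nlinarith
    have h1 := hq (b / (1 - c))
    have h2 : (0 : ℝ) < 1 - c := by linarith
    have h3 : 2 * b * (b / (1 - c)) + c * (b / (1 - c)) ^ 2 = b ^ 2 * (2 - c) / (1 - c) ^ 2 := by
      field_simp; ring
    rw [h3] at h1
    have : 0 < b ^ 2 * (2 - c) / (1 - c) ^ 2 := by
      apply div_pos (mul_pos (by positivity) (by linarith)) (by positivity)
    linarith
  rw [hbz, mul_zero, Finset.sum_eq_zero_iff_of_nonneg fun w _ => mul_self_nonneg _] at hgg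
  exact mul_self_eq_zero.1 (hgg w (by simpa using hw))

lemma qvan_replicate (d : ℕ) : qvan (List.replicate d 1) = (qc - qc ^ 2) ^ d.choose 2 := by
  induction d with
  | zero => simp [qvan]
  | succ d ih =>
    simp only [List.replicate_succ, qvan, ih, List.map_replicate, List.prod_replicate, mul_one]
    rw [← pow_add, Nat.choose_succ_succ' d 1, Nat.choose_one_right]

lemma qc_sub_sq_ne_zero : qc - qc ^ 2 ≠ 0 := by
  intro h
  have q3 := qc_rel
  have : (3 : ℂ) = 0 := by linear_combination -(qc - qc ^ 2) * h + (qc ^ 2 - 3 * qc + 3) * q3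
  norm_num at this

lemma absPhi_pos {n : ℕ} (hn : 1 ≤ n) (w : List Bool) (h1 : w.count true = n)
    (h2 : w.count false = n + 1) : 0 < absPhi n w := by
  refine word_induction (P := fun w => w.count true = n → w.count false = n + 1 → 0 < absPhi n w)
    ?_ ?_ w h1 h2
  · intro d u h1 h2
    rw [absPhi, if_pos ⟨h1, h2⟩, norm_pos_iff, homPhi]
    have := phi_sorted (List.replicate d (1 : ℂ)) (List.replicate u 1)
    simp only [List.length_replicate, List.replicate_append_replicate] at this
    rw [List.length_append, List.length_replicate, List.length_replicate, this]
    simp only [qvan_replicate]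
    exact mul_ne_zero (pow_ne_zero _ qc_sub_sq_ne_zero) (pow_ne_zero _ qc_sub_sq_ne_zero)
  · intro U V ih h1 h2
    have c1 : (U ++ false :: true :: V).Perm (U ++ true :: false :: V) :=
      List.Perm.append_left _ (List.Perm.swap _ _ _)
    have hlt := ih (by rw [c1.count_eq, h1]) (by rw [c1.count_eq, h2])
    refine lt_of_le_of_ne (absPhi_nonneg _ _) fun h0 => ?_
    have hl := count_lem (w := U ++ true :: false :: V)
    have := absPhi_eigen hn (w := U ++ true :: false :: V) (by omega)
    simp only [bond_eq, absPhi_rotate, ← h0, mul_zero, sub_zero] at this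
    have hnn : ∀ u, 0 ≤ exchPart (absPhi n) u := by
      intro u
      match u with
      | [] => simp [exchPart]
      | [_] => simp [exchPart]
      | s :: s' :: v => simp only [exchPart]; split_ifs; exacts [le_rfl, absPhi_nonneg _ _]
    rw [Finset.sum_eq_zero_iff_of_nonneg fun j _ => hnn _] at this
    have h3 := this U.length (by simp)
    rw [List.rotate_append_length_eq] at h3
    have h4 := absPhi_rotate n (U ++ false :: true :: V) U.length
    rw [List.rotate_append_length_eq] at h4
    simp [exchPart] at h3 h4
    linarith

lemma localOp_mulVec {N : ℕ} (i : Fin N) (A : Matrix Bool Bool ℂ) (Ψ : Cfg N → ℂ) (α : Cfg N) :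
    (localOp N i A).mulVec Ψ α = ∑ b, A (α i) b * Ψ (Function.update α i b) := by
  have hinj : Function.Injective fun b => Function.update α i b :=
    Function.update_injective α i
  have hprod : ∀ g : Cfg N, (∏ j ∈ Finset.univ.erase i, (if α j = g j then (1 : ℂ) else 0)) =
      if g ∈ Finset.univ.image (fun b => Function.update α i b) then 1 else 0 := by
    intro g
    by_cases h : g ∈ Finset.univ.image (fun b => Function.update α i b)
    · rw [if_pos h]
      obtain ⟨b, -, rfl⟩ := Finset.mem_image.1 h
      refine Finset.prod_eq_one fun j hj => ?_
      rw [if_pos]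
      rw [Function.update_of_ne (Finset.ne_of_mem_erase hj)]
    · rw [if_neg h, Finset.prod_eq_zero_iff]
      by_contra hc
      push Not at hc
      apply h
      rw [Finset.mem_image]
      refine ⟨g i, Finset.mem_univ _, ?_⟩
      funext j
      by_cases hj : j = i
      · subst hj; simp
      · rw [Function.update_of_ne hj]
        by_contra hne
        exact hc j (by simp [hj]) (by simp [hne])
  simp only [Matrix.mulVec, dotProduct, localOp, Matrix.of_apply, hprod, mul_ite, mul_one, mul_zero,
    ite_mul, zero_mul]
  rw [← Finset.sum_filter, Finset.filter_mem_eq_inter, Finset.univ_inter,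
    Finset.sum_image fun a _ b _ h => hinj h]
  simp

lemma cyc_ne {N : ℕ} (hN : 2 ≤ N) (i : Fin N) : cyc N i ≠ i := by
  intro h
  have := congrArg Fin.val h
  simp only [cyc] at this
  have hi := i.isLt
  by_cases h' : i.val + 1 = N
  · rw [h', Nat.mod_self] at this; omega
  · rw [Nat.mod_eq_of_lt (by omega)] at this; omega

/-- The configuration with neighbouring spins `i`, `i + 1` exchanged. -/
def swapCfg {N : ℕ} (i : Fin N) (α : Cfg N) : Cfg N := α ∘ Equiv.swap i (cyc N i)

lemma Hper_mulVec {N : ℕ} (hN : 2 ≤ N) (Ψ : Cfg N → ℂ) (α : Cfg N) :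
    (Hper N).mulVec Ψ α = ∑ i : Fin N,
      (if α i = α (cyc N i) then Ψ α / 4 else -Ψ α / 4 - Ψ (swapCfg i α)) := by
  simp only [Hper, Matrix.smul_mulVec, Pi.smul_apply, Matrix.sum_mulVec, Finset.sum_apply,
    Matrix.sub_mulVec, Matrix.add_mulVec, Pi.sub_apply, Pi.add_apply, ← Matrix.mulVec_mulVec,
    localOp_mulVec, smul_eq_mul, Finset.mul_sum]
  refine Finset.sum_congr rfl fun i _ => ?_
  have hne := cyc_ne hN i
  simp only [Fintype.sum_bool, Function.update_of_ne hne]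
  have hα : Function.update (Function.update α i (α i)) (cyc N i) (α (cyc N i)) = α := by simp
  have hs : Function.update (Function.update α i (α (cyc N i))) (cyc N i) (α i) =
      swapCfg i α := by
    funext j
    by_cases h1 : j = cyc N i
    · subst h1; simp [swapCfg]
    · rw [Function.update_of_ne h1]
      by_cases h2 : j = i
      · subst h2; simp [swapCfg]
      · rw [Function.update_of_ne h2]
        simp [swapCfg, Equiv.swap_apply_of_ne_of_ne h2 h1]
  have hI := Complex.I_mul_I
  cases ha : α i <;> cases hb : α (cyc N i) <;> simp only [ha, hb] at hα hs <;>
    simp [sigmaX, sigmaY, sigmaZ, hα, hs] <;> ring_nf <;> simp only [Complex.I_sq] <;> ring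

lemma count_ofFn {N : ℕ} (α : Cfg N) (s : Bool) :
    (List.ofFn α).count s = ∑ i, if α i = s then 1 else 0 := by
  induction N with
  | zero => simp
  | succ N ih =>
    rw [List.ofFn_succ, List.count_cons, ih, Fin.sum_univ_succ, add_comm]
    simp

lemma localOp_sigmaZ_mulVec {N : ℕ} (i : Fin N) (Ψ : Cfg N → ℂ) (α : Cfg N) :
    (localOp N i sigmaZ).mulVec Ψ α = (if α i = true then 1 else -1) * Ψ α := by
  have hα : Function.update α i (α i) = α := by simp
  rw [localOp_mulVec]
  cases ha : α i <;> rw [ha] at hα <;> simp [sigmaZ, hα]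

lemma Sz_mulVec {N : ℕ} (Ψ : Cfg N → ℂ) (α : Cfg N) :
    (Sz N).mulVec Ψ α = (((List.ofFn α).count true : ℂ) - N / 2) * Ψ α := by
  simp only [Sz, Matrix.smul_mulVec, Pi.smul_apply, Matrix.sum_mulVec, Finset.sum_apply,
    localOp_sigmaZ_mulVec, smul_eq_mul, ← Finset.sum_mul]
  rw [count_ofFn, ← mul_assoc]
  congr 1
  have : ∀ i, (if α i = true then (1 : ℂ) else -1) = 2 * (if α i = true then 1 else 0) - 1 := by
    intro i; split_ifs <;> norm_num
  simp only [this, Finset.sum_sub_distrib, ← Finset.mul_sum]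
  push_cast
  simp
  ring

lemma pUp_mulVec {N : ℕ} (i : Fin N) (Ψ : Cfg N → ℂ) (α : Cfg N) :
    (pUp N i).mulVec Ψ α = if α i = true then Ψ α else 0 := by
  simp only [pUp, Matrix.smul_mulVec, Matrix.add_mulVec, Matrix.one_mulVec, Pi.smul_apply,
    Pi.add_apply, localOp_sigmaZ_mulVec, smul_eq_mul]
  split_ifs <;> ring

lemma projProd_mulVec {N : ℕ} (k : ℕ) (Ψ : Cfg N → ℂ) (α : Cfg N) :
    (projProd N k).mulVec Ψ α = if ∀ i : Fin N, i.val < k → α i = true then Ψ α else 0 := by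
  have key : ∀ l : List (Fin N), ((l.map (pUp N)).prod).mulVec Ψ α =
      if ∀ i ∈ l, α i = true then Ψ α else 0 := by
    intro l
    induction l with
    | nil => simp
    | cons i l ih =>
      rw [List.map_cons, List.prod_cons, ← Matrix.mulVec_mulVec, pUp_mulVec, ih]
      by_cases h : α i = true <;> simp [h]
  rw [projProd, key]
  simp

/-- The emptiness formation probability is a quotient of sums over configurations. -/
lemma EFP_eq {N : ℕ} (Ψ : Cfg N → ℂ) (k : ℕ) (p : Cfg N → ℝ) (c : ℂ) (hc : c ≠ 0)
    (h : ∀ α, Ψ α = c * p α) :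
    EFP Ψ k = (∑ α, if ∀ i : Fin N, i.val < k → α i = true then (p α : ℂ) ^ 2 else 0) /
      ∑ α, (p α : ℂ) ^ 2 := by
  have hcc : starRingEnd ℂ c * c ≠ 0 :=
    mul_ne_zero ((map_ne_zero _).2 hc) hc
  rw [EFP, hermInner, hermInner, ← mul_div_mul_left _ (∑ α, (p α : ℂ) ^ 2) hcc]
  simp only [Finset.mul_sum]
  congr 1
  · refine Finset.sum_congr rfl fun α _ => ?_
    rw [projProd_mulVec]
    split_ifs
    · rw [h, map_mul, Complex.conj_ofReal]; ring
    · simp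
  · refine Finset.sum_congr rfl fun α _ => ?_
    rw [h, map_mul, Complex.conj_ofReal]; ring

/-- Uniqueness of the ground state of a nonnegative hopping matrix along edges. -/
lemma hopping_unique {ι B : Type*} [Fintype ι] [Fintype B] (e : B → ι → Prop)
    [∀ b a, Decidable (e b a)] (s : B → ι → ι) (hs : ∀ b a, s b (s b a) = a)
    (he : ∀ b a, e b (s b a) ↔ e b a) (K : ι → ℝ) (p : ι → ℝ) (hp0 : ∀ a, 0 ≤ p a)
    (hp : ∀ a, ∑ b, (if e b a then p (s b a) else 0) = K a * p a) (ψ : ι → ℝ) (ε : ℝ)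
    (hε : ε ≤ 0) (hψ : ∀ a, ∑ b, (if e b a then ψ (s b a) else 0) = (K a - ε) * ψ a)
    (hsupp : ∀ a, p a = 0 → ψ a = 0) (b : B) (a : ι) (hab : e b a) (h1 : p a ≠ 0)
    (h2 : p (s b a) ≠ 0) : ψ a / p a = ψ (s b a) / p (s b a) := by
  set r : ι → ℝ := fun a => ψ a / p a with hr
  have hψr : ∀ a, ψ a = r a * p a := by
    intro a
    by_cases h : p a = 0
    · rw [hsupp a h, h, mul_zero]
    · rw [hr]; field_simp
  set T : B → ι → ℝ := fun b a =>
    if e b a then p a * p (s b a) * (r a - r (s b a)) ^ 2 else 0 with hT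
  have hT0 : ∀ b a, 0 ≤ T b a := by
    intro b a
    simp only [hT]
    split_ifs
    · exact mul_nonneg (mul_nonneg (hp0 _) (hp0 _)) (sq_nonneg _)
    · exact le_rfl
  have hswap : ∀ (b : B) (f : ι → ι → ℝ), ∑ a, (if e b a then f a (s b a) else 0) =
      ∑ a, if e b a then f (s b a) a else 0 := by
    intro b f
    rw [← Equiv.sum_comp (Function.Involutive.toPerm (s b) (hs b))
      (fun a => if e b a then f a (s b a) else 0)]
    refine Finset.sum_congr rfl fun a _ => ?_
    change (if e b (s b a) then f (s b a) (s b (s b a)) else 0) = _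
    simp only [he, hs]
  have hsum : ∑ b, ∑ a, T b a = 2 * (ε * ∑ a, ψ a ^ 2) := by
    have h1 : ∀ b, ∑ a, T b a =
        2 * ∑ a, (if e b a then (r a ^ 2 * p a) * p (s b a) - ψ a * ψ (s b a) else 0) := by
      intro b
      have h3 : ∀ a, T b a =
          (if e b a then (r a ^ 2 * p a) * p (s b a) - ψ a * ψ (s b a) else 0) +
          (if e b a then (r (s b a) ^ 2 * p (s b a)) * p a - ψ (s b a) * ψ a else 0) := by
        intro a
        simp only [hT]
        split_ifs
        · rw [hψr a, hψr (s b a)]; ring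
        · simp
      simp only [h3, Finset.sum_add_distrib]
      rw [← hswap b fun x y => (r x ^ 2 * p x) * p y - ψ x * ψ y]
      ring
    simp only [h1, ← Finset.mul_sum]
    congr 1
    rw [Finset.sum_comm, Finset.mul_sum]
    refine Finset.sum_congr rfl fun a _ => ?_
    have h4 : ∀ b, (if e b a then (r a ^ 2 * p a) * p (s b a) - ψ a * ψ (s b a) else 0) =
        (r a ^ 2 * p a) * (if e b a then p (s b a) else 0) -
          ψ a * (if e b a then ψ (s b a) else 0) := by
      intro b; split_ifs <;> simp
    simp only [h4, Finset.sum_sub_distrib, ← Finset.mul_sum, hp, hψ]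
    rw [hψr a]; ring
  have hle : ∑ b, ∑ a, T b a ≤ 0 := by
    rw [hsum]
    have : 0 ≤ ∑ a, ψ a ^ 2 := Finset.sum_nonneg fun _ _ => sq_nonneg _
    nlinarith
  have hz : T b a = 0 := by
    have h5 : T b a ≤ ∑ b, ∑ a, T b a :=
      (Finset.single_le_sum (fun a _ => hT0 b a) (Finset.mem_univ a)).trans
        (Finset.single_le_sum (f := fun b => ∑ a, T b a)
          (fun b _ => Finset.sum_nonneg fun a _ => hT0 b a) (Finset.mem_univ b))
    exact le_antisymm (h5.trans hle) (hT0 b a)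
  simp only [hT, if_pos hab] at hz
  have h6 : (r a - r (s b a)) ^ 2 = 0 := by
    rcases mul_eq_zero.1 hz with h | h
    · rcases mul_eq_zero.1 h with h | h
      · exact absurd h h1
      · exact absurd h h2
    · exact h
  have := pow_eq_zero_iff (two_ne_zero) |>.1 h6
  simp only [hr] at this
  linarith

lemma rotate_ofFn {m : ℕ} (α : Cfg (m + 2)) (i : ℕ) :
    (List.ofFn α).rotate i =
      List.ofFn fun k : Fin (m + 2) => α ⟨(k.val + i) % (m + 2), Nat.mod_lt _ (by omega)⟩ := by
  apply List.ext_getElem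
  · simp
  · intro k h1 h2
    rw [List.getElem_rotate, List.getElem_ofFn, List.getElem_ofFn]
    simp only [List.length_ofFn]

lemma exists_rotate_swapCfg {N : ℕ} (hN : 2 ≤ N) (α : Cfg N) (i : Fin N) :
    ∃ v, (List.ofFn α).rotate i = α i :: α (cyc N i) :: v ∧
      (List.ofFn (swapCfg i α)).rotate i = α (cyc N i) :: α i :: v := by
  obtain ⟨m, rfl⟩ : ∃ m, N = m + 2 := ⟨N - 2, by omega⟩
  have e0 : ∀ h, (⟨i.val % (m + 2), h⟩ : Fin (m + 2)) = i := by
    intro h; apply Fin.ext; simp [Nat.mod_eq_of_lt i.isLt]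
  have e1 : ∀ h, (⟨(1 + i.val) % (m + 2), h⟩ : Fin (m + 2)) = cyc (m + 2) i := by
    intro h; apply Fin.ext; simp only [cyc]; rw [add_comm]
  refine ⟨List.ofFn fun k : Fin m => α ⟨(k.val + 1 + 1 + i) % (m + 2), Nat.mod_lt _ (by omega)⟩,
    ?_, ?_⟩
  · rw [rotate_ofFn, List.ofFn_succ, List.ofFn_succ]
    simp only [Fin.val_zero, Fin.val_succ, zero_add, e0, e1]
  · rw [rotate_ofFn, List.ofFn_succ, List.ofFn_succ]
    simp only [Fin.val_zero, Fin.val_succ, zero_add, e0, e1]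
    simp only [swapCfg, Function.comp, Equiv.swap_apply_left, Equiv.swap_apply_right]
    congr 3
    funext k
    congr 1
    have hk := k.isLt
    have hi := i.isLt
    apply Equiv.swap_apply_of_ne_of_ne
    · intro h
      have := congrArg Fin.val h
      simp only at this
      have h2 := Nat.div_add_mod (k.val + 1 + 1 + i.val) (m + 2)
      rw [this] at h2
      have h3 : (m + 2) * ((k.val + 1 + 1 + i.val) / (m + 2)) = k.val + 2 := by omega
      have : (m + 2) ∣ k.val + 2 := ⟨_, h3.symm⟩
      have := Nat.le_of_dvd (by omega) this
      omega
    · intro h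
      have := congrArg Fin.val h
      simp only [cyc] at this
      have h2 : (k.val + 1 + (i.val + 1)) ≡ 0 + (i.val + 1) [MOD (m + 2)] := by
        rw [Nat.ModEq, zero_add, ← this]; congr 1; ring
      have h3 := Nat.ModEq.add_right_cancel' _ h2
      have := Nat.le_of_dvd (by omega) ((Nat.modEq_zero_iff_dvd).1 h3)
      omega

lemma exchPart_rotate_ofFn {R : Type*} [Field R] {N : ℕ} (hN : 2 ≤ N) (f : List Bool → R)
    (hf : ∀ w j, f (w.rotate j) = f w) (α : Cfg N) (i : Fin N) :
    exchPart f ((List.ofFn α).rotate i) =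
      if α i ≠ α (cyc N i) then f (List.ofFn (swapCfg i α)) else 0 := by
  obtain ⟨v, h1, h2⟩ := exists_rotate_swapCfg hN α i
  rw [h1, ← hf (List.ofFn (swapCfg i α)) i, h2]
  simp only [exchPart]
  split_ifs <;> simp_all

lemma diagPart_rotate_ofFn {R : Type*} [Field R] {N : ℕ} (hN : 2 ≤ N) (α : Cfg N) (i : Fin N) :
    diagPart R ((List.ofFn α).rotate i) = if α i = α (cyc N i) then 1 else 1 / 2 := by
  obtain ⟨v, h1, -⟩ := exists_rotate_swapCfg hN α i
  rw [h1, diagPart]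

/-- Diagonal coefficient of the Hamiltonian, shifted by three quarters of the length. -/
def diagCoef {N : ℕ} (α : Cfg N) : ℝ := ∑ i : Fin N, if α i = α (cyc N i) then 1 else 1 / 2

lemma absPhi_hopping {n : ℕ} (hn : 1 ≤ n) (α : Cfg (2 * n + 1)) :
    ∑ i, (if α i ≠ α (cyc _ i) then absPhi n (List.ofFn (swapCfg i α)) else 0) =
      diagCoef α * absPhi n (List.ofFn α) := by
  have h := absPhi_eigen hn (w := List.ofFn α) (by simp)
  rw [List.length_ofFn, ← Fin.sum_univ_eq_sum_range (fun j => bond (absPhi n) (List.rotate _ j))] at h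
  simp only [bond_eq, Finset.sum_sub_distrib, absPhi_rotate, ← Finset.sum_mul,
    exchPart_rotate_ofFn (show 2 ≤ 2 * n + 1 by omega) (absPhi n) (absPhi_rotate n),
    diagPart_rotate_ofFn (show 2 ≤ 2 * n + 1 by omega)] at h
  rw [diagCoef]
  linarith

lemma Hper_hopping {N : ℕ} (hN : 2 ≤ N) (ψ : Cfg N → ℂ) (α : Cfg N) :
    (Hper N).mulVec ψ α = (diagCoef α - 3 * N / 4 : ℝ) * ψ α -
      ∑ i, (if α i ≠ α (cyc _ i) then ψ (swapCfg i α) else 0) := by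
  rw [Hper_mulVec hN]
  have : ((diagCoef α - 3 * N / 4 : ℝ) : ℂ) * ψ α =
      ∑ i : Fin N, ((if α i = α (cyc N i) then 1 else 1 / 2) - 3 / 4) * ψ α := by
    rw [← Finset.sum_mul]
    congr 1
    simp only [Finset.sum_sub_distrib, diagCoef]
    push_cast
    simp only [apply_ite Complex.ofReal]
    simp
    ring
  rw [this, ← Finset.sum_sub_distrib]
  refine Finset.sum_congr rfl fun i _ => ?_
  by_cases h : α i = α (cyc N i)
  · simp only [h, if_true, ne_eq, not_true, if_false]; ring
  · simp only [h, if_false, ne_eq, not_false_eq_true, if_true]; ring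

lemma swapCfg_swapCfg {N : ℕ} (i : Fin N) (α : Cfg N) : swapCfg i (swapCfg i α) = α := by
  funext j; simp [swapCfg]

lemma absPhi_ne_zero {n : ℕ} (hn : 1 ≤ n) {w : List Bool} :
    absPhi n w ≠ 0 ↔ w.count true = n ∧ w.count false = n + 1 := by
  constructor
  · intro h
    by_contra hc
    exact h (by rw [absPhi, if_neg hc])
  · intro h
    exact (absPhi_pos hn w h.1 h.2).ne'

/-- The configuration spelled by a word. -/
def cfgOf (N : ℕ) (w : List Bool) : Cfg N := fun i => w.getD i false

lemma ofFn_cfgOf {N : ℕ} {w : List Bool} (h : w.length = N) : List.ofFn (cfgOf N w) = w := by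
  apply List.ext_getElem
  · simp [h]
  · intro i h1 h2
    rw [List.getElem_ofFn]
    exact List.getD_eq_getElem _ _ h2

lemma cfgOf_ofFn {N : ℕ} (α : Cfg N) : cfgOf N (List.ofFn α) = α :=
  List.ofFn_injective (ofFn_cfgOf (by simp))

lemma hopping_const {n : ℕ} (hn : 1 ≤ n) (ψ : Cfg (2 * n + 1) → ℝ) (ε : ℝ) (hε : ε ≤ 0)
    (hψ : ∀ α, ∑ i, (if α i ≠ α (cyc _ i) then ψ (swapCfg i α) else 0) = (diagCoef α - ε) * ψ α)
    (hsupp : ∀ α, absPhi n (List.ofFn α) = 0 → ψ α = 0) :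
    ∃ c : ℝ, ∀ α, ψ α = c * absPhi n (List.ofFn α) := by
  set r : Cfg (2 * n + 1) → ℝ := fun α => ψ α / absPhi n (List.ofFn α) with hr
  set w₀ := List.replicate (n + 1) false ++ List.replicate n true
  have key : ∀ w : List Bool, w.count true = n → w.count false = n + 1 →
      r (cfgOf _ w) = r (cfgOf _ w₀) := by
    refine word_induction ?_ ?_
    · intro d u h1 h2
      simp [List.count_replicate] at h1 h2
      rw [h1, h2]
    · intro U V ih h1 h2
      have c1 : (U ++ false :: true :: V).Perm (U ++ true :: false :: V) :=
        List.Perm.append_left _ (List.Perm.swap _ _ _)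
      have h1' : (U ++ false :: true :: V).count true = n := by rw [c1.count_eq, h1]
      have h2' : (U ++ false :: true :: V).count false = n + 1 := by rw [c1.count_eq, h2]
      rw [← ih h1' h2']
      have hl := count_lem (w := U ++ true :: false :: V)
      rw [h1, h2, List.length_append, List.length_cons, List.length_cons] at hl
      have hl' := hl
      set i : Fin (2 * n + 1) := ⟨U.length, by omega⟩ with hi
      have hci : (cyc (2 * n + 1) i).val = U.length + 1 := by
        simp only [cyc, hi]; rw [Nat.mod_eq_of_lt (by omega)]
      have hsw : swapCfg i (cfgOf _ (U ++ true :: false :: V)) =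
          cfgOf (2 * n + 1) (U ++ false :: true :: V) := by
        funext j
        have := congrFun (getD_swap U V true false false) j.val
        simp only [Function.comp] at this
        simp only [swapCfg, Function.comp, cfgOf]
        rw [← this]
        congr 1
        simp only [Equiv.swap_apply_def, apply_ite Fin.val, hci, Fin.ext_iff]
        rfl
      have h3 : List.ofFn (cfgOf (2 * n + 1) (U ++ true :: false :: V)) = _ :=
        ofFn_cfgOf (by simp; omega)
      have h4 : List.ofFn (cfgOf (2 * n + 1) (U ++ false :: true :: V)) = _ :=
        ofFn_cfgOf (by simp; omega)
      have := hopping_unique (fun (i : Fin (2 * n + 1)) α => α i ≠ α (cyc _ i)) swapCfg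
        swapCfg_swapCfg (fun i α => by simp [swapCfg, eq_comm]) diagCoef
        (fun α => absPhi n (List.ofFn α)) (fun _ => absPhi_nonneg _ _) (absPhi_hopping hn) ψ ε hε
        hψ hsupp i (cfgOf _ (U ++ true :: false :: V))
        (by simp [cfgOf, hci]; simp [hi])
        (by rw [h3, absPhi_ne_zero hn]; exact ⟨h1, h2⟩)
        (by rw [hsw, h4, absPhi_ne_zero hn]; exact ⟨h1', h2'⟩)
      rw [hsw] at this
      exact this
  refine ⟨r (cfgOf _ w₀), fun α => ?_⟩
  by_cases h : absPhi n (List.ofFn α) = 0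
  · rw [h, mul_zero, hsupp α h]
  · have h' := (absPhi_ne_zero hn).1 h
    rw [← key _ h'.1 h'.2, cfgOf_ofFn, hr]
    field_simp

/-- Any eigenvector in the sector with eigenvalue at most `-3 N / 4` is a multiple of the vector of
absolute values. -/
lemma eigenvector_unique {n : ℕ} (hn : 1 ≤ n) (ψ : Cfg (2 * n + 1) → ℂ) (E : ℝ)
    (hE : E ≤ -(3 * (2 * n + 1 : ℕ) / 4)) (h : (Hper (2 * n + 1)).mulVec ψ = (E : ℂ) • ψ)
    (hsupp : ∀ α, absPhi n (List.ofFn α) = 0 → ψ α = 0) :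
    ∃ c : ℂ, ∀ α, ψ α = c * absPhi n (List.ofFn α) := by
  have h1 : ∀ α, ∑ i, (if α i ≠ α (cyc _ i) then ψ (swapCfg i α) else 0) =
      ((diagCoef α - (E + 3 * (2 * n + 1 : ℕ) / 4) : ℝ) : ℂ) * ψ α := by
    intro α
    have := congrFun h α
    rw [Hper_hopping (by omega), Pi.smul_apply, smul_eq_mul] at this
    push_cast at this ⊢
    linear_combination -this
  obtain ⟨a, ha⟩ := hopping_const hn (fun α => (ψ α).re) (E + 3 * (2 * n + 1 : ℕ) / 4)
    (by linarith) (fun α => by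
      have := congrArg Complex.re (h1 α)
      rw [Complex.re_ofReal_mul, Complex.re_sum] at this
      rw [← this]
      exact Finset.sum_congr rfl fun i _ => by split_ifs <;> simp)
    (fun α hα => by simp [hsupp α hα])
  obtain ⟨b, hb⟩ := hopping_const hn (fun α => (ψ α).im) (E + 3 * (2 * n + 1 : ℕ) / 4)
    (by linarith) (fun α => by
      have := congrArg Complex.im (h1 α)
      rw [Complex.im_ofReal_mul, Complex.im_sum] at this
      rw [← this]
      exact Finset.sum_congr rfl fun i _ => by split_ifs <;> simp)
    (fun α hα => by simp [hsupp α hα])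
  refine ⟨⟨a, b⟩, fun α => ?_⟩
  apply Complex.ext
  · simpa using ha α
  · simpa using hb α

/-- The homogeneous components restricted to the sector of magnetisation `-1/2`. -/
def secPhi (n : ℕ) (w : List Bool) : ℂ :=
  if w.count true = n ∧ w.count false = n + 1 then homPhi w else 0

lemma norm_secPhi (n : ℕ) (w : List Bool) : ‖secPhi n w‖ = absPhi n w := by
  unfold secPhi absPhi; split_ifs <;> simp

lemma secPhi_rotate (n : ℕ) (w : List Bool) (j : ℕ) : secPhi n (w.rotate j) = secPhi n w := by
  unfold secPhi
  rw [(List.rotate_perm w j).count_eq, (List.rotate_perm w j).count_eq]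
  split_ifs with h
  · rw [homPhi_rotate_iter h.1 h.2]
  · rfl

lemma bond_secPhi (n : ℕ) (w : List Bool) : bond (secPhi n) w =
    if w.count true = n ∧ w.count false = n + 1 then bond homPhi w else 0 := by
  match w with
  | [] => simp [bond]
  | [_] => simp [bond]
  | s :: s' :: v =>
    have h1 := fun t => (List.Perm.swap s s' v).count_eq (a := t)
    simp only [bond, secPhi, ← h1]
    split_ifs <;> simp

lemma secPhi_eigen {n : ℕ} (hn : 1 ≤ n) (w : List Bool) :
    ∑ j ∈ Finset.range w.length, bond (secPhi n) (w.rotate j) = 0 := by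
  simp only [bond_secPhi, (List.rotate_perm w _).count_eq]
  by_cases h : w.count true = n ∧ w.count false = n + 1
  · simp only [if_pos h]
    exact homPhi_eigen hn h.1 h.2
  · simp only [if_neg h, Finset.sum_const_zero]

lemma secPhi_hopping {n : ℕ} (hn : 1 ≤ n) (α : Cfg (2 * n + 1)) :
    ∑ i, (if α i ≠ α (cyc _ i) then secPhi n (List.ofFn (swapCfg i α)) else 0) =
      diagCoef α * secPhi n (List.ofFn α) := by
  have h := secPhi_eigen hn (List.ofFn α)
  rw [List.length_ofFn, ← Fin.sum_univ_eq_sum_range (fun j => bond (secPhi n) (List.rotate _ j))] at h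
  simp only [bond_eq, Finset.sum_sub_distrib, secPhi_rotate, ← Finset.sum_mul,
    exchPart_rotate_ofFn (show 2 ≤ 2 * n + 1 by omega) (secPhi n) (secPhi_rotate n),
    diagPart_rotate_ofFn (show 2 ≤ 2 * n + 1 by omega)] at h
  rw [diagCoef]
  push_cast
  simp only [apply_ite Complex.ofReal]
  push_cast
  linear_combination h

/-- Sum of products of mirrored homogeneous components over words ending with `k` up spins. -/
def upSum (n k : ℕ) : ℂ :=
  ∑ v ∈ words (2 * n + 1 - k),
    secPhi n (v ++ List.replicate k true) * secPhi n (v ++ List.replicate k true).reverse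

/-- The reflection of sites that maps the bond `(i, i+1)` to itself reversed. -/
def mirror (N : ℕ) (i : Fin N) : Fin N := Fin.rev (cyc N i)

lemma cyc_mirror {N : ℕ} (i : Fin N) : cyc N (mirror N i) = Fin.rev i := by
  apply Fin.ext
  have hi := i.isLt
  simp only [mirror, cyc, Fin.val_rev]
  by_cases h : i.val + 1 = N
  · rw [h, Nat.mod_self]
    rw [show N - (0 + 1) + 1 = N by omega, Nat.mod_self]; omega
  · rw [Nat.mod_eq_of_lt (show i.val + 1 < N by omega), Nat.mod_eq_of_lt (by omega)]
    omega

lemma mirror_mirror {N : ℕ} (i : Fin N) : mirror N (mirror N i) = i := by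
  rw [mirror, cyc_mirror, Fin.rev_rev]

lemma swapCfg_mirror {N : ℕ} (i : Fin N) (α : Cfg N) :
    swapCfg (mirror N i) (α ∘ Fin.rev) = swapCfg i α ∘ Fin.rev := by
  funext j
  simp only [swapCfg, Function.comp]
  rw [cyc_mirror, mirror]
  congr 1
  simp only [Equiv.swap_apply_def]
  rcases eq_or_ne j (cyc N i).rev with rfl | h1
  · simp only [if_true, Fin.rev_rev]
    split_ifs with h <;> simp [*]
  · have h1' : j.rev ≠ cyc N i := fun h => h1 (by rw [← h, Fin.rev_rev])
    rcases eq_or_ne j i.rev with rfl | h2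
    · rw [if_neg h1, if_pos rfl]; simp
    · have h2' : j.rev ≠ i := fun h => h2 (by rw [← h, Fin.rev_rev])
      simp [h1, h1', h2, h2']

lemma diagCoef_rev {N : ℕ} (α : Cfg N) : diagCoef (α ∘ Fin.rev) = diagCoef α := by
  unfold diagCoef
  rw [← Equiv.sum_comp (Function.Involutive.toPerm (mirror N) mirror_mirror)]
  refine Finset.sum_congr rfl fun i _ => ?_
  change (if (α ∘ Fin.rev) (mirror N i) = (α ∘ Fin.rev) (cyc N (mirror N i)) then (1 : ℝ)
    else 1 / 2) = _
  rw [cyc_mirror]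
  simp [mirror, eq_comm]

lemma ofFn_comp_rev {N : ℕ} (α : Cfg N) : List.ofFn (α ∘ Fin.rev) = (List.ofFn α).reverse := by
  apply List.ext_getElem
  · simp
  · intro i h1 h2
    simp only [List.getElem_ofFn, List.getElem_reverse, Function.comp]
    congr 1
    apply Fin.ext
    simp only [Fin.val_rev, List.length_ofFn]
    omega

lemma secPhi_hopping_reverse {n : ℕ} (hn : 1 ≤ n) (α : Cfg (2 * n + 1)) :
    ∑ i, (if α i ≠ α (cyc _ i) then secPhi n (List.ofFn (swapCfg i α)).reverse else 0) =
      diagCoef α * secPhi n (List.ofFn α).reverse := by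
  rw [← ofFn_comp_rev α, ← diagCoef_rev α, ← secPhi_hopping hn,
    ← Equiv.sum_comp (Function.Involutive.toPerm (mirror _) mirror_mirror)
      (fun i => if (α ∘ Fin.rev) i ≠ (α ∘ Fin.rev) (cyc _ i) then
        secPhi n (List.ofFn (swapCfg i (α ∘ Fin.rev))) else 0)]
  refine Finset.sum_congr rfl fun i _ => ?_
  change _ = if (α ∘ Fin.rev) (mirror _ i) ≠ (α ∘ Fin.rev) (cyc _ (mirror _ i)) then
        secPhi n (List.ofFn (swapCfg (mirror _ i) (α ∘ Fin.rev))) else 0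
  rw [swapCfg_mirror, ofFn_comp_rev, cyc_mirror]
  simp [mirror, eq_comm]

lemma sum_prefix_up {N k : ℕ} (hk : k ≤ N) (f : List Bool → ℂ)
    (hf : ∀ w j, f (w.rotate j) = f w) :
    (∑ α : Cfg N, if ∀ i : Fin N, i.val < k → α i = true then f (List.ofFn α) else 0) =
      ∑ v ∈ words (N - k), f (v ++ List.replicate k true) := by
  have h1 : (∑ α : Cfg N, if ∀ i : Fin N, i.val < k → α i = true then f (List.ofFn α) else 0) =
      ∑ w ∈ words N, if w.take k = List.replicate k true then f w else 0 := by
    rw [sum_words_ofFn]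
    refine Finset.sum_congr rfl fun α _ => ?_
    congr 1
    rw [eq_iff_iff, List.eq_replicate_iff]
    constructor
    · intro h
      refine ⟨by simp [hk], fun b hb => ?_⟩
      obtain ⟨i, hi, rfl⟩ := List.mem_iff_getElem.1 hb
      simp at hi ⊢
      exact h _ hi.1
    · rintro ⟨-, h⟩ i hi
      apply h
      rw [List.mem_iff_getElem]
      exact ⟨i.val, by simp [hi], by simp⟩
  rw [h1]
  obtain ⟨m, rfl⟩ : ∃ m, N = k + m := ⟨N - k, by omega⟩
  rw [sum_words_add, Nat.add_sub_cancel_left,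
    Finset.sum_eq_single_of_mem (List.replicate k true) (by simp)]
  · refine Finset.sum_congr rfl fun v hv => ?_
    rw [if_pos (by simp), ← hf (_ ++ v) (List.replicate k true).length,
      List.rotate_append_length_eq]
  · intro x hx hne
    refine Finset.sum_eq_zero fun v _ => if_neg ?_
    rw [mem_words] at hx
    rwa [List.take_left' hx]

lemma EFP_reduction (n : ℕ) (hn : 1 ≤ n)
    (Ψ : Cfg (2*n+1) → ℂ) (hΨ : Ψ ≠ 0) (E₀ : ℝ)
    (hground : (Hper (2*n+1)).mulVec Ψ = (E₀ : ℂ) • Ψ)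
    (hmin : ∀ (E : ℂ) (v : Cfg (2*n+1) → ℂ), v ≠ 0 →
      (Hper (2*n+1)).mulVec v = E • v → E₀ ≤ E.re)
    (hSz : (Sz (2*n+1)).mulVec Ψ = (-(1/2) : ℂ) • Ψ) :
    ∃ (S : ℕ → ℝ) (d : ℂ), d ≠ 0 ∧ ∀ k ≤ n,
      0 < S k ∧ upSum n k = d * S k ∧ EFP Ψ k = S k / S 0 := by
  have hw₀ : absPhi n (List.replicate (n + 1) false ++ List.replicate n true) ≠ 0 := by
    rw [absPhi_ne_zero hn]; simp [List.count_replicate]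
  have hE : E₀ ≤ -(3 * (2 * n + 1 : ℕ) / 4) := by
    have := hmin ((-(3 * (2 * n + 1 : ℕ) / 4) : ℝ) : ℂ)
      (fun α => (absPhi n (List.ofFn α) : ℂ)) ?_ ?_
    · simpa only [Complex.ofReal_re] using this
    · intro h
      have := congrFun h (cfgOf _ (List.replicate (n + 1) false ++ List.replicate n true))
      rw [ofFn_cfgOf (by simp; omega)] at this
      exact hw₀ (by simpa using this)
    · funext α
      rw [Hper_hopping (by omega), Pi.smul_apply, smul_eq_mul]
      have := congrArg Complex.ofReal (absPhi_hopping hn α)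
      push_cast [apply_ite Complex.ofReal] at this ⊢
      rw [this]; ring
  have hsec : ∀ α : Cfg (2 * n + 1), absPhi n (List.ofFn α) = 0 →
      (List.ofFn α).count true ≠ n := by
    intro α hα h
    have hl := count_lem (w := List.ofFn α)
    rw [List.length_ofFn] at hl
    exact (absPhi_ne_zero hn).2 ⟨h, by omega⟩ hα
  obtain ⟨c, hc⟩ := eigenvector_unique hn Ψ E₀ hE hground (fun α hα => by
    have h1 := congrFun hSz α
    rw [Sz_mulVec, Pi.smul_apply, smul_eq_mul] at h1
    have h2 : (((List.ofFn α).count true : ℂ) - n) * Ψ α = 0 := by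
      push_cast at h1
      linear_combination h1
    rcases mul_eq_zero.1 h2 with h | h
    · exact absurd (by exact_mod_cast sub_eq_zero.1 h) (hsec α hα)
    · exact h)
  obtain ⟨d, hd⟩ := eigenvector_unique hn (fun α => secPhi n (List.ofFn α))
    (-(3 * (2 * n + 1 : ℕ) / 4)) le_rfl (by
      funext α
      rw [Hper_hopping (by omega), Pi.smul_apply, smul_eq_mul, secPhi_hopping hn]
      push_cast; ring) (fun α hα => by
      rw [← norm_secPhi] at hα; exact norm_eq_zero.1 hα)
  have hrev : ∀ w : List Bool, absPhi n w = 0 → secPhi n w.reverse = 0 := by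
    intro w hw
    rw [secPhi, List.count_reverse, List.count_reverse, if_neg]
    rwa [← absPhi_ne_zero hn, not_not]
  obtain ⟨e, he⟩ := eigenvector_unique hn (fun α => secPhi n (List.ofFn α).reverse)
    (-(3 * (2 * n + 1 : ℕ) / 4)) le_rfl (by
      funext α
      rw [Hper_hopping (by omega), Pi.smul_apply, smul_eq_mul, secPhi_hopping_reverse hn]
      push_cast; ring) (fun α hα => hrev _ hα)
  have hc0 : c ≠ 0 := by
    rintro rfl
    exact hΨ (funext fun α => by simp [hc])
  have hd' : ∀ w : List Bool, w.length = 2 * n + 1 → secPhi n w = d * absPhi n w := by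
    intro w hw
    have := hd (cfgOf _ w)
    simpa only [ofFn_cfgOf hw] using this
  have hd0 : d ≠ 0 := by
    rintro rfl
    have := hd' (List.replicate (n + 1) false ++ List.replicate n true) (by simp; omega)
    rw [zero_mul] at this
    rw [← norm_secPhi, this, norm_zero] at hw₀
    exact hw₀ rfl
  have he' : ∀ w : List Bool, w.length = 2 * n + 1 → secPhi n w.reverse = e * absPhi n w := by
    intro w hw
    have := he (cfgOf _ w)
    simpa only [ofFn_cfgOf hw] using this
  have he0 : e ≠ 0 := by
    rintro rfl
    have h2 : absPhi n (List.replicate n true ++ List.replicate (n + 1) false) ≠ 0 := by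
      rw [absPhi_ne_zero hn]; simp [List.count_replicate]
    have := he' (List.replicate (n + 1) false ++ List.replicate n true) (by simp; omega)
    rw [zero_mul, List.reverse_append, List.reverse_replicate, List.reverse_replicate] at this
    rw [← norm_secPhi, this, norm_zero] at h2
    exact h2 rfl
  have hS : ∀ k ≤ n, (∑ α : Cfg (2 * n + 1), if ∀ i : Fin (2 * n + 1), i.val < k → α i = true then
      (absPhi n (List.ofFn α) : ℂ) ^ 2 else 0) =
      ((∑ v ∈ words (2 * n + 1 - k), absPhi n (v ++ List.replicate k true) ^ 2 : ℝ) : ℂ) := by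
    intro k hk
    rw [sum_prefix_up (by omega) (fun w => (absPhi n w : ℂ) ^ 2)
      (fun w j => by simp only [absPhi_rotate])]
    push_cast
    rfl
  refine ⟨fun k => ∑ v ∈ words (2 * n + 1 - k), absPhi n (v ++ List.replicate k true) ^ 2, d * e,
    mul_ne_zero hd0 he0, fun k hk => ⟨?_, ?_, ?_⟩⟩
  · apply Finset.sum_pos'
    · intro v _; exact sq_nonneg _
    · refine ⟨List.replicate (n + 1) false ++ List.replicate (n - k) true, by simp; omega, ?_⟩
      have := absPhi_pos hn (List.replicate (n + 1) false ++ List.replicate (n - k) true ++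
        List.replicate k true) (by simp [List.count_replicate]; omega)
        (by simp [List.count_replicate])
      positivity
  · simp only [upSum]
    push_cast
    rw [Finset.mul_sum]
    refine Finset.sum_congr rfl fun v hv => ?_
    rw [mem_words] at hv
    rw [hd' _ (by simp; omega), he' _ (by simp; omega)]; ring
  · rw [EFP_eq Ψ k (fun α => absPhi n (List.ofFn α)) c hc0 hc, hS k hk, ← hS 0 (by omega)]
    simp

/-- Product of the variables sitting on up spins. -/
def upProd (w : List Bool) (x : List ℂ) : ℂ :=
  (List.zipWith (fun s t => if s = true then t else 1) w x).prod

/-- The mirrored inhomogeneous ground state. -/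
def psi (w : List Bool) (x : List ℂ) : ℂ := upProd w x * phi w.reverse x.reverse

lemma upProd_append {U : List Bool} {A : List ℂ} (h : U.length = A.length) (V : List Bool)
    (B : List ℂ) : upProd (U ++ V) (A ++ B) = upProd U A * upProd V B := by
  rw [upProd, List.zipWith_append h, List.prod_append]; rfl

lemma upProd_cons (s : Bool) (t : ℂ) (V : List Bool) (B : List ℂ) :
    upProd (s :: V) (t :: B) = (if s = true then t else 1) * upProd V B := by
  simp [upProd]

lemma upProd_false (d : ℕ) (x : List ℂ) : upProd (List.replicate d false) x = 1 := by
  induction d generalizing x with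
  | zero => simp [upProd]
  | succ d ih =>
    cases x with
    | nil => simp [upProd]
    | cons a x => rw [List.replicate_succ, upProd_cons, ih]; simp

lemma upProd_true (x : List ℂ) : upProd (List.replicate x.length true) x = x.prod := by
  induction x with
  | nil => simp [upProd]
  | cons a x ih => rw [List.length_cons, List.replicate_succ, upProd_cons, ih]; simp

lemma psi_polyDeg (w : List Bool) (n : ℕ) (h : ∀ s, w.count s ≤ n + 1) (A B : List ℂ) :
    PolyDeg (n + 1) fun t => psi w (A ++ t :: B) := by
  rw [show n + 1 = 1 + n by ring]
  refine PolyDeg.mul ?_ ?_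
  · by_cases hw : w.length ≤ A.length
    · have : (fun t => upProd w (A ++ t :: B)) = fun _ => upProd w A := by
        funext t
        obtain ⟨A1, A2, rfl, hA⟩ : ∃ A1 A2, A = A1 ++ A2 ∧ A1.length = w.length :=
          ⟨A.take w.length, A.drop w.length, by simp, by simp [hw]⟩
        have h1 := upProd_append hA.symm [] (A2 ++ t :: B)
        have h2 := upProd_append hA.symm [] A2
        simp only [List.append_nil] at h1 h2
        rw [List.append_assoc, h1, h2]; simp [upProd]
      rw [this]; exact polyDeg_const _ _
    · obtain ⟨U, s, V, rfl, hU⟩ : ∃ U s V, w = U ++ s :: V ∧ U.length = A.length := by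
        refine ⟨w.take A.length, w[A.length]'(by omega), w.drop (A.length + 1), ?_, ?_⟩
        · rw [List.getElem_cons_drop, List.take_append_drop]
        · simp; omega
      simp only [upProd_append hU, upProd_cons]
      refine PolyDeg.const_mul _ ?_
      by_cases hs : s = true
      · simpa [hs, mul_comm] using polyDeg_affine (upProd V B) 0
      · simpa [hs] using polyDeg_const 1 (upProd V B)
  · have := phi_polyDeg w.reverse n (by simpa using h) B.reverse A.reverse
    simpa using this

lemma psi_middle (U V : List Bool) (s s' : Bool) (A B : List ℂ) (a b : ℂ)
    (h : U.length = A.length) :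
    psi (U ++ s :: s' :: V) (A ++ a :: b :: B) =
      upProd U A * upProd V B * (if s = true then a else 1) * (if s' = true then b else 1) *
        phi (V.reverse ++ s' :: s :: U.reverse) (B.reverse ++ b :: a :: A.reverse) := by
  simp only [psi, upProd_append h, upProd_cons, List.reverse_append, List.reverse_cons,
    List.append_assoc, List.cons_append, List.nil_append]
  ring

lemma psi_exch_aligned (U V : List Bool) (s : Bool) (A B : List ℂ) (a b : ℂ)
    (hV : V.length = B.length) (h : U.length = A.length) :
    (qc * b - qc ^ 2 * a) * psi (U ++ s :: s :: V) (A ++ b :: a :: B) =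
      (qc * a - qc ^ 2 * b) * psi (U ++ s :: s :: V) (A ++ a :: b :: B) := by
  have := phi_exch_aligned V.reverse U.reverse s B.reverse A.reverse b a (by simpa using hV)
  simp only [psi_middle _ _ _ _ _ _ _ _ h]
  linear_combination (upProd U A * upProd V B * (if s = true then a else 1) *
    (if s = true then b else 1)) * this

lemma psi_exch_ft (U V : List Bool) (A B : List ℂ) (a b : ℂ)
    (hV : V.length = B.length) (h : U.length = A.length) :
    (qc * b - qc ^ 2 * a) * psi (U ++ false :: true :: V) (A ++ b :: a :: B) =
      (a - b) * psi (U ++ true :: false :: V) (A ++ a :: b :: B) +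
      (qc - qc ^ 2) * a * psi (U ++ false :: true :: V) (A ++ a :: b :: B) := by
  have := phi_exch_tf V.reverse U.reverse B.reverse A.reverse b a (by simpa using hV)
  simp only [psi_middle _ _ _ _ _ _ _ _ h]
  simp only [if_true, Bool.false_eq_true, if_false]
  linear_combination (upProd U A * upProd V B * a) * this

lemma psi_exch_tf (U V : List Bool) (A B : List ℂ) (a b : ℂ)
    (hV : V.length = B.length) (h : U.length = A.length) :
    (qc * b - qc ^ 2 * a) * psi (U ++ true :: false :: V) (A ++ b :: a :: B) =
      (a - b) * psi (U ++ false :: true :: V) (A ++ a :: b :: B) +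
      (qc - qc ^ 2) * b * psi (U ++ true :: false :: V) (A ++ a :: b :: B) := by
  have := phi_exch_ft V.reverse U.reverse B.reverse A.reverse b a (by simpa using hV)
  simp only [psi_middle _ _ _ _ _ _ _ _ h]
  simp only [if_true, Bool.false_eq_true, if_false]
  linear_combination (upProd U A * upProd V B * b) * this

/-- The combination of mirrored components that pairs with a vanishing pair of variables. -/
lemma psi_pair (U V : List Bool) (A B : List ℂ) (a : ℂ) (ha : a ≠ 0) (hU : U.length = A.length)
    (hV : V.length = B.length) (hG : Gen (a :: (A ++ B))) :
    psi (U ++ false :: true :: V) (A ++ a :: (qc ^ 2 * a) :: B) -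
      qc * psi (U ++ true :: false :: V) (A ++ a :: (qc ^ 2 * a) :: B) =
    qc ^ 2 * a * (pairCst (U ++ V) * pairFac a (A ++ B) * psi (U ++ V) (A ++ B)) := by
  have hp : (B.reverse ++ A.reverse).Perm (A ++ B) :=
    List.perm_append_comm.trans ((List.reverse_perm A).append (List.reverse_perm B))
  have hw : (V.reverse ++ U.reverse).Perm (U ++ V) :=
    List.perm_append_comm.trans ((List.reverse_perm U).append (List.reverse_perm V))
  have h1 := phi_pair V.reverse U.reverse B.reverse A.reverse a (by simpa using hV)
    (by simpa using hU) (hG.perm (hp.symm.cons a))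
  rw [pairFac_perm a hp, pairCst_perm hw] at h1
  have h2 := phi_exch_ft V.reverse U.reverse B.reverse A.reverse (qc ^ 2 * a) a
    (by simpa using hV)
  rw [h1] at h2
  simp only [psi_middle _ _ _ _ _ _ _ _ hU]
  have h3 : psi (U ++ V) (A ++ B) = upProd U A * upProd V B *
    phi (V.reverse ++ U.reverse) (B.reverse ++ A.reverse) := by
    simp only [psi, upProd_append hU, List.reverse_append]
  rw [h3]
  simp only [if_true, Bool.false_eq_true, if_false]
  generalize phi (V.reverse ++ U.reverse) (B.reverse ++ A.reverse) = X at *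
  generalize phi (V.reverse ++ true :: false :: U.reverse)
    (B.reverse ++ qc ^ 2 * a :: a :: A.reverse) = Y at *
  generalize phi (V.reverse ++ false :: true :: U.reverse)
    (B.reverse ++ qc ^ 2 * a :: a :: A.reverse) = Z at *
  generalize upProd U A * upProd V B = W at *
  generalize pairCst (U ++ V) * pairFac a (A ++ B) = T at *
  have q3 := qc_rel
  have h4 : T * X = Y - qc ^ 2 * Z := by
    have h5 : (qc * (qc ^ 2 * a) - qc ^ 2 * a) ≠ 0 := by
      rw [show qc * (qc ^ 2 * a) - qc ^ 2 * a = (1 - qc ^ 2) * a by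
        linear_combination a * qc_cube]
      refine mul_ne_zero (fun h => ?_) ha
      have : (3 : ℂ) = 0 := by clear * - h q3; grind
      norm_num at this
    apply mul_left_cancel₀ h5
    clear * - q3 h2
    grind
  clear * - q3 h4
  grind

lemma sum_words_middle (a b : ℕ) (f : List Bool → ℂ) :
    ∑ w ∈ words (a + (b + 2)), f w = ∑ U ∈ words a, ∑ V ∈ words b,
      (f (U ++ true :: true :: V) + f (U ++ false :: false :: V) +
        (f (U ++ true :: false :: V) + f (U ++ false :: true :: V))) := by
  rw [sum_words_add]
  refine Finset.sum_congr rfl fun U _ => ?_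
  simp only [sum_words_succ, ← Finset.sum_add_distrib]
  refine Finset.sum_congr rfl fun V _ => ?_
  ring

/-- The term of the bilinear form associated with a word. -/
def bilinTerm (n : ℕ) (z y y' : List ℂ) (v : List Bool) : ℂ :=
  if v.count true + y.length = n ∧ v.count false = n + 1 then
    phi (v ++ List.replicate y.length true) (z ++ y) *
      psi (v ++ List.replicate y.length true) (z ++ y')
  else 0

/-- The inhomogeneous version of `upSum`. -/
def bilin (n : ℕ) (z y y' : List ℂ) : ℂ := ∑ v ∈ words z.length, bilinTerm n z y y' v

lemma bilin_swap (n : ℕ) (A B y y' : List ℂ) (a b : ℂ) (hy : y'.length = y.length)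
    (h : a ^ 2 + a * b + b ^ 2 ≠ 0) :
    bilin n (A ++ b :: a :: B) y y' = bilin n (A ++ a :: b :: B) y y' := by
  have hD : (qc * a - qc ^ 2 * b) * (qc * b - qc ^ 2 * a) ≠ 0 := by
    intro h'; apply h
    have q3 := qc_rel
    clear * - h' q3
    grind
  apply mul_left_cancel₀ hD
  have e : ∀ t s : ℂ, (A ++ t :: s :: B).length = A.length + (B.length + 2) := by
    intro t s; simp
  unfold bilin
  rw [e, e, sum_words_middle, sum_words_middle]
  simp only [Finset.mul_sum]
  refine Finset.sum_congr rfl fun U hU => Finset.sum_congr rfl fun V hV => ?_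
  rw [mem_words] at hU hV
  have hU' := hU
  have hV1 : (V ++ List.replicate y.length true).length = (B ++ y').length := by simp [hV, hy]
  have hal : ∀ s, (qc * a - qc ^ 2 * b) * (qc * b - qc ^ 2 * a) *
      bilinTerm n (A ++ b :: a :: B) y y' (U ++ s :: s :: V) =
      (qc * a - qc ^ 2 * b) * (qc * b - qc ^ 2 * a) *
      bilinTerm n (A ++ a :: b :: B) y y' (U ++ s :: s :: V) := by
    intro s
    unfold bilinTerm
    split_ifs
    · have h1 := phi_exch_aligned U (V ++ List.replicate y.length true) s A (B ++ y) a b hU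
      have h2 := psi_exch_aligned U (V ++ List.replicate y.length true) s A (B ++ y') a b hV1 hU
      simp only [List.append_assoc, List.cons_append]
      generalize phi (U ++ s :: s :: (V ++ _)) (A ++ b :: a :: (B ++ y)) = X at *
      generalize phi (U ++ s :: s :: (V ++ _)) (A ++ a :: b :: (B ++ y)) = X' at *
      generalize psi (U ++ s :: s :: (V ++ _)) (A ++ b :: a :: (B ++ y')) = Y at *
      generalize psi (U ++ s :: s :: (V ++ _)) (A ++ a :: b :: (B ++ y')) = Y' at *
      linear_combination (qc * b - qc ^ 2 * a) * Y * h1 + (qc * b - qc ^ 2 * a) * X' * h2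
    · rfl
  have hop : (qc * a - qc ^ 2 * b) * (qc * b - qc ^ 2 * a) *
      (bilinTerm n (A ++ b :: a :: B) y y' (U ++ true :: false :: V) +
        bilinTerm n (A ++ b :: a :: B) y y' (U ++ false :: true :: V)) =
      (qc * a - qc ^ 2 * b) * (qc * b - qc ^ 2 * a) *
      (bilinTerm n (A ++ a :: b :: B) y y' (U ++ true :: false :: V) +
        bilinTerm n (A ++ a :: b :: B) y y' (U ++ false :: true :: V)) := by
    have hc : ∀ s, (U ++ true :: false :: V).count s = (U ++ false :: true :: V).count s :=
      fun s => ((List.Perm.swap _ _ V).append_left U).count_eq s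
    unfold bilinTerm
    rw [hc, hc]
    split_ifs
    · have h1 := phi_exch_ft U (V ++ List.replicate y.length true) A (B ++ y) a b hU
      have h2 := psi_exch_ft U (V ++ List.replicate y.length true) A (B ++ y') a b hV1 hU
      have h3 := phi_exch_tf U (V ++ List.replicate y.length true) A (B ++ y) a b hU
      have h4 := psi_exch_tf U (V ++ List.replicate y.length true) A (B ++ y') a b hV1 hU
      simp only [List.append_assoc, List.cons_append]
      generalize phi (U ++ true :: false :: (V ++ _)) (A ++ b :: a :: (B ++ y)) = X1 at *
      generalize phi (U ++ true :: false :: (V ++ _)) (A ++ a :: b :: (B ++ y)) = X1' at *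
      generalize psi (U ++ true :: false :: (V ++ _)) (A ++ b :: a :: (B ++ y')) = Y1 at *
      generalize psi (U ++ true :: false :: (V ++ _)) (A ++ a :: b :: (B ++ y')) = Y1' at *
      generalize phi (U ++ false :: true :: (V ++ _)) (A ++ b :: a :: (B ++ y)) = X2 at *
      generalize phi (U ++ false :: true :: (V ++ _)) (A ++ a :: b :: (B ++ y)) = X2' at *
      generalize psi (U ++ false :: true :: (V ++ _)) (A ++ b :: a :: (B ++ y')) = Y2 at *
      generalize psi (U ++ false :: true :: (V ++ _)) (A ++ a :: b :: (B ++ y')) = Y2' at *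
      have e1 : (qc * a - qc ^ 2 * b) * (qc * b - qc ^ 2 * a) * (X1 * Y1 + X2 * Y2) =
        ((qc * a - qc ^ 2 * b) * X1) * ((qc * b - qc ^ 2 * a) * Y1) +
        ((qc * a - qc ^ 2 * b) * X2) * ((qc * b - qc ^ 2 * a) * Y2) := by ring
      rw [e1, h1, h2, h3, h4]
      have q3 := qc_rel
      clear * - q3
      grind
    · rfl
  linear_combination hal true + hal false + hop

lemma PolyDeg.sum {ι : Type*} {d : ℕ} (s : Finset ι) (f : ι → ℂ → ℂ)
    (h : ∀ i ∈ s, PolyDeg d (f i)) : PolyDeg d fun t => ∑ i ∈ s, f i t := by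
  classical
  induction s using Finset.induction_on with
  | empty => simpa using polyDeg_const d 0
  | insert i s hi ih =>
    simp only [Finset.sum_insert hi]
    exact (h i (by simp)).add (ih fun j hj => h j (by simp [hj]))

lemma bilin_polyDeg (n : ℕ) (A B y y' : List ℂ) :
    PolyDeg (2 * n + 1) fun t => bilin n (A ++ t :: B) y y' := by
  unfold bilin
  have e : ∀ t : ℂ, (A ++ t :: B).length = A.length + (B.length + 1) := by intro t; simp
  simp only [e]
  refine PolyDeg.sum _ _ fun v _ => ?_
  unfold bilinTerm
  split_ifs with h
  · have hc : ∀ s, (v ++ List.replicate y.length true).count s ≤ n + 1 := by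
      intro s; cases s <;> simp [List.count_replicate] <;> omega
    rw [show 2 * n + 1 = n + (n + 1) by ring]
    simp only [List.append_assoc, List.cons_append]
    exact (phi_polyDeg _ n hc A (B ++ y)).mul (psi_polyDeg _ n hc A (B ++ y'))
  · exact polyDeg_const _ _

lemma bilin_polyDeg_left (n : ℕ) (z A B y' : List ℂ) :
    PolyDeg n fun t => bilin n z (A ++ t :: B) y' := by
  unfold bilin
  refine PolyDeg.sum _ _ fun v _ => ?_
  unfold bilinTerm
  have e : ∀ t : ℂ, (A ++ t :: B).length = A.length + (B.length + 1) := by intro t; simp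
  simp only [e]
  split_ifs with h
  · have hc : ∀ s, (v ++ List.replicate (A.length + (B.length + 1)) true).count s ≤ n + 1 := by
      intro s; cases s <;> simp [List.count_replicate] <;> omega
    simp only [← List.append_assoc z]
    have := (polyDeg_const 0 (psi (v ++ List.replicate (A.length + (B.length + 1)) true)
      (z ++ y'))).mul (phi_polyDeg _ n hc (z ++ A) B)
    simpa [mul_comm] using this
  · exact polyDeg_const _ _

lemma bilin_polyDeg_right (n : ℕ) (z y A B : List ℂ) :
    PolyDeg (n + 1) fun t => bilin n z y (A ++ t :: B) := by
  unfold bilin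
  refine PolyDeg.sum _ _ fun v _ => ?_
  unfold bilinTerm
  split_ifs with h
  · have hc : ∀ s, (v ++ List.replicate y.length true).count s ≤ n + 1 := by
      intro s; cases s <;> simp [List.count_replicate] <;> omega
    simp only [← List.append_assoc z]
    exact (psi_polyDeg _ n hc (z ++ A) B).const_mul _
  · exact polyDeg_const _ _

lemma bilin_pair (n : ℕ) (A B y y' : List ℂ) (a : ℂ) (hy : y'.length = y.length)
    (hG : Gen (a :: (A ++ B ++ y))) (hG' : Gen (a :: (A ++ B ++ y'))) :
    bilin (n + 1) (A ++ a :: (qc ^ 2 * a) :: B) y y' =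
      qc * a * pairFac a (A ++ B ++ y) * pairFac a (A ++ B ++ y') * bilin n (A ++ B) y y' := by
  have e : (A ++ a :: (qc ^ 2 * a) :: B).length = A.length + (B.length + 2) := by simp
  have ha := (gen_cons.1 hG).1
  unfold bilin
  rw [e, sum_words_middle, List.length_append, sum_words_add]
  simp only [Finset.mul_sum]
  refine Finset.sum_congr rfl fun U hU => Finset.sum_congr rfl fun V hV => ?_
  rw [mem_words] at hU hV
  have hV1 : (V ++ List.replicate y.length true).length = (B ++ y).length := by simp [hV]
  have hV2 : (V ++ List.replicate y.length true).length = (B ++ y').length := by simp [hV, hy]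
  rw [List.append_assoc] at hG hG'
  have hal : ∀ s, bilinTerm (n + 1) (A ++ a :: (qc ^ 2 * a) :: B) y y' (U ++ s :: s :: V) = 0 := by
    intro s
    unfold bilinTerm
    have := phi_pair_aligned U (V ++ List.replicate y.length true) s A (B ++ y) a ha hU
    simp only [List.append_assoc, List.cons_append, this, zero_mul, ite_self]
  rw [hal, hal]
  have hc : ∀ s, (U ++ true :: false :: V).count s = (U ++ V).count s + 1 := by
    intro s; cases s <;> simp <;> omega
  have hc' : ∀ s, (U ++ false :: true :: V).count s = (U ++ V).count s + 1 := by
    intro s; cases s <;> simp <;> omega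
  unfold bilinTerm
  rw [hc, hc', hc, hc']
  by_cases h : (U ++ V).count true + y.length = n ∧ (U ++ V).count false = n + 1
  · rw [if_pos (by omega), if_pos (by omega), if_pos h]
    have h1 := phi_pair_tf U (V ++ List.replicate y.length true) A (B ++ y) a ha hU
    have h2 := phi_pair U (V ++ List.replicate y.length true) A (B ++ y) a hU hV1 hG
    have h3 := psi_pair U (V ++ List.replicate y.length true) A (B ++ y') a ha hU hV2 hG'
    have h4 : pairCst (U ++ (V ++ List.replicate y.length true)) ^ 2 = qc ^ 2 := by
      unfold pairCst
      have t1 : (U ++ (V ++ List.replicate y.length true)).count true = n := by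
        simp at h ⊢; omega
      have t2 : (U ++ (V ++ List.replicate y.length true)).count false = n + 1 := by
        simp [List.count_replicate] at h ⊢; omega
      rw [t1, t2]
      calc (qc ^ (n + 1) * (-qc ^ 2) ^ n) ^ 2 = (qc ^ 3) ^ (2 * n) * qc ^ 2 := by
            rw [neg_pow, ← pow_mul, mul_pow, mul_pow, ← pow_mul (-1 : ℂ), mul_comm n 2,
              pow_mul (-1 : ℂ)]
            norm_num; ring
        _ = qc ^ 2 := by rw [qc_cube]; simp
    simp only [List.append_assoc, List.cons_append]
    rw [h1, h2]
    rw [h2] at h1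
    generalize psi (U ++ false :: true :: (V ++ _)) (A ++ a :: qc ^ 2 * a :: (B ++ y')) = Y1 at *
    generalize psi (U ++ true :: false :: (V ++ _)) (A ++ a :: qc ^ 2 * a :: (B ++ y')) = Y2 at *
    generalize pairCst (U ++ (V ++ List.replicate y.length true)) = p at *
    generalize pairFac a (A ++ (B ++ y)) = f at *
    generalize pairFac a (A ++ (B ++ y')) = f' at *
    generalize phi (U ++ (V ++ List.replicate y.length true)) (A ++ (B ++ y)) = X at *
    generalize psi (U ++ (V ++ List.replicate y.length true)) (A ++ (B ++ y')) = Y at *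
    linear_combination (p * f * X) * h3 + qc ^ 2 * a * f * X * f' * Y * h4 +
      qc * a * f * X * f' * Y * qc_cube
  · rw [if_neg (by omega), if_neg (by omega), if_neg h]; ring

/-- Moving a whole block of up spins through the periodic boundary. -/
lemma phi_cyclic_block (n : ℕ) (u w : List Bool) (x z : List ℂ) (hu : u.length = x.length)
    (h1 : (u ++ w).count true = n) (h2 : (u ++ w).count false = n + 1)
    (hz : (x ++ z).length = 2 * n + 1) : phi (u ++ w) (x ++ z) = phi (w ++ u) (z ++ x) := by
  induction u generalizing w x z with
  | nil =>
    have : x = [] := List.length_eq_zero_iff.1 hu.symm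
    subst this; simp
  | cons s u ih =>
    match x, hu with
    | a :: x, hu =>
      have := phi_cyclic n s (u ++ w) a (x ++ z) h1 h2 (by simpa using hz)
      rw [List.cons_append, List.cons_append, this, List.append_assoc, List.append_assoc,
        ih (w ++ [s]) x (z ++ [a]) (by simpa using hu) ?_ ?_ (by simp at hz ⊢; omega)]
      · simp
      · rw [← h1]; exact List.Perm.count_eq (by
          rw [List.cons_append, ← List.append_assoc]; exact List.perm_append_singleton _ _) _
      · rw [← h2]; exact List.Perm.count_eq (by
          rw [List.cons_append, ← List.append_assoc]; exact List.perm_append_singleton _ _) _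

lemma eq_replicate_false_of_count {v : List Bool} (h : v.count true = 0) :
    v = List.replicate v.length false := by
  rw [List.eq_replicate_iff]
  refine ⟨rfl, fun b hb => ?_⟩
  cases b with
  | false => rfl
  | true => exact absurd hb (List.count_eq_zero.1 h)

lemma bilin_base (k : ℕ) (z y y' : List ℂ) (hz : z.length = k + 1) (hy : y.length = k)
    (hy' : y'.length = k) :
    bilin k z y y' = qvan z * qvan z.reverse * (qvan y * y'.prod * qvan y'.reverse) := by
  unfold bilin
  rw [Finset.sum_eq_single_of_mem (List.replicate (k + 1) false) (by simp [mem_words, hz])]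
  · unfold bilinTerm
    rw [if_pos (by simp [List.count_replicate, hy])]
    have h1 := phi_sorted z y
    rw [hz, hy] at h1
    have hr := phi_cyclic_block k (List.replicate k true) (List.replicate (k + 1) false)
      y'.reverse z.reverse (by simp [hy']) (by simp [List.count_replicate])
      (by simp [List.count_replicate]) (by simp [hy', hz]; omega)
    have h2 := phi_sorted z.reverse y'.reverse
    rw [List.length_reverse, List.length_reverse, hz, hy'] at h2
    have h3 : psi (List.replicate (k + 1) false ++ List.replicate k true) (z ++ y') =
        y'.prod * (qvan z.reverse * qvan y'.reverse) := by
      rw [psi, upProd_append (by simp [hz]), upProd_false, one_mul]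
      rw [List.reverse_append, List.reverse_append, List.reverse_replicate,
        List.reverse_replicate, hr, h2]
      congr 1
      rw [← hy']; exact upProd_true y'
    rw [hy, h1, h3]; ring
  · intro v hv hne
    rw [mem_words] at hv
    unfold bilinTerm
    rw [if_neg]
    rintro ⟨h1, h2⟩
    apply hne
    have := eq_replicate_false_of_count (v := v) (by omega)
    rw [this, hv, hz]

lemma bilin_one (n k : ℕ) (hk : k ≤ n) :
    bilin n (List.replicate (2 * n + 1 - k) 1) (List.replicate k 1) (List.replicate k 1) =
      upSum n k := by
  unfold bilin upSum
  rw [List.length_replicate]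
  refine Finset.sum_congr rfl fun v hv => ?_
  rw [mem_words] at hv
  have e : List.replicate (2 * n + 1 - k) (1 : ℂ) ++ List.replicate k 1 =
      List.replicate (v ++ List.replicate k true).length 1 := by
    rw [List.replicate_append_replicate, List.length_append, hv, List.length_replicate]
  have hu : ∀ w : List Bool, upProd w (List.replicate w.length 1) = 1 := by
    intro w
    induction w with
    | nil => simp [upProd]
    | cons s w ih => rw [List.length_cons, List.replicate_succ, upProd_cons, ih]; simp
  unfold bilinTerm secPhi psi
  rw [List.length_replicate, e, hu, one_mul, List.count_reverse, List.count_reverse]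
  have hc : (v.count true + k = n ∧ v.count false = n + 1) ↔
      ((v ++ List.replicate k true).count true = n ∧
        (v ++ List.replicate k true).count false = n + 1) := by
    simp [List.count_replicate]
  simp only [hc]
  split_ifs
  · rw [List.reverse_replicate, homPhi, homPhi, List.length_reverse]
  · simp

section SignedDeterminants

open Matrix

variable {R : Type*} [CommRing R]
variable {α β α' β' : Type*} [Fintype α'] [DecidableEq α'] [Fintype β']
  [DecidableEq β'] [Fintype α] [DecidableEq α] [Fintype β] [DecidableEq β]

/-- The determinant, up to sign, of a matrix with equally many rows and columns. -/
def mdet (A : Matrix α β R) : R :=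
  if h : Fintype.card α = Fintype.card β then
    (A.submatrix id (Fintype.equivOfCardEq h)).det else 0

lemma mdet_eq_det (g : α ≃ β) :
    ∃ ε : R, ε ^ 2 = 1 ∧ ∀ A : Matrix α β R, mdet A = ε * (A.submatrix id g).det := by
  have h : Fintype.card α = Fintype.card β := Fintype.card_congr g
  let σ : Equiv.Perm α := (Fintype.equivOfCardEq h).trans g.symm
  refine ⟨((Equiv.Perm.sign σ : ℤ) : R), ?_, fun A => ?_⟩
  · rw [← Int.cast_pow, ← Units.val_pow_eq_pow_val]; simp
  · rw [mdet, dif_pos h, ← det_permute']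
    congr 1
    ext i j
    simp [σ]

lemma mdet_submatrix (e₁ : α' ≃ α) (e₂ : β' ≃ β) :
    ∃ ε : R, ε ^ 2 = 1 ∧ ∀ A : Matrix α β R, mdet (A.submatrix e₁ e₂) = ε * mdet A := by
  by_cases h : Fintype.card α = Fintype.card β
  · let f := Fintype.equivOfCardEq h
    obtain ⟨ε₁, h₁, H₁⟩ := mdet_eq_det (R := R) f
    obtain ⟨ε₂, h₂, H₂⟩ := mdet_eq_det (R := R) ((e₁.trans f).trans e₂.symm)
    refine ⟨ε₂ * ε₁, by rw [mul_pow, h₁, h₂, one_mul], fun A => ?_⟩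
    rw [H₁, H₂]
    have : (A.submatrix e₁ e₂).submatrix id ((e₁.trans f).trans e₂.symm) =
        (A.submatrix id f).submatrix e₁ e₁ := by ext i j; simp
    rw [this, det_submatrix_equiv_self]
    linear_combination (-ε₂ * (A.submatrix id f).det) * h₁
  · refine ⟨1, by simp, fun A => ?_⟩
    rw [mdet, mdet, dif_neg h, dif_neg, mul_zero]
    rwa [Fintype.card_congr e₁, Fintype.card_congr e₂]

lemma mdet_mul_left (L : Matrix α α R) (A : Matrix α β R) : mdet (L * A) = L.det * mdet A := by
  unfold mdet
  split_ifs
  · rw [← det_mul]; rfl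
  · simp

lemma mdet_mul_right (A : Matrix α β R) (B : Matrix β β R) : mdet (A * B) = mdet A * B.det := by
  unfold mdet
  split_ifs with h
  · rw [← det_submatrix_equiv_self (Fintype.equivOfCardEq h) B, ← det_mul, submatrix_mul_equiv]
  · simp

lemma mdet_fromBlocks (h : Fintype.card α = Fintype.card β)
    (h' : Fintype.card α' = Fintype.card β') :
    ∃ ε : R, ε ^ 2 = 1 ∧ ∀ (A : Matrix α β R) (C : Matrix α' β R) (D : Matrix α' β' R),
      mdet (fromBlocks A 0 C D) = ε * (mdet A * mdet D) := by
  obtain ⟨ε₁, h₁, H₁⟩ := mdet_eq_det (R := R)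
    (Equiv.sumCongr (Fintype.equivOfCardEq h) (Fintype.equivOfCardEq h'))
  refine ⟨ε₁, h₁, fun A C D => ?_⟩
  rw [H₁, mdet, mdet, dif_pos h, dif_pos h']
  have : (fromBlocks A 0 C D).submatrix id
      (Equiv.sumCongr (Fintype.equivOfCardEq h) (Fintype.equivOfCardEq h')) =
      fromBlocks (A.submatrix id (Fintype.equivOfCardEq h)) 0
        (C.submatrix id (Fintype.equivOfCardEq h))
        (D.submatrix id (Fintype.equivOfCardEq h')) := by
    ext (i | i) (j | j) <;> simp
  rw [this, det_fromBlocks_zero₁₂]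

variable {μ κ γ γ' : Type*} [Fintype μ] [DecidableEq μ] [Fintype κ] [DecidableEq κ]
  [Fintype γ'] [DecidableEq γ'] [Fintype γ] [DecidableEq γ]

/-- The matrix with rows `(P, 0)`, `(0, P')` indexed by `μ` and `(P, P')` indexed by `κ`. -/
def linked (P : Matrix (μ ⊕ κ) γ R) (P' : Matrix (μ ⊕ κ) γ' R) :
    Matrix ((μ ⊕ μ) ⊕ κ) (γ ⊕ γ') R :=
  fromBlocks
    (fromRows (P.submatrix Sum.inl id) 0) (fromRows 0 (P'.submatrix Sum.inl id))
    (P.submatrix Sum.inr id) (P'.submatrix Sum.inr id)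

lemma mdet_linked_mul_left (L₁ : Matrix μ μ R) (L₂ : Matrix κ μ R) (L₃ : Matrix κ κ R)
    (P : Matrix (μ ⊕ κ) γ R) (P' : Matrix (μ ⊕ κ) γ' R) :
    mdet (linked (fromBlocks L₁ 0 L₂ L₃ * P) (fromBlocks L₁ 0 L₂ L₃ * P')) =
      L₁.det ^ 2 * L₃.det * mdet (linked P P') := by
  have : linked (fromBlocks L₁ 0 L₂ L₃ * P) (fromBlocks L₁ 0 L₂ L₃ * P') =
      fromBlocks (fromBlocks L₁ 0 0 L₁) 0 (fromCols L₂ L₂) L₃ * linked P P' := by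
    ext ((i | i) | i) (j | j) <;>
      simp [linked, mul_apply, Fintype.sum_sum_type]
  rw [this, mdet_mul_left, det_fromBlocks_zero₁₂, det_fromBlocks_zero₁₂]
  ring

lemma mdet_linked_mul_right (P : Matrix (μ ⊕ κ) γ R) (P' : Matrix (μ ⊕ κ) γ' R)
    (B : Matrix γ γ R) (B' : Matrix γ' γ' R) :
    mdet (linked (P * B) (P' * B')) = B.det * B'.det * mdet (linked P P') := by
  have : linked (P * B) (P' * B') = linked P P' * fromBlocks B 0 0 B' := by
    ext ((i | i) | i) (j | j) <;>
      simp [linked, mul_apply, Fintype.sum_sum_type]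
  rw [this, mdet_mul_right, det_fromBlocks_zero₁₂]
  ring

lemma mdet_linked_submatrix {μ' κ' δ δ' : Type*} [Fintype μ'] [DecidableEq μ'] [Fintype κ']
    [DecidableEq κ'] [Fintype δ] [DecidableEq δ] [Fintype δ'] [DecidableEq δ']
    (e : μ' ≃ μ) (e' : κ' ≃ κ) (f : δ ≃ γ) (f' : δ' ≃ γ') :
    ∃ ε : R, ε ^ 2 = 1 ∧ ∀ (P : Matrix (μ ⊕ κ) γ R) (P' : Matrix (μ ⊕ κ) γ' R),
      mdet (linked (P.submatrix (Sum.map e e') f) (P'.submatrix (Sum.map e e') f')) =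
        ε * mdet (linked P P') := by
  obtain ⟨ε, h, H⟩ := mdet_submatrix (R := R) (Equiv.sumCongr (Equiv.sumCongr e e) e')
    (Equiv.sumCongr f f')
  refine ⟨ε, h, fun P P' => ?_⟩
  rw [← H]
  congr 1
  ext ((i | i) | i) (j | j) <;> simp [linked]

lemma mdet_linked_peel {μ₁ δ δ' : Type*} [Fintype μ₁] [DecidableEq μ₁] [Fintype δ]
    [DecidableEq δ] [Fintype δ'] [DecidableEq δ'] (h₁ : Fintype.card μ₁ = Fintype.card δ)
    (h₂ : Fintype.card μ₁ = Fintype.card δ')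
    (h₃ : Fintype.card ((μ ⊕ μ) ⊕ κ) = Fintype.card (γ ⊕ γ')) :
    ∃ ε : R, ε ^ 2 = 1 ∧ ∀ (P : Matrix ((μ₁ ⊕ μ) ⊕ κ) (δ ⊕ γ) R)
      (P' : Matrix ((μ₁ ⊕ μ) ⊕ κ) (δ' ⊕ γ') R),
      (∀ i c, P (Sum.inl (Sum.inl i)) (Sum.inr c) = 0) →
      (∀ i c, P' (Sum.inl (Sum.inl i)) (Sum.inr c) = 0) →
      mdet (linked P P') = ε *
        (mdet (P.submatrix (fun i => Sum.inl (Sum.inl i)) Sum.inl) *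
          mdet (P'.submatrix (fun i => Sum.inl (Sum.inl i)) Sum.inl)) *
        mdet (linked (P.submatrix (Sum.map Sum.inr id) Sum.inr)
          (P'.submatrix (Sum.map Sum.inr id) Sum.inr)) := by
  let e₁ : (μ₁ ⊕ μ₁) ⊕ ((μ ⊕ μ) ⊕ κ) ≃ ((μ₁ ⊕ μ) ⊕ (μ₁ ⊕ μ)) ⊕ κ :=
    (Equiv.sumAssoc _ _ _).symm.trans
      (Equiv.sumCongr (Equiv.sumSumSumComm μ₁ μ₁ μ μ) (Equiv.refl κ))
  let e₂ : (δ ⊕ δ') ⊕ (γ ⊕ γ') ≃ (δ ⊕ γ) ⊕ (δ' ⊕ γ') := Equiv.sumSumSumComm _ _ _ _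
  obtain ⟨ε, h, H⟩ := mdet_submatrix (R := R) e₁ e₂
  obtain ⟨ε', h', H'⟩ := mdet_fromBlocks (R := R) (α := μ₁ ⊕ μ₁) (β := δ ⊕ δ')
    (by simp [h₁, ← h₂]) h₃
  obtain ⟨ε'', h'', H''⟩ := mdet_fromBlocks (R := R) h₁ h₂
  refine ⟨ε * (ε' * ε''), by simp [mul_pow, *], fun P P' hP hP' => ?_⟩
  have key : (linked P P').submatrix e₁ e₂ = fromBlocks
      (fromBlocks (P.submatrix (fun i => Sum.inl (Sum.inl i)) Sum.inl) 0 0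
        (P'.submatrix (fun i => Sum.inl (Sum.inl i)) Sum.inl)) 0
      ((linked P P').submatrix (fun i => e₁ (Sum.inr i)) (fun j => e₂ (Sum.inl j)))
      (linked (P.submatrix (Sum.map Sum.inr id) Sum.inr)
        (P'.submatrix (Sum.map Sum.inr id) Sum.inr)) := by
    ext ((i | i) | ((i | i) | i)) ((j | j) | (j | j)) <;> simp [linked, e₁, e₂, hP, hP']
  have h5 := H (linked P P')
  rw [key, H', H''] at h5
  linear_combination (-ε) * h5 - mdet (linked P P') * h

lemma mdet_linked_common {γ₀ : Type*} [Fintype γ₀] [DecidableEq γ₀]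
    (h₁ : Fintype.card (μ ⊕ κ) = Fintype.card ((γ₀ ⊕ γ) ⊕ γ'))
    (h₂ : Fintype.card μ = Fintype.card γ₀) :
    ∃ ε : R, ε ^ 2 = 1 ∧ ∀ (P : Matrix (μ ⊕ κ) (γ₀ ⊕ γ) R) (P' : Matrix (μ ⊕ κ) (γ₀ ⊕ γ') R),
      (∀ i c, P i (Sum.inl c) = P' i (Sum.inl c)) →
      mdet (linked P P') = ε * (mdet (P.submatrix Sum.inl Sum.inl) *
        mdet (fromCols P (P'.submatrix id Sum.inr))) := by
  let e₁ : (μ ⊕ κ) ⊕ μ ≃ (μ ⊕ μ) ⊕ κ :=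
    (Equiv.sumAssoc _ _ _).trans ((Equiv.sumCongr (Equiv.refl μ) (Equiv.sumComm κ μ)).trans
      (Equiv.sumAssoc _ _ _).symm)
  let e₂ : ((γ₀ ⊕ γ) ⊕ γ') ⊕ γ₀ ≃ (γ₀ ⊕ γ) ⊕ (γ₀ ⊕ γ') :=
    (Equiv.sumAssoc _ _ _).trans (Equiv.sumCongr (Equiv.refl _) (Equiv.sumComm _ _))
  obtain ⟨ε, h, H⟩ := mdet_submatrix (R := R) e₁ e₂
  obtain ⟨ε', h', H'⟩ := mdet_fromBlocks (R := R) h₁ h₂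
  refine ⟨ε * ε', by simp [mul_pow, *], fun P P' hP => ?_⟩
  let L : Matrix ((μ ⊕ μ) ⊕ κ) ((μ ⊕ μ) ⊕ κ) R := fromBlocks (fromBlocks 1 1 0 1) 0 0 1
  let B : Matrix ((γ₀ ⊕ γ) ⊕ (γ₀ ⊕ γ')) ((γ₀ ⊕ γ) ⊕ (γ₀ ⊕ γ')) R :=
    fromBlocks 1 (fromBlocks (-1) 0 0 0) 0 1
  have hL : L.det = 1 := by simp [L]
  have hB : B.det = 1 := by simp [B]
  have h5 := H (L * linked P P' * B)
  have key : (L * linked P P' * B).submatrix e₁ e₂ = fromBlocks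
      (fromCols P (P'.submatrix id Sum.inr)) 0
      ((L * linked P P' * B).submatrix (fun i => e₁ (Sum.inr i)) (fun j => e₂ (Sum.inl j)))
      (P.submatrix Sum.inl Sum.inl) := by
    have hP0 : ∀ i c, P' i (Sum.inl c) = P i (Sum.inl c) := fun i c => (hP i c).symm
    ext ((i | i) | i) (((j | j) | j) | j) <;>
      simp [L, B, e₁, e₂, linked, mul_apply, Fintype.sum_sum_type, one_apply, hP0]
  rw [key, H', mdet_mul_right, mdet_mul_left, hL, hB] at h5
  linear_combination (-ε) * h5 - mdet (linked P P') * h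

end SignedDeterminants

section DividedDifferences

variable {R : Type*} [CommRing R]

/-- `dd x e j` is the divided difference of the monomial of degree `e` at `x 0, …, x j`. -/
def dd (x : ℕ → R) : ℕ → ℕ → R
  | 0, 0 => 1
  | 0, _ + 1 => 0
  | e + 1, 0 => x 0 * dd x e 0
  | e + 1, j + 1 => x (j + 1) * dd x e (j + 1) + dd x e j

lemma dd_zero_zero (x : ℕ → R) : dd x 0 0 = 1 := by rw [dd]

lemma dd_zero_succ (x : ℕ → R) (j : ℕ) : dd x 0 (j + 1) = 0 := by rw [dd]

lemma dd_succ_zero (x : ℕ → R) (e : ℕ) : dd x (e + 1) 0 = x 0 * dd x e 0 := by rw [dd]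

lemma dd_succ_succ (x : ℕ → R) (e j : ℕ) :
    dd x (e + 1) (j + 1) = x (j + 1) * dd x e (j + 1) + dd x e j := by rw [dd]

lemma dd_zero_right (x : ℕ → R) (e : ℕ) : dd x e 0 = x 0 ^ e := by
  induction e with
  | zero => rw [dd_zero_zero, pow_zero]
  | succ e ih => rw [dd_succ_zero, ih, pow_succ, mul_comm]

lemma dd_of_lt (x : ℕ → R) {e j : ℕ} (h : e < j) : dd x e j = 0 := by
  induction e generalizing j with
  | zero => obtain ⟨j, rfl⟩ := Nat.exists_eq_succ_of_ne_zero (by omega : j ≠ 0); exact dd_zero_succ _ _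
  | succ e ih =>
    obtain ⟨j, rfl⟩ := Nat.exists_eq_succ_of_ne_zero (by omega : j ≠ 0)
    rw [Nat.succ_eq_add_one, dd_succ_succ, ih (by omega), ih (by omega), mul_zero, zero_add]

lemma dd_self (x : ℕ → R) (e : ℕ) : dd x e e = 1 := by
  induction e with
  | zero => exact dd_zero_zero x
  | succ e ih => rw [dd_succ_succ, ih, dd_of_lt x (by omega), mul_zero, zero_add]

lemma dd_one (e j : ℕ) : dd (fun _ => (1 : R)) e j = (e.choose j : R) := by
  induction e generalizing j with
  | zero => cases j <;> simp [dd_zero_zero, dd_zero_succ]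
  | succ e ih =>
    cases j with
    | zero => simp [dd_zero_right]
    | succ j => rw [dd_succ_succ, ih, ih, Nat.choose_succ_succ]; push_cast; ring

lemma dd_peel (x : ℕ → R) (e j : ℕ) :
    dd x (e + 1) (j + 1) = x 0 * dd x e (j + 1) + dd (fun i => x (i + 1)) e j := by
  induction e generalizing j with
  | zero => cases j <;> simp [dd_succ_succ, dd_zero_succ, dd_zero_zero]
  | succ e ih =>
    cases j with
    | zero =>
      rw [dd_succ_zero, dd_succ_succ x (e + 1)]
      have := ih 0
      linear_combination (x 1) * this + dd_succ_zero x e - x 0 * dd_succ_succ x e 0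
    | succ j =>
      rw [dd_succ_succ (fun i => x (i + 1)), dd_succ_succ x (e + 1)]
      linear_combination (x (j + 1 + 1)) * ih (j + 1) + ih j - x 0 * dd_succ_succ x e (j + 1)

lemma dd_shift (x : ℕ → R) (e j : ℕ) :
    dd (fun i => x (i + 1)) e j = (x (j + 1) - x 0) * dd x e (j + 1) + dd x e j := by
  linear_combination dd_succ_succ x e j - dd_peel x e j

lemma dd_swap (x : ℕ → R) (i e j : ℕ) :
    dd (x ∘ Equiv.swap i (i + 1)) e j =
      dd x e j + if j = i then (x (i + 1) - x i) * dd x e (i + 1) else 0 := by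
  induction e generalizing j with
  | zero => cases j <;> simp [dd_zero_zero, dd_zero_succ]
  | succ e ih =>
    rcases lt_trichotomy j i with h | rfl | h
    · have hj : (x ∘ Equiv.swap i (i + 1)) j = x j := by
        simp [Equiv.swap_apply_of_ne_of_ne (by omega : j ≠ i) (by omega : j ≠ i + 1)]
      rw [if_neg h.ne, add_zero]
      cases j with
      | zero => rw [dd_succ_zero, dd_succ_zero, hj, ih, if_neg h.ne, add_zero]
      | succ j =>
        rw [dd_succ_succ, dd_succ_succ, hj, ih, ih, if_neg h.ne, if_neg (by omega)]; ring
    · have hj : (x ∘ Equiv.swap j (j + 1)) j = x (j + 1) := by simp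
      rw [if_pos rfl]
      cases j with
      | zero =>
        rw [dd_succ_zero, dd_succ_zero, hj, ih, if_pos rfl, dd_succ_succ]; ring
      | succ j =>
        rw [dd_succ_succ, dd_succ_succ, hj, ih, ih, if_pos rfl, if_neg (by omega),
          dd_succ_succ x e (j + 1)]; ring
    · rw [if_neg h.ne', add_zero]
      obtain ⟨j, rfl⟩ := Nat.exists_eq_succ_of_ne_zero (by omega : j ≠ 0)
      rw [Nat.succ_eq_add_one] at *
      rw [dd_succ_succ, dd_succ_succ, ih, ih, if_neg h.ne']
      by_cases hij : j = i
      · subst hij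
        have hj : (x ∘ Equiv.swap j (j + 1)) (j + 1) = x j := by simp
        rw [hj, if_pos rfl]; ring
      · have hj : (x ∘ Equiv.swap i (i + 1)) (j + 1) = x (j + 1) := by
          simp [Equiv.swap_apply_of_ne_of_ne (by omega : j + 1 ≠ i) (by omega : j + 1 ≠ i + 1)]
        rw [hj, if_neg hij]; ring

lemma dd_cube_zero (x : ℕ → R) (e : ℕ) : dd x (e + 3) 0 = x 0 ^ 3 * dd x e 0 := by
  rw [dd_zero_right, dd_zero_right]; ring

lemma dd_cube_succ (x : ℕ → R) (e j : ℕ) :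
    dd x (e + 3) (j + 1) = x 0 ^ 3 * dd x e (j + 1) +
      (x 0 ^ 2 * dd (fun i => x (i + 1)) e j + x 0 * dd (fun i => x (i + 1)) (e + 1) j +
        dd (fun i => x (i + 1)) (e + 2) j) := by
  rw [dd_peel x (e + 2), dd_peel x (e + 1), dd_peel x e]; ring

lemma dd_cube_one (x : ℕ → R) (e : ℕ) (h : x 0 ^ 2 + x 0 * x 1 + x 1 ^ 2 = 0) :
    dd x (e + 3) 1 = x 0 ^ 3 * dd x e 1 := by
  rw [dd_cube_succ]
  simp only [dd_zero_right, zero_add]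
  linear_combination x 1 ^ e * h

lemma dd_cube_add_two (x : ℕ → R) (e j : ℕ) (h : x 0 ^ 2 + x 0 * x 1 + x 1 ^ 2 = 0) :
    dd x (e + 3) (j + 2) = x 0 ^ 3 * dd x e (j + 2) +
      ((x 0 + x 1) * dd (fun i => x (i + 2)) e j + dd (fun i => x (i + 2)) (e + 1) j) := by
  have h1 := dd_peel (fun i => x (i + 1)) (e + 1) j
  have h2 := dd_peel (fun i => x (i + 1)) e j
  have h0 := dd_cube_succ x e (j + 1)
  simp only [zero_add, add_assoc, Nat.reduceAdd] at h0 h1 h2 ⊢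
  rw [h0, h1, h2]
  linear_combination dd (fun i => x (i + 1)) e (j + 1) * h

end DividedDifferences

section RowMatrices

open Matrix

variable {R : Type*} [CommRing R] {τ : Type*}
variable {γ γ' : Type} [Fintype γ'] [DecidableEq γ'] [Fintype γ] [DecidableEq γ]

/-- The rows `0, …, M + K - 1` of `Φ`, restricted to the columns listed by `f`. -/
def rowMat (Φ : ℕ → τ → R) (M K : ℕ) (f : γ → τ) : Matrix (Fin M ⊕ Fin K) γ R :=
  Matrix.of fun r c => Φ (Sum.elim (fun i : Fin M => (i : ℕ)) (fun i : Fin K => M + i) r) (f c)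

lemma rowMat_inl (Φ : ℕ → τ → R) (M K : ℕ) (f : γ → τ) (i : Fin M) (c : γ) :
    rowMat Φ M K f (Sum.inl i) c = Φ i (f c) := rfl

lemma rowMat_inr (Φ : ℕ → τ → R) (M K : ℕ) (f : γ → τ) (i : Fin K) (c : γ) :
    rowMat Φ M K f (Sum.inr i) c = Φ (M + i) (f c) := rfl

/-- The determinant of the linked matrix with rows `Φ`. -/
def linkDet (Φ : ℕ → τ → R) (M K : ℕ) (f : γ → τ) (f' : γ' → τ) : R :=
  mdet (linked (rowMat Φ M K f) (rowMat Φ M K f'))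

lemma linkDet_lower (Φ Φ' : ℕ → τ → R) (M K : ℕ) (f : γ → τ) (f' : γ' → τ) (L : ℕ → ℕ → R)
    (h : ∀ i < M + K, ∀ e, Φ' i e = ∑ j ∈ Finset.range (i + 1), L i j * Φ j e) :
    linkDet Φ' M K f f' = (∏ j ∈ Finset.range M, L j j) ^ 2 *
      (∏ l ∈ Finset.range K, L (M + l) (M + l)) * linkDet Φ M K f f' := by
  let L₀ : ℕ → ℕ → R := fun i j => if j ≤ i then L i j else 0
  have h₀ : ∀ i N, i < N → N ≤ M + K → ∀ e,
      Φ' i e = ∑ j ∈ Finset.range N, L₀ i j * Φ j e := by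
    intro i N hi hN e
    rw [h i (by omega) e, ← Finset.sum_subset (Finset.range_mono (by omega : i + 1 ≤ N))]
    · refine Finset.sum_congr rfl fun j hj => ?_
      rw [Finset.mem_range] at hj
      simp [L₀, Nat.lt_succ_iff.1 hj]
    · intro j _ hj
      rw [Finset.mem_range, not_lt] at hj
      simp [L₀, show ¬ j ≤ i by omega]
  let L₁ : Matrix (Fin M) (Fin M) R := Matrix.of fun i j => L₀ i j
  let L₂ : Matrix (Fin K) (Fin M) R := Matrix.of fun i j => L₀ (M + i) j
  let L₃ : Matrix (Fin K) (Fin K) R := Matrix.of fun i j => L₀ (M + i) (M + j)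
  have key : ∀ {δ : Type} (g : δ → τ), rowMat Φ' M K g =
      fromBlocks L₁ 0 L₂ L₃ * rowMat Φ M K g := by
    intro δ g
    ext (i | i) c
    · simp only [rowMat, mul_apply, Fintype.sum_sum_type, of_apply, Sum.elim_inl, fromBlocks_apply₁₁,
        fromBlocks_apply₁₂, Matrix.zero_apply, zero_mul, Finset.sum_const_zero, add_zero, L₁]
      rw [Fin.sum_univ_eq_sum_range (fun j => L₀ i j * Φ j (g c))]
      exact h₀ i M i.2 (by omega) _
    · simp only [rowMat, mul_apply, Fintype.sum_sum_type, of_apply, Sum.elim_inl, Sum.elim_inr,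
        fromBlocks_apply₂₁, fromBlocks_apply₂₂, L₂, L₃]
      rw [Fin.sum_univ_eq_sum_range (fun j => L₀ (M + i) j * Φ j (g c)),
        Fin.sum_univ_eq_sum_range (fun j => L₀ (M + i) (M + j) * Φ (M + j) (g c)),
        ← Finset.sum_range_add]
      exact h₀ (M + i) (M + K) (by omega) le_rfl _
  have d₁ : L₁.det = ∏ j ∈ Finset.range M, L j j := by
    rw [det_of_isLowerTriangular, ← Fin.prod_univ_eq_prod_range (fun j => L j j)]
    · exact Finset.prod_congr rfl fun j _ => by simp [L₁, L₀]
    · intro i j hij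
      have : (i : ℕ) < j := hij
      simp [L₁, L₀, show ¬ j ≤ i from not_le.2 this]
  have d₃ : L₃.det = ∏ l ∈ Finset.range K, L (M + l) (M + l) := by
    rw [det_of_isLowerTriangular, ← Fin.prod_univ_eq_prod_range (fun l => L (M + l) (M + l))]
    · exact Finset.prod_congr rfl fun j _ => by simp [L₃, L₀]
    · intro i j hij
      have : (i : ℕ) < j := hij
      simp [L₃, L₀, show ¬ j ≤ i from not_le.2 this]
  rw [linkDet, key, key, mdet_linked_mul_left, d₁, d₃, linkDet]

lemma linkDet_bidiagonal (Φ Φ' : ℕ → τ → R) (M K : ℕ) (f : γ → τ) (f' : γ' → τ) (d c : ℕ → R)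
    (h₀ : ∀ e, Φ' 0 e = d 0 * Φ 0 e)
    (h : ∀ i, i + 1 < M + K → ∀ e, Φ' (i + 1) e = d (i + 1) * Φ (i + 1) e + c i * Φ i e) :
    linkDet Φ' M K f f' = (∏ j ∈ Finset.range M, d j) ^ 2 *
      (∏ l ∈ Finset.range K, d (M + l)) * linkDet Φ M K f f' := by
  rw [linkDet_lower Φ Φ' M K f f'
    (fun i j => if j = i then d i else if j + 1 = i then c j else 0)]
  · simp
  · intro i hi e
    cases i with
    | zero => simp [h₀]
    | succ i =>
      rw [Finset.sum_range_succ, Finset.sum_range_succ, Finset.sum_eq_zero, h i hi]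
      · simp; ring
      · intro j hj
        rw [Finset.mem_range] at hj
        simp [show j ≠ i + 1 by omega, show j ≠ i by omega]

lemma linkDet_transvection (Φ Φ' : ℕ → τ → R) (M K : ℕ) (f : γ → τ) (f' : γ' → τ) (i : ℕ)
    (hi : i + 1 < M) (c : R)
    (h : ∀ j e, Φ' j e = Φ j e + if j = i then c * Φ (i + 1) e else 0) :
    linkDet Φ' M K f f' = linkDet Φ M K f f' := by
  let L₁ : Matrix (Fin M) (Fin M) R := transvection ⟨i, by omega⟩ ⟨i + 1, hi⟩ c
  let L₂ : Matrix (Fin K) (Fin M) R := 0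
  let L₃ : Matrix (Fin K) (Fin K) R := 1
  have key : ∀ {δ : Type} (g : δ → τ), rowMat Φ' M K g =
      fromBlocks L₁ 0 L₂ L₃ * rowMat Φ M K g := by
    intro δ g
    ext (j | j) e
    · simp only [mul_apply, Fintype.sum_sum_type, rowMat_inl, rowMat_inr,
        fromBlocks_apply₁₁, fromBlocks_apply₁₂, Matrix.zero_apply, zero_mul,
        Finset.sum_const_zero, add_zero, L₁, transvection, Matrix.add_apply, add_mul,
        Finset.sum_add_distrib, h]
      congr 1
      · simp [one_apply]
      · rw [Finset.sum_eq_single_of_mem (⟨i + 1, hi⟩ : Fin M) (Finset.mem_univ _)]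
        · simp [single_apply, Fin.ext_iff, eq_comm]
        · intro b _ hb
          rw [single_apply, if_neg, zero_mul]
          exact fun h' => hb h'.2.symm
    · simp only [mul_apply, Fintype.sum_sum_type, rowMat_inl, rowMat_inr, h,
        fromBlocks_apply₂₁, fromBlocks_apply₂₂, L₂, L₃]
      simp [one_apply, show M + (j : ℕ) ≠ i by omega]
  have d₁ : L₁.det = 1 := det_transvection_of_ne _ _ (by simp) _
  rw [linkDet, key, key, mdet_linked_mul_left, d₁, linkDet]
  simp [L₃]

end RowMatrices

section LinkedDividedDifferences

variable {R : Type*} [CommRing R]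

/-- Exponents of the first family of columns. -/
def expL (n : ℕ) : Fin (n + 1) ⊕ Fin n → ℕ :=
  Sum.elim (fun i => 3 * (i : ℕ)) (fun i => 3 * (i : ℕ) + 1)

/-- Exponents of the second family of columns. -/
def expR (n : ℕ) : Fin (n + 1) ⊕ Fin n → ℕ :=
  Sum.elim (fun i => 3 * (i : ℕ)) (fun i => 3 * (i : ℕ) + 2)

/-- The linked determinant of divided differences of monomials. -/
def ddDet (n M K : ℕ) (x : ℕ → R) : R := linkDet (fun j e => dd x e j) M K (expL n) (expR n)

lemma ddDet_swap (n M K : ℕ) (x : ℕ → R) (i : ℕ) (hi : i + 1 < M) :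
    ddDet n M K (x ∘ Equiv.swap i (i + 1)) = ddDet n M K x := by
  unfold ddDet
  refine linkDet_transvection _ _ M K _ _ i hi (x (i + 1) - x i) fun j e => ?_
  exact dd_swap x i e j

end LinkedDividedDifferences

section Recursion

open Matrix

variable {R : Type*} [CommRing R]

/-- Splitting off the first element of `Fin (m + 1)`. -/
def unitSumFin (m : ℕ) : Unit ⊕ Fin m ≃ Fin (m + 1) where
  toFun := Sum.elim (fun _ => 0) Fin.succ
  invFun := Fin.cases (Sum.inl ()) Sum.inr
  left_inv := by rintro (_ | i) <;> simp
  right_inv := by intro i; cases i using Fin.cases <;> simp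

@[simp] lemma unitSumFin_inl (m : ℕ) (u : Unit) : unitSumFin m (Sum.inl u) = 0 := rfl

@[simp] lemma unitSumFin_inr (m : ℕ) (i : Fin m) : unitSumFin m (Sum.inr i) = i.succ := rfl

/-- Splitting off the first two elements of `Fin (m + 2)`. -/
def unitsSumFin (m : ℕ) : (Unit ⊕ Unit) ⊕ Fin m ≃ Fin (m + 2) :=
  (Equiv.sumAssoc _ _ _).trans
    ((Equiv.sumCongr (Equiv.refl _) (unitSumFin m)).trans (unitSumFin (m + 1)))

@[simp] lemma unitsSumFin_inl_inl (m : ℕ) (u : Unit) :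
    unitsSumFin m (Sum.inl (Sum.inl u)) = 0 := rfl

@[simp] lemma unitsSumFin_inl_inr (m : ℕ) (u : Unit) :
    unitsSumFin m (Sum.inl (Sum.inr u)) = 1 := rfl

@[simp] lemma unitsSumFin_inr (m : ℕ) (i : Fin m) :
    unitsSumFin m (Sum.inr i) = i.succ.succ := rfl

/-- Splitting off the first column of each of the two families of columns. -/
def splitCols (n : ℕ) : (Unit ⊕ Unit) ⊕ (Fin (n + 1) ⊕ Fin n) ≃ Fin (n + 2) ⊕ Fin (n + 1) :=
  (Equiv.sumSumSumComm _ _ _ _).trans (Equiv.sumCongr (unitSumFin (n + 1)) (unitSumFin n))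

@[simp] lemma splitCols_inl_inl (n : ℕ) (u : Unit) :
    splitCols n (Sum.inl (Sum.inl u)) = Sum.inl 0 := rfl

@[simp] lemma splitCols_inl_inr (n : ℕ) (u : Unit) :
    splitCols n (Sum.inl (Sum.inr u)) = Sum.inr 0 := rfl

@[simp] lemma splitCols_inr_inl (n : ℕ) (i : Fin (n + 1)) :
    splitCols n (Sum.inr (Sum.inl i)) = Sum.inl i.succ := rfl

@[simp] lemma splitCols_inr_inr (n : ℕ) (i : Fin n) :
    splitCols n (Sum.inr (Sum.inr i)) = Sum.inr i.succ := rfl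

/-- The column operation subtracting `c` times the preceding column. -/
def colOp (c : R) (m : ℕ) : Matrix (Fin m) (Fin m) R :=
  Matrix.of fun i j => if i = j then 1 else if (i : ℕ) + 1 = j then -c else 0

lemma det_colOp (c : R) (m : ℕ) : (colOp c m).det = 1 := by
  rw [det_of_isUpperTriangular]
  · simp [colOp]
  · intro i j hij
    have : j < i := hij
    have h' : (j : ℕ) < i := this
    simp [colOp, this.ne', show ¬ (i : ℕ) + 1 = j by omega]

lemma sum_colOp_zero (c : R) (m : ℕ) (g : Fin (m + 1) → R) :
    ∑ i, g i * colOp c (m + 1) i 0 = g 0 := by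
  rw [Finset.sum_eq_single_of_mem 0 (Finset.mem_univ _)]
  · simp [colOp]
  · intro i _ hi
    simp [colOp, hi]

lemma sum_colOp_succ (c : R) (m : ℕ) (g : Fin (m + 1) → R) (j : Fin m) :
    ∑ i, g i * colOp c (m + 1) i j.succ = g j.succ - c * g j.castSucc := by
  rw [← Finset.sum_subset (Finset.subset_univ {j.castSucc, j.succ})]
  · rw [Finset.sum_pair (by simp [Fin.ext_iff])]
    have : j.castSucc ≠ j.succ := by simp [Fin.ext_iff]
    simp [colOp, this]; ring
  · intro i _ hi
    simp only [Finset.mem_insert, Finset.mem_singleton, not_or] at hi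
    have : ¬ (i : ℕ) = j := fun h => hi.1 (Fin.ext h)
    simp [colOp, hi.2, this]

lemma mdet_units :
    ∃ ε : R, ε ^ 2 = 1 ∧ ∀ A : Matrix (Unit ⊕ Unit) (Unit ⊕ Unit) R,
      A (Sum.inr ()) (Sum.inl ()) = 0 →
      mdet A = ε * (A (Sum.inl ()) (Sum.inl ()) * A (Sum.inr ()) (Sum.inr ())) := by
  obtain ⟨ε, h, H⟩ := mdet_eq_det (R := R) (Equiv.refl (Unit ⊕ Unit))
  refine ⟨ε, h, fun A hA => ?_⟩
  rw [H, ← fromBlocks_toBlocks (A.submatrix id (Equiv.refl (Unit ⊕ Unit))),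
    show (A.submatrix id (Equiv.refl (Unit ⊕ Unit))).toBlocks₂₁ = 0 by ext; simpa [toBlocks₂₁],
    det_fromBlocks_zero₂₁, det_unique, det_unique]
  rfl

theorem ddDet_recursion (n M K : ℕ) (hMK : 2 * M + K = 2 * (2 * n + 1)) :
    ∃ ε : R, ε ^ 2 = 1 ∧ ∀ x : ℕ → R, x 0 ^ 2 + x 0 * x 1 + x 1 ^ 2 = 0 →
      ddDet (n + 1) (M + 2) K x = ε * (x 0 + x 1) *
        ((∏ j ∈ Finset.range M, (x (j + 2) + x 0 + x 1)) ^ 2 *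
          ∏ l ∈ Finset.range K, (x (M + l + 2) + x 0 + x 1)) *
        ddDet n M K fun i => x (i + 2) := by
  obtain ⟨ε₁, h₁, H₁⟩ := mdet_linked_submatrix (R := R) (unitsSumFin M) (Equiv.refl (Fin K))
    (splitCols n) (splitCols n)
  obtain ⟨ε₂, h₂, H₂⟩ := mdet_linked_peel (R := R) (μ₁ := Unit ⊕ Unit) (δ := Unit ⊕ Unit)
    (δ' := Unit ⊕ Unit) (μ := Fin M) (κ := Fin K) (γ := Fin (n + 1) ⊕ Fin n)
    (γ' := Fin (n + 1) ⊕ Fin n) rfl rfl (by simp; omega)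
  obtain ⟨ε₃, h₃, H₃⟩ := mdet_units (R := R)
  refine ⟨ε₁ * ε₂, by simp [mul_pow, *], fun x hx => ?_⟩
  let Ψ : ℕ → ℕ → R := fun j e => (x 0 + x 1) * dd (fun i => x (i + 2)) e j +
    dd (fun i => x (i + 2)) (e + 1) j
  have hΨ : linkDet Ψ M K (expL n) (expR n) =
      (∏ j ∈ Finset.range M, (x (j + 2) + x 0 + x 1)) ^ 2 *
        (∏ l ∈ Finset.range K, (x (M + l + 2) + x 0 + x 1)) *
        ddDet n M K fun i => x (i + 2) := by
    refine linkDet_bidiagonal _ _ _ _ _ _ (fun j => x (j + 2) + x 0 + x 1) (fun _ => 1) ?_ ?_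
    · intro e
      simp only [Ψ, dd_succ_zero]; ring
    · intro i _ e
      simp only [Ψ, dd_succ_succ]; ring
  let B : Matrix (Fin (n + 2) ⊕ Fin (n + 1)) (Fin (n + 2) ⊕ Fin (n + 1)) R :=
    fromBlocks (colOp (x 0 ^ 3) (n + 2)) 0 0 (colOp (x 0 ^ 3) (n + 1))
  have hB : B.det = 1 := by simp [B, det_fromBlocks_zero₂₁, det_colOp]
  let PL := rowMat (fun j e => dd x e j) (M + 2) K (expL (n + 1)) * B
  let PR := rowMat (fun j e => dd x e j) (M + 2) K (expR (n + 1)) * B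
  have e₁ : ddDet (n + 1) (M + 2) K x = mdet (linked PL PR) := by
    rw [mdet_linked_mul_right, hB, mul_one, one_mul]; rfl
  have col0 : ∀ (f : Fin (n + 2) ⊕ Fin (n + 1) → ℕ) r,
      (rowMat (fun j e => dd x e j) (M + 2) K f * B) r (Sum.inl 0) =
        rowMat (fun j e => dd x e j) (M + 2) K f r (Sum.inl 0) := by
    intro f r
    simp only [mul_apply, Fintype.sum_sum_type, B, fromBlocks_apply₁₁, fromBlocks_apply₂₁,
      Matrix.zero_apply, mul_zero, Finset.sum_const_zero, add_zero]
    exact sum_colOp_zero _ _ _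
  have col0' : ∀ (f : Fin (n + 2) ⊕ Fin (n + 1) → ℕ) r,
      (rowMat (fun j e => dd x e j) (M + 2) K f * B) r (Sum.inr 0) =
        rowMat (fun j e => dd x e j) (M + 2) K f r (Sum.inr 0) := by
    intro f r
    simp only [mul_apply, Fintype.sum_sum_type, B, fromBlocks_apply₁₂, fromBlocks_apply₂₂,
      Matrix.zero_apply, mul_zero, Finset.sum_const_zero, zero_add]
    exact sum_colOp_zero _ _ _
  have col1 : ∀ (f : Fin (n + 2) ⊕ Fin (n + 1) → ℕ) r j,
      (rowMat (fun j e => dd x e j) (M + 2) K f * B) r (Sum.inl (Fin.succ j)) =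
        rowMat (fun j e => dd x e j) (M + 2) K f r (Sum.inl j.succ) -
        x 0 ^ 3 * rowMat (fun j e => dd x e j) (M + 2) K f r (Sum.inl j.castSucc) := by
    intro f r j
    simp only [mul_apply, Fintype.sum_sum_type, B, fromBlocks_apply₁₁, fromBlocks_apply₂₁,
      Matrix.zero_apply, mul_zero, Finset.sum_const_zero, add_zero]
    exact sum_colOp_succ _ _ _ _
  have col1' : ∀ (f : Fin (n + 2) ⊕ Fin (n + 1) → ℕ) r j,
      (rowMat (fun j e => dd x e j) (M + 2) K f * B) r (Sum.inr (Fin.succ j)) =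
        rowMat (fun j e => dd x e j) (M + 2) K f r (Sum.inr j.succ) -
        x 0 ^ 3 * rowMat (fun j e => dd x e j) (M + 2) K f r (Sum.inr j.castSucc) := by
    intro f r j
    simp only [mul_apply, Fintype.sum_sum_type, B, fromBlocks_apply₁₂, fromBlocks_apply₂₂,
      Matrix.zero_apply, mul_zero, Finset.sum_const_zero, zero_add]
    exact sum_colOp_succ _ _ _ _
  have hz : ∀ e, dd x (e + 3) 0 - x 0 ^ 3 * dd x e 0 = 0 := fun e => by
    rw [dd_cube_zero, sub_self]
  have ho : ∀ e, dd x (e + 3) 1 - x 0 ^ 3 * dd x e 1 = 0 := fun e => by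
    rw [dd_cube_one _ _ hx, sub_self]
  have hs : ∀ e j, dd x (e + 3) (j + 2) - x 0 ^ 3 * dd x e (j + 2) = Ψ j e := fun e j => by
    rw [dd_cube_add_two _ _ _ hx]; simp only [Ψ]; ring
  have e₂ := H₂ (PL.submatrix (Sum.map (unitsSumFin M) (Equiv.refl (Fin K))) (splitCols n))
    (PR.submatrix (Sum.map (unitsSumFin M) (Equiv.refl (Fin K))) (splitCols n)) ?_ ?_
  · rw [H₁] at e₂
    have t₁ : (PL.submatrix (Sum.map (unitsSumFin M) (Equiv.refl (Fin K)))
        (splitCols n)).submatrix (Sum.map Sum.inr id) Sum.inr = rowMat Ψ M K (expL n) := by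
      ext (i | i) (j | j)
      · simp only [submatrix_apply, Sum.map_inl, unitsSumFin_inr, splitCols_inr_inl, PL, col1,
          rowMat_inl, expL, Sum.elim_inl, Fin.val_succ, Fin.val_castSucc]
        exact hs _ _
      · simp only [submatrix_apply, Sum.map_inl, unitsSumFin_inr, splitCols_inr_inr, PL, col1',
          rowMat_inl, expL, Sum.elim_inr, Fin.val_succ, Fin.val_castSucc]
        rw [← hs]; congr 2
      · simp only [submatrix_apply, Sum.map_inr, splitCols_inr_inl, PL, col1,
          rowMat_inr, expL, Sum.elim_inl, Fin.val_succ, Fin.val_castSucc, ← hs]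
        simp only [id, Equiv.refl_apply]
        rw [show M + 2 + (i : ℕ) = M + i + 2 by ring]; rfl
      · simp only [submatrix_apply, Sum.map_inr, splitCols_inr_inr, PL, col1',
          rowMat_inr, expL, Sum.elim_inr, Fin.val_succ, Fin.val_castSucc, ← hs]
        simp only [id, Equiv.refl_apply]
        rw [show M + 2 + (i : ℕ) = M + i + 2 by ring,
          show 3 * ((j : ℕ) + 1) + 1 = 3 * j + 1 + 3 by ring]
    have t₂ : (PR.submatrix (Sum.map (unitsSumFin M) (Equiv.refl (Fin K)))
        (splitCols n)).submatrix (Sum.map Sum.inr id) Sum.inr = rowMat Ψ M K (expR n) := by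
      ext (i | i) (j | j)
      · simp only [submatrix_apply, Sum.map_inl, unitsSumFin_inr, splitCols_inr_inl, PR, col1,
          rowMat_inl, expR, Sum.elim_inl, Fin.val_succ, Fin.val_castSucc]
        exact hs _ _
      · simp only [submatrix_apply, Sum.map_inl, unitsSumFin_inr, splitCols_inr_inr, PR, col1',
          rowMat_inl, expR, Sum.elim_inr, Fin.val_succ, Fin.val_castSucc]
        rw [← hs]; congr 2
      · simp only [submatrix_apply, Sum.map_inr, splitCols_inr_inl, PR, col1,
          rowMat_inr, expR, Sum.elim_inl, Fin.val_succ, Fin.val_castSucc, ← hs]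
        simp only [id, Equiv.refl_apply]
        rw [show M + 2 + (i : ℕ) = M + i + 2 by ring]; rfl
      · simp only [submatrix_apply, Sum.map_inr, splitCols_inr_inr, PR, col1',
          rowMat_inr, expR, Sum.elim_inr, Fin.val_succ, Fin.val_castSucc, ← hs]
        simp only [id, Equiv.refl_apply]
        rw [show M + 2 + (i : ℕ) = M + i + 2 by ring,
          show 3 * ((j : ℕ) + 1) + 2 = 3 * j + 2 + 3 by ring]
    rw [t₁, t₂, H₃, H₃] at e₂
    · simp only [submatrix_apply, Sum.map_inl, unitsSumFin_inl_inl, unitsSumFin_inl_inr,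
        splitCols_inl_inl, splitCols_inl_inr, PL, PR, col0, col0', rowMat_inl, expL, expR,
        Sum.elim_inl, Sum.elim_inr] at e₂
      simp only [Fin.val_zero, Fin.val_one, mul_zero, zero_add, dd_self,
        show dd x 2 1 = x 0 + x 1 by
          rw [dd_succ_succ, dd_self, dd_zero_right]; ring] at e₂
      rw [e₁]
      change ε₁ * mdet (linked PL PR) = _ * _ * linkDet Ψ M K (expL n) (expR n) at e₂
      rw [hΨ] at e₂
      linear_combination ε₁ * e₂ - mdet (linked PL PR) * h₁ +
        ε₁ * ε₂ * (x 0 + x 1) * ((∏ j ∈ Finset.range M, (x (j + 2) + x 0 + x 1)) ^ 2 *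
        (∏ l ∈ Finset.range K, (x (M + l + 2) + x 0 + x 1)) *
        ddDet n M K fun i => x (i + 2)) * h₃
    all_goals
      simp only [submatrix_apply, Sum.map_inl, unitsSumFin_inl_inr,
        splitCols_inl_inl, PL, PR, col0, rowMat_inl, expL, expR, Sum.elim_inl]
      exact dd_of_lt x (by simp)
  · rintro (i | i) (j | j)
    · simp only [submatrix_apply, Sum.map_inl, unitsSumFin_inl_inl, splitCols_inr_inl, PL, col1,
        rowMat_inl, expL, Sum.elim_inl, Fin.val_succ, Fin.val_castSucc]
      exact hz _
    · simp only [submatrix_apply, Sum.map_inl, unitsSumFin_inl_inl, splitCols_inr_inr, PL, col1',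
        rowMat_inl, expL, Sum.elim_inr, Fin.val_succ, Fin.val_castSucc]
      rw [← hz (3 * j + 1)]; congr 2
    · simp only [submatrix_apply, Sum.map_inl, unitsSumFin_inl_inr, splitCols_inr_inl, PL, col1,
        rowMat_inl, expL, Sum.elim_inl, Fin.val_succ, Fin.val_castSucc]
      exact ho _
    · simp only [submatrix_apply, Sum.map_inl, unitsSumFin_inl_inr, splitCols_inr_inr, PL, col1',
        rowMat_inl, expL, Sum.elim_inr, Fin.val_succ, Fin.val_castSucc]
      rw [← ho (3 * j + 1)]; congr 2
  · rintro (i | i) (j | j)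
    · simp only [submatrix_apply, Sum.map_inl, unitsSumFin_inl_inl, splitCols_inr_inl, PR, col1,
        rowMat_inl, expR, Sum.elim_inl, Fin.val_succ, Fin.val_castSucc]
      exact hz _
    · simp only [submatrix_apply, Sum.map_inl, unitsSumFin_inl_inl, splitCols_inr_inr, PR, col1',
        rowMat_inl, expR, Sum.elim_inr, Fin.val_succ, Fin.val_castSucc]
      rw [← hz (3 * j + 2)]; congr 2
    · simp only [submatrix_apply, Sum.map_inl, unitsSumFin_inl_inr, splitCols_inr_inl, PR, col1,
        rowMat_inl, expR, Sum.elim_inl, Fin.val_succ, Fin.val_castSucc]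
      exact ho _
    · simp only [submatrix_apply, Sum.map_inl, unitsSumFin_inl_inr, splitCols_inr_inr, PR, col1',
        rowMat_inl, expR, Sum.elim_inr, Fin.val_succ, Fin.val_castSucc]
      rw [← ho (3 * j + 2)]; congr 2

end Recursion

section Degrees

open Matrix

lemma PolyDeg.prod {ι : Type*} (s : Finset ι) (f : ι → ℂ → ℂ) (d : ι → ℕ)
    (h : ∀ i ∈ s, PolyDeg (d i) (f i)) :
    PolyDeg (∑ i ∈ s, d i) fun t => ∏ i ∈ s, f i t := by
  classical
  induction s using Finset.induction_on with
  | empty => simpa using polyDeg_const 0 1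
  | insert a s ha ih =>
    simp only [Finset.prod_insert ha, Finset.sum_insert ha]
    exact (h a (Finset.mem_insert_self _ _)).mul
      (ih fun i hi => h i (Finset.mem_insert_of_mem hi))

lemma polyDeg_det {ι : Type*} [Fintype ι] [DecidableEq ι] (A : ℂ → Matrix ι ι ℂ) (d : ι → ℕ)
    (h : ∀ i j, PolyDeg (d i) fun t => A t i j) :
    PolyDeg (∑ i, d i) fun t => (A t).det := by
  simp only [det_apply']
  refine PolyDeg.sum _ _ fun σ _ => PolyDeg.const_mul _ ?_
  have := PolyDeg.prod Finset.univ (fun i t => A t (σ i) i) (fun i => d (σ i)) fun i _ => h _ _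
  rwa [Equiv.sum_comp σ d] at this

/-- Linear factors can be cancelled from a polynomial, lowering the degree. -/
lemma PolyDeg.of_prod_mul {ι : Type*} {s : Finset ι} {r : ι → ℂ} {D e : ℕ} {g : ℂ → ℂ}
    (h : PolyDeg D fun t => (∏ i ∈ s, (r i - t)) * g t) (hg : PolyDeg e g) :
    PolyDeg (D - s.card) g := by
  obtain ⟨p, hp, hp'⟩ := h
  obtain ⟨b, -, hb⟩ := hg
  refine ⟨b, ?_, hb⟩
  by_cases hb0 : b = 0
  · simp [hb0]
  have key : p = Polynomial.C ((-1) ^ s.card) * (∏ i ∈ s, (Polynomial.X - Polynomial.C (r i))) * b := by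
    refine Polynomial.funext fun t => ?_
    rw [← hp' t]
    simp only [hb]
    simp only [Polynomial.eval_mul, Polynomial.eval_C, Polynomial.eval_prod, Polynomial.eval_sub,
      Polynomial.eval_X]
    rw [← Finset.prod_const, ← Finset.prod_mul_distrib]
    simp
  have h1 : p.natDegree = s.card + b.natDegree := by
    rw [key, Polynomial.natDegree_mul, Polynomial.natDegree_C_mul, Polynomial.natDegree_prod]
    · simp
    · exact fun i _ => Polynomial.X_sub_C_ne_zero _
    · exact pow_ne_zero _ (by norm_num)
    · refine mul_ne_zero ?_ ?_
      · rw [Polynomial.C_ne_zero]; exact pow_ne_zero _ (by norm_num)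
      · exact Finset.prod_ne_zero_iff.2 fun i _ => Polynomial.X_sub_C_ne_zero _
    · exact hb0
  omega

lemma linkDet_polyDeg {τ γ γ' : Type} [Fintype γ] [DecidableEq γ] [Fintype γ'] [DecidableEq γ']
    (Φ : ℂ → ℕ → τ → ℂ) (M K : ℕ) (f : γ → τ) (f' : γ' → τ) (d : ℕ → ℕ)
    (hcard : 2 * M + K = Fintype.card γ + Fintype.card γ')
    (h : ∀ j c, PolyDeg (d j) fun t => Φ t j (f c))
    (h' : ∀ j c, PolyDeg (d j) fun t => Φ t j (f' c)) :
    PolyDeg (2 * (∑ j ∈ Finset.range M, d j) + ∑ l ∈ Finset.range K, d (M + l))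
      fun t => linkDet (Φ t) M K f f' := by
  have e : ((Fin M ⊕ Fin M) ⊕ Fin K) ≃ (γ ⊕ γ') := Fintype.equivOfCardEq (by simp; omega)
  obtain ⟨ε, -, H⟩ := mdet_eq_det (R := ℂ) e
  simp only [linkDet, H]
  refine PolyDeg.const_mul _ ?_
  let D : (Fin M ⊕ Fin M) ⊕ Fin K → ℕ :=
    Sum.elim (Sum.elim (fun i => d i) (fun i => d i)) (fun i => d (M + i))
  have hD : ∑ r, D r = 2 * (∑ j ∈ Finset.range M, d j) + ∑ l ∈ Finset.range K, d (M + l) := by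
    simp only [Fintype.sum_sum_type, D, Sum.elim_inl, Sum.elim_inr]
    rw [Fin.sum_univ_eq_sum_range (fun i => d i), Fin.sum_univ_eq_sum_range (fun i => d (M + i))]
    ring
  rw [← hD]
  refine polyDeg_det _ D fun r c => ?_
  simp only [submatrix_apply, id]
  rcases r with (r | r) | r <;> rcases e c with c | c
  · exact h _ _
  · exact polyDeg_const _ 0
  · exact polyDeg_const _ 0
  · exact h' _ _
  · exact h _ _
  · exact h' _ _

lemma dd_polyDeg (x : ℂ → ℕ → ℂ) (hx : ∀ i, PolyDeg 1 fun t => x t i) (e j : ℕ) :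
    PolyDeg e fun t => dd (x t) e j := by
  induction e generalizing j with
  | zero => cases j <;> simp only [dd_zero_zero, dd_zero_succ] <;> exact polyDeg_const _ _
  | succ e ih =>
    rw [add_comm]
    cases j with
    | zero => simp only [add_comm 1 e, dd_succ_zero]; exact (add_comm 1 e) ▸ (hx _).mul (ih _)
    | succ j =>
      simp only [add_comm 1 e, dd_succ_succ]
      exact PolyDeg.add ((add_comm 1 e) ▸ (hx _).mul (ih _)) ((ih _).mono (by omega))

lemma expL_le (n : ℕ) (c) : expL n c ≤ 3 * n := by
  rcases c with c | c <;> simp [expL] <;> omega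

lemma expR_le (n : ℕ) (c) : expR n c ≤ 3 * n := by
  rcases c with c | c <;> simp [expR] <;> omega

lemma ddDet_polyDeg (n M K : ℕ) (hMK : 2 * M + K = 2 * (2 * n + 1)) (x : ℂ → ℕ → ℂ)
    (hx : ∀ i, PolyDeg 1 fun t => x t i) : ∃ d, PolyDeg d fun t => ddDet n M K (x t) :=
  ⟨_, linkDet_polyDeg (fun t j e => dd (x t) e j) M K _ _ (fun _ => 3 * n) (by simp; omega)
    (fun j c => (dd_polyDeg x hx _ _).mono (expL_le n c))
    (fun j c => (dd_polyDeg x hx _ _).mono (expR_le n c))⟩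

/-- `ddDet` at the entries of a list. -/
def ddList (n M K : ℕ) (l : List ℂ) : ℂ := ddDet n M K fun i => l.getD i 0

lemma ddList_polyDeg (n M K : ℕ) (hMK : 2 * M + K = 2 * (2 * n + 1)) (A B : List ℂ) :
    ∃ d, PolyDeg d fun t => ddList n M K (A ++ t :: B) := by
  refine ddDet_polyDeg n M K hMK _ fun i => ?_
  rcases lt_trichotomy i A.length with h | h | h
  · simp only [List.getD_append _ _ _ _ h]; exact polyDeg_const _ _
  · subst h
    simpa using polyDeg_affine 1 0
  · obtain ⟨j, rfl⟩ := Nat.exists_eq_add_of_lt h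
    simp only [List.getD_append_right _ _ _ _ h.le, show A.length + j + 1 - A.length = j + 1 by omega,
      List.getD_cons_succ]
    exact polyDeg_const _ _

/-- `ddDet` has degree at most `2 * n` in its first variable. -/
lemma ddList_polyDeg_head (n M K : ℕ) (hMK : 2 * (M + 1) + K = 2 * (2 * n + 1)) (l : List ℂ) :
    PolyDeg (2 * n) fun t => ddList n (M + 1) K (t :: l) := by
  obtain ⟨e, he⟩ := ddList_polyDeg n (M + 1) K hMK [] l
  let Φ : ℂ → ℕ → ℕ → ℂ := fun t j e =>
    match j with
    | 0 => t ^ e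
    | j + 1 => dd (fun i => l.getD i 0) e j
  have h₁ : PolyDeg (6 * n) fun t => linkDet (Φ t) (M + 1) K (expL n) (expR n) := by
    have := linkDet_polyDeg Φ (M + 1) K (expL n) (expR n) (fun j => if j = 0 then 3 * n else 0)
      (by simp; omega) ?_ ?_
    · simp only [Finset.sum_range_succ', Nat.add_eq_zero_iff, one_ne_zero, and_false, if_false,
        Finset.sum_const_zero, if_true, zero_add, false_and] at this
      exact this.mono (by omega)
    · rintro (_ | j) c
      · have := PolyDeg.prod (Finset.range (expL n c)) (fun _ t => t) (fun _ => 1) fun _ _ => by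
          simpa using polyDeg_affine 1 0
        simp only [Finset.sum_const, Finset.prod_const, Finset.card_range, smul_eq_mul, mul_one]
          at this
        exact this.mono (by simpa using expL_le n c)
      · exact polyDeg_const _ _
    · rintro (_ | j) c
      · have := PolyDeg.prod (Finset.range (expR n c)) (fun _ t => t) (fun _ => 1) fun _ _ => by
          simpa using polyDeg_affine 1 0
        simp only [Finset.sum_const, Finset.prod_const, Finset.card_range, smul_eq_mul, mul_one]
          at this
        exact this.mono (by simpa using expR_le n c)
      · exact polyDeg_const _ _
  have h₂ : ∀ t, linkDet (Φ t) (M + 1) K (expL n) (expR n) =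
      (∏ i : (Fin M ⊕ Fin M) ⊕ Fin K,
        (Sum.elim (Sum.elim (fun i : Fin M => l.getD i 0) (fun i : Fin M => l.getD i 0))
          (fun i : Fin K => l.getD (M + i) 0) i - t)) * ddList n (M + 1) K (t :: l) := by
    intro t
    rw [linkDet_bidiagonal (fun j e => dd (fun i => (t :: l).getD i 0) e j) (Φ t) (M + 1) K
      (expL n) (expR n) (fun j => match j with | 0 => 1 | j + 1 => l.getD j 0 - t) (fun _ => 1),
      Finset.prod_range_succ']
    · simp only [Fintype.prod_sum_type, Sum.elim_inl, Sum.elim_inr, mul_one]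
      rw [Fin.prod_univ_eq_prod_range (fun i => l.getD i 0 - t),
        Fin.prod_univ_eq_prod_range (fun i => l.getD (M + i) 0 - t), sq, ddList, ddDet]
      congr 2
      refine Finset.prod_congr rfl fun i _ => ?_
      rw [show M + 1 + i = (M + i) + 1 by ring]
    · intro e
      simp [Φ, dd_zero_right]
    · intro i _ e
      have := dd_shift (fun i => (t :: l).getD i 0) e i
      simp only [List.getD_cons_succ, List.getD_cons_zero] at this
      simp only [Φ, this]; ring
  simp only [h₂] at h₁
  refine (h₁.of_prod_mul he).mono ?_
  simp
  omega

end Degrees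

section CubeDeterminant

open Matrix

variable {R : Type*} [CommRing R]

/-- The determinant of the divided differences of the monomials `1, X ^ 3, …, X ^ (3 * (m - 1))`. -/
def cubeDet (m : ℕ) (x : ℕ → R) : R :=
  (Matrix.of fun j i : Fin m => dd x (3 * (i : ℕ)) j).det

lemma dd_quadratic (a : R) (y : ℕ → R) (e j : ℕ) :
    a ^ 2 * dd y e j + a * dd y (e + 1) j + dd y (e + 2) j =
      (a ^ 2 + a * y j + y j ^ 2) * dd y e j +
        (if 1 ≤ j then (a + y j + y (j - 1)) * dd y e (j - 1) else 0) +
        (if 2 ≤ j then dd y e (j - 2) else 0) := by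
  match j with
  | 0 => simp only [dd_zero_right]; simp; ring
  | 1 => simp [dd_succ_succ, dd_succ_zero]; ring
  | j + 2 => simp [dd_succ_succ]; ring

lemma cubeDet_succ (m : ℕ) (x : ℕ → R) :
    cubeDet (m + 1) x = (∏ j ∈ Finset.range m, (x 0 ^ 2 + x 0 * x (j + 1) + x (j + 1) ^ 2)) *
      cubeDet m fun i => x (i + 1) := by
  let A : Matrix (Fin (m + 1)) (Fin (m + 1)) R := Matrix.of fun j i => dd x (3 * (i : ℕ)) j
  let y : ℕ → R := fun i => x (i + 1)
  let L : Matrix (Fin m) (Fin m) R := Matrix.of fun j i =>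
    if i = j then x 0 ^ 2 + x 0 * y j + y j ^ 2
    else if (i : ℕ) + 1 = j then x 0 + y j + y i
    else if (i : ℕ) + 2 = j then 1 else 0
  have hL : L.det = ∏ j ∈ Finset.range m, (x 0 ^ 2 + x 0 * x (j + 1) + x (j + 1) ^ 2) := by
    rw [det_of_isLowerTriangular,
      ← Fin.prod_univ_eq_prod_range (fun j => x 0 ^ 2 + x 0 * x (j + 1) + x (j + 1) ^ 2)]
    · simp [L, y]
    · intro i j hij
      have h : i < j := hij
      have : (i : ℕ) < j := h
      simp [L, h.ne', show ¬ (j : ℕ) + 1 = i by omega, show ¬ (j : ℕ) + 2 = i by omega]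
  have h₀ : ∀ j, (A * colOp (x 0 ^ 3) (m + 1)) j 0 = if j = 0 then 1 else 0 := by
    intro j
    rw [mul_apply, sum_colOp_zero]
    refine Fin.cases ?_ (fun j => ?_) j
    · simp [A, dd_zero_zero]
    · simp [A, dd_zero_succ]
  have h₁ : (A * colOp (x 0 ^ 3) (m + 1)).submatrix Fin.succ Fin.succ =
      L * Matrix.of fun j i : Fin m => dd y (3 * (i : ℕ)) j := by
    ext j i
    rw [submatrix_apply, mul_apply, sum_colOp_succ]
    simp only [A, of_apply, Fin.val_succ, Fin.val_castSucc, mul_add, mul_one, dd_cube_succ]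
    rw [add_sub_cancel_left, dd_quadratic, mul_apply]
    simp only [of_apply, L]
    have split : ∀ l : Fin m, (if l = j then x 0 ^ 2 + x 0 * y j + y j ^ 2
        else if (l : ℕ) + 1 = j then x 0 + y j + y l
        else if (l : ℕ) + 2 = j then 1 else 0) * dd y (3 * (i : ℕ)) l =
        (if (l : ℕ) = j then (x 0 ^ 2 + x 0 * y j + y j ^ 2) * dd y (3 * (i : ℕ)) l else 0) +
        (if (l : ℕ) + 1 = j then (x 0 + y j + y l) * dd y (3 * (i : ℕ)) l else 0) +
        (if (l : ℕ) + 2 = j then dd y (3 * (i : ℕ)) l else 0) := by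
      intro l
      rcases eq_or_ne l j with rfl | h
      · simp
      · rw [if_neg h, if_neg (fun h' => h (Fin.ext h'))]
        split_ifs <;> first | omega | simp
    simp only [split, Finset.sum_add_distrib]
    congr 1
    · congr 1
      · rw [Finset.sum_eq_single_of_mem j (Finset.mem_univ _)]
        · simp [y]
        · intro l _ h
          rw [if_neg (fun h' => h (Fin.ext h'))]
      · split_ifs with h
        · rw [Finset.sum_eq_single_of_mem (⟨(j : ℕ) - 1, by omega⟩ : Fin m) (Finset.mem_univ _)]
          · rw [if_pos (show (j : ℕ) - 1 + 1 = j by omega)]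
          · intro l _ hl
            rw [if_neg (fun h' => hl (Fin.ext (show (l : ℕ) = j - 1 by omega)))]
        · exact (Finset.sum_eq_zero fun l _ => by rw [if_neg (by omega)]).symm
    · split_ifs with h
      · rw [Finset.sum_eq_single_of_mem (⟨(j : ℕ) - 2, by omega⟩ : Fin m) (Finset.mem_univ _)]
        · rw [if_pos (show (j : ℕ) - 2 + 2 = j by omega)]
        · intro l _ hl
          rw [if_neg (fun h' => hl (Fin.ext (show (l : ℕ) = j - 2 by omega)))]
      · exact (Finset.sum_eq_zero fun l _ => by rw [if_neg (by omega)]).symm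
  calc cubeDet (m + 1) x = (A * colOp (x 0 ^ 3) (m + 1)).det := by
        rw [det_mul, det_colOp, mul_one]; rfl
    _ = ((A * colOp (x 0 ^ 3) (m + 1)).submatrix Fin.succ Fin.succ).det := by
        rw [det_succ_column_zero, Finset.sum_eq_single_of_mem 0 (Finset.mem_univ _)]
        · rw [h₀]
          simp only [if_true, Fin.val_zero, pow_zero, one_mul]
          rfl
        · intro j _ hj
          rw [h₀, if_neg hj]; simp
    _ = _ := by rw [h₁, det_mul, hL]; rfl

lemma qvan_mul_qvan_reverse (z : List ℂ) :
    qvan z * qvan z.reverse = (-1) ^ z.length.choose 2 *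
      cubeDet z.length fun i => z.getD i 0 := by
  induction z with
  | nil => simp [qvan, cubeDet]
  | cons a l ih =>
    rw [List.length_cons, cubeDet_succ, List.reverse_cons, qvan_append]
    simp only [List.getD_cons_succ, List.getD_cons_zero]
    rw [Nat.choose_succ_succ, Nat.choose_one_right, pow_add]
    have h : (l.map fun y => qc * a - qc ^ 2 * y).prod *
        (l.reverse.map fun x => ([a].map fun y => qc * x - qc ^ 2 * y).prod).prod =
        (-1) ^ l.length * ∏ j ∈ Finset.range l.length,
          (a ^ 2 + a * l.getD j 0 + l.getD j 0 ^ 2) := by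
      rw [List.map_reverse, List.prod_reverse, ← List.prod_map_mul, ← Finset.card_range l.length,
        ← Finset.prod_const, Finset.card_range, ← Finset.prod_mul_distrib,
        ← prod_range_getD]
      refine Finset.prod_congr rfl fun j _ => ?_
      simp only [List.map_cons, List.map_nil, List.prod_cons, List.prod_nil, mul_one]
      have := qc_rel
      generalize qc = q at *
      generalize l.getD j 0 = b
      clear * - this
      grind
    simp only [qvan, List.map_nil, List.prod_nil]
    linear_combination qvan l * qvan l.reverse * h + (-1) ^ l.length * (∏ j ∈ Finset.range l.length,
          (a ^ 2 + a * l.getD j 0 + l.getD j 0 ^ 2)) * ih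

end CubeDeterminant

section BaseCase

open Matrix

variable {R : Type*} [CommRing R]

lemma ddDet_base (k : ℕ) :
    ∃ ε : R, ε ^ 2 = 1 ∧ ∀ x : ℕ → R, ddDet k (k + 1) (2 * k) x = ε * cubeDet (k + 1) x := by
  obtain ⟨ε₁, h₁, H₁⟩ := mdet_linked_common (R := R) (μ := Fin (k + 1)) (κ := Fin (2 * k))
    (γ₀ := Fin (k + 1)) (γ := Fin k) (γ' := Fin k) (by simp; omega) (by simp)
  obtain ⟨ε₂, h₂, H₂⟩ := mdet_eq_det (R := R) (Equiv.refl (Fin (k + 1)))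
  let ex : (Fin (k + 1) ⊕ Fin k) ⊕ Fin k → Fin (k + 1 + 2 * k) :=
    Sum.elim (fun c => ⟨expL k c, by have := expL_le k c; omega⟩) fun i => ⟨3 * i + 2, by omega⟩
  have hex : Function.Bijective ex := by
    rw [Fintype.bijective_iff_injective_and_card]
    refine ⟨?_, by simp; omega⟩
    rintro ((a | a) | a) ((b | b) | b) h <;>
      simp only [ex, expL, Sum.elim_inl, Sum.elim_inr, Fin.ext_iff] at h <;>
      first
      | exact absurd h (by omega)
      | (congr; omega)
  let g : Fin (k + 1) ⊕ Fin (2 * k) ≃ (Fin (k + 1) ⊕ Fin k) ⊕ Fin k :=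
    finSumFinEquiv.trans (Equiv.ofBijective ex hex).symm
  obtain ⟨ε₃, h₃, H₃⟩ := mdet_eq_det (R := R) g
  refine ⟨ε₁ * ε₂ * ε₃, by simp [mul_pow, *], fun x => ?_⟩
  rw [ddDet, linkDet, H₁ _ _ ?_, H₂, H₃]
  · have e₁ : (((rowMat (fun j e => dd x e j) (k + 1) (2 * k) (expL k)).submatrix
        Sum.inl Sum.inl).submatrix id (Equiv.refl (Fin (k + 1)))).det = cubeDet (k + 1) x := rfl
    have e₂ : ((fromCols (rowMat (fun j e => dd x e j) (k + 1) (2 * k) (expL k))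
        ((rowMat (fun j e => dd x e j) (k + 1) (2 * k) (expR k)).submatrix id
          Sum.inr)).submatrix id g).det = 1 := by
      rw [← det_submatrix_equiv_self finSumFinEquiv.symm]
      have : ((fromCols (rowMat (fun j e => dd x e j) (k + 1) (2 * k) (expL k))
        ((rowMat (fun j e => dd x e j) (k + 1) (2 * k) (expR k)).submatrix id
          Sum.inr)).submatrix id g).submatrix finSumFinEquiv.symm finSumFinEquiv.symm =
          Matrix.of fun j e : Fin (k + 1 + 2 * k) => dd x e j := by
        ext j e
        obtain ⟨j, rfl⟩ := finSumFinEquiv.surjective j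
        obtain ⟨c, rfl⟩ := (Equiv.ofBijective ex hex).surjective e
        simp only [submatrix_apply, g, Equiv.symm_apply_apply, Equiv.trans_apply,
          Equiv.apply_symm_apply, id, of_apply, Equiv.ofBijective_apply,
          Equiv.ofBijective_symm_apply_apply]
        rcases j with j | j <;> rcases c with c | c <;> rfl
      rw [this, det_of_isUpperTriangular]
      · simp [dd_self]
      · intro i j hij
        have : (j : ℕ) < i := hij
        exact dd_of_lt x this
    rw [e₁, e₂]; ring
  · rintro (i | i) c <;> rfl

end BaseCase

section Symmetry

lemma ddList_swap (n M K : ℕ) (A B : List ℂ) (a b : ℂ) (hA : A.length + 1 < M) :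
    ddList n M K (A ++ b :: a :: B) = ddList n M K (A ++ a :: b :: B) := by
  unfold ddList
  rw [← ddDet_swap n M K _ A.length hA]
  congr 1
  funext i
  simp only [Function.comp_apply]
  rcases lt_trichotomy i A.length with h | rfl | h
  · rw [Equiv.swap_apply_of_ne_of_ne h.ne (by omega), List.getD_append _ _ _ _ h,
      List.getD_append _ _ _ _ h]
  · rw [Equiv.swap_apply_left]
    simp
  · obtain ⟨j, rfl⟩ := Nat.exists_eq_add_of_lt h
    cases j with
    | zero => rw [add_zero, Equiv.swap_apply_right]; simp
    | succ j =>
      rw [Equiv.swap_apply_of_ne_of_ne (by omega) (by omega),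
        List.getD_append_right _ _ _ _ h.le, List.getD_append_right _ _ _ _ h.le,
        show A.length + (j + 1) + 1 - A.length = j + 2 by omega]
      simp

lemma ddList_perm (n M K : ℕ) {z z' : List ℂ} (h : z.Perm z') (w : List ℂ) (hM : z.length ≤ M) :
    ddList n M K (z ++ w) = ddList n M K (z' ++ w) := by
  suffices H : ∀ A : List ℂ, A.length + z.length ≤ M →
      ddList n M K (A ++ (z ++ w)) = ddList n M K (A ++ (z' ++ w)) by
    simpa using H [] (by simpa using hM)
  clear hM
  induction h with
  | nil => exact fun _ _ => rfl
  | cons x _ ih =>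
    intro A hA
    have := ih (A ++ [x]) (by simp at hA ⊢; omega)
    simpa using this
  | swap x y l =>
    intro A hA
    exact ddList_swap n M K A (l ++ w) x y (by simp at hA; omega)
  | trans h₁ _ ih₁ ih₂ =>
    intro A hA
    exact (ih₁ A hA).trans (ih₂ A (h₁.length_eq ▸ hA))

lemma bilin_swap_any (n : ℕ) (A B y y' : List ℂ) (a b : ℂ) (hy : y'.length = y.length) :
    bilin n (A ++ b :: a :: B) y y' = bilin n (A ++ a :: b :: B) y y' := by
  have h₁ := bilin_polyDeg n A (a :: B) y y'
  have h₂ := bilin_polyDeg n (A ++ [a]) B y y'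
  have h₃ := h₁.sub h₂
  rw [← sub_eq_zero]
  have := h₃.eq_zero_of_cofinite {qc * a, qc ^ 2 * a} (by simp) ?_ b
  · simpa using this
  · intro t ht
    simp only [Set.mem_insert_iff, Set.mem_singleton_iff, not_or] at ht
    rw [sub_eq_zero, bilin_swap n A B y y' a t hy]
    · simp
    · have : a ^ 2 + a * t + t ^ 2 = (t - qc * a) * (t - qc ^ 2 * a) := by
        have := qc_rel
        generalize qc = q at *
        clear * - this
        grind
      rw [this]
      exact mul_ne_zero (sub_ne_zero.2 ht.1) (sub_ne_zero.2 ht.2)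

lemma bilin_perm (n : ℕ) {z z' : List ℂ} (h : z.Perm z') (y y' : List ℂ)
    (hy : y'.length = y.length) : bilin n z y y' = bilin n z' y y' := by
  suffices H : ∀ A : List ℂ, bilin n (A ++ z) y y' = bilin n (A ++ z') y y' from H []
  induction h with
  | nil => exact fun _ => rfl
  | cons x _ ih =>
    intro A
    simpa using ih (A ++ [x])
  | swap x y l => exact fun A => bilin_swap_any n A l _ _ x y hy
  | trans _ _ ih₁ ih₂ => exact fun A => (ih₁ A).trans (ih₂ A)

lemma Gen.sublist {l l' : List ℂ} (h : l'.Sublist l) (hl : Gen l) : Gen l' :=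
  ⟨hl.1.sublist h, fun x hx => hl.2 x (h.subset hx)⟩

lemma Gen.cons_of_cube {a b : ℂ} {l : List ℂ} (h : Gen (a :: l)) (hb : b ^ 3 = a ^ 3) :
    Gen (b :: l) := by
  rw [gen_cons] at h ⊢
  refine ⟨fun h0 => h.1 ?_, fun x hx => hb ▸ h.2.1 x hx, h.2.2⟩
  subst h0
  exact pow_eq_zero_iff (n := 3) (by norm_num) |>.1 (by rw [← hb]; norm_num)

/-- The pair recursion for `ddList`. -/
lemma ddList_pair (n k M : ℕ) (hM : 2 * M + 2 * k = 2 * (2 * n + 1)) :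
    ∃ ε : ℂ, ε ^ 2 = 1 ∧ ∀ (a : ℂ) (B y y' : List ℂ), B.length = M → y.length = k →
      y'.length = k →
      ddList (n + 1) (M + 2) (2 * k) (a :: (qc ^ 2 * a) :: (B ++ y ++ y')) =
        ε * (qc * a * pairFac a (B ++ y) * pairFac a (B ++ y') *
          ddList n M (2 * k) (B ++ y ++ y')) := by
  obtain ⟨ε, h, H⟩ := ddDet_recursion (R := ℂ) n M (2 * k) hM
  refine ⟨-ε, by simpa using h, fun a B y y' hB hy hy' => ?_⟩
  have hs : ∀ b : ℂ, b + a + qc ^ 2 * a = b - qc * a := fun b => by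
    linear_combination a * qc_rel
  unfold ddList
  rw [H]
  · simp only [List.getD_cons_zero, List.getD_cons_succ, hs]
    have e₁ : ∏ j ∈ Finset.range M, ((B ++ y ++ y').getD j 0 - qc * a) = pairFac a B := by
      rw [pairFac, ← prod_range_getD, hB]
      refine Finset.prod_congr rfl fun j hj => ?_
      rw [Finset.mem_range] at hj
      rw [List.append_assoc, List.getD_append _ _ _ _ (by omega)]
    have e₂ : ∏ l ∈ Finset.range (2 * k), ((B ++ y ++ y').getD (M + l) 0 - qc * a) =
        pairFac a y * pairFac a y' := by
      rw [pairFac, pairFac, ← List.prod_append, ← List.map_append, ← prod_range_getD,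
        List.length_append, hy, hy', ← two_mul]
      refine Finset.prod_congr rfl fun j hj => ?_
      rw [List.append_assoc, List.getD_append_right _ _ _ _ (by omega)]
      simp [hB]
    rw [e₁, e₂]
    simp only [pairFac, List.map_append, List.prod_append]
    linear_combination ε * (a * (B.map fun z => z - qc * a).prod ^ 2 *
      ((y.map fun z => z - qc * a).prod * (y'.map fun z => z - qc * a).prod) *
      ddDet n M (2 * k) fun i => (B ++ y ++ y').getD i 0) * qc_rel
  · simp only [List.getD_cons_zero, List.getD_cons_succ]
    linear_combination (a ^ 2 * (qc ^ 2 - qc + 1)) * qc_rel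

end Symmetry

section Uniqueness

lemma dd_congr {R : Type*} [CommRing R] {x y : ℕ → R} (e j : ℕ) (h : ∀ i ≤ j, x i = y i) :
    dd x e j = dd y e j := by
  induction e generalizing j with
  | zero => cases j <;> simp [dd_zero_zero, dd_zero_succ]
  | succ e ih =>
    cases j with
    | zero => rw [dd_succ_zero, dd_succ_zero, h 0 le_rfl, ih 0 h]
    | succ j =>
      rw [dd_succ_succ, dd_succ_succ, h _ le_rfl, ih _ h, ih j fun i hi => h i (by omega)]

lemma cubeDet_congr {R : Type*} [CommRing R] {x y : ℕ → R} (m : ℕ) (h : ∀ i < m, x i = y i) :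
    cubeDet m x = cubeDet m y := by
  unfold cubeDet
  congr 1
  ext j i
  exact dd_congr _ _ fun l hl => h l (lt_of_le_of_lt hl j.2)

/-- The dependence of the base case on the last two groups of variables. -/
def edgeFac (y y' : List ℂ) : ℂ := qvan y * y'.prod * qvan y'.reverse

lemma bilin_eq_ddList_of_gen (k m : ℕ) : ∃ ε : ℂ, ε ^ 2 = 1 ∧ ∀ z y y' : List ℂ,
    z.length = k + 1 + 2 * m → y.length = k → y'.length = k → Gen (z ++ y ++ y') →
    bilin (k + m) z y y' =
      ε * (edgeFac y y' * ddList (k + m) (k + 1 + 2 * m) (2 * k) (z ++ y ++ y')) := by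
  induction m with
  | zero =>
    obtain ⟨ε, h, H⟩ := ddDet_base (R := ℂ) k
    refine ⟨(-1) ^ (k + 1).choose 2 * ε, by simp [mul_pow, h, ← pow_mul], ?_⟩
    intro z y y' hz hy hy' _
    simp only [mul_zero, add_zero] at hz ⊢
    rw [bilin_base k z y y' hz hy hy', qvan_mul_qvan_reverse, hz, ddList, H, edgeFac]
    have : cubeDet (k + 1) (fun i => (z ++ y ++ y').getD i 0) =
        cubeDet (k + 1) fun i => z.getD i 0 :=
      cubeDet_congr _ fun i hi => by
        rw [List.append_assoc, List.getD_append _ _ _ _ (by omega)]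
    rw [this]
    linear_combination - (-1) ^ (k + 1).choose 2 * (qvan y * y'.prod * qvan y'.reverse) *
      (cubeDet (k + 1) fun i => z.getD i 0) * h
  | succ m ih =>
    obtain ⟨ε, h, H⟩ := ih
    obtain ⟨δ, h', H'⟩ := ddList_pair (k + m) k (k + 1 + 2 * m) (by ring)
    refine ⟨ε * δ, by simp [mul_pow, *], ?_⟩
    intro z y y' hz hy hy' hG
    have hyy : y'.length = y.length := by omega
    have pair : ∀ (a : ℂ) (B : List ℂ), B.length = k + 1 + 2 * m → Gen (a :: (B ++ y ++ y')) →
        bilin (k + (m + 1)) (a :: (qc ^ 2 * a) :: B) y y' =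
          ε * δ * (edgeFac y y' * ddList (k + (m + 1)) (k + 1 + 2 * (m + 1)) (2 * k)
            ((a :: (qc ^ 2 * a) :: B) ++ y ++ y')) := by
      intro a B hB hG
      have b := bilin_pair (k + m) [] B y y' a hyy (hG.sublist (by simp)) (hG.sublist (by simp))
      simp only [List.nil_append] at b
      rw [← add_assoc, b, H B y y' hB hy hy' (gen_cons.1 hG).2.2,
        show k + 1 + 2 * (m + 1) = k + 1 + 2 * m + 2 by ring, List.cons_append, List.cons_append,
        List.cons_append, List.cons_append, H' a B y y' hB hy hy']
      linear_combination -(ε * edgeFac y y' * (qc * a * pairFac a (B ++ y) * pairFac a (B ++ y') *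
        ddList (k + m) (k + 1 + 2 * m) (2 * k) (B ++ y ++ y'))) * h'
    obtain ⟨t, l, rfl⟩ : ∃ t l, z = t :: l := List.exists_cons_of_length_pos (by omega) |>.imp
      fun _ h => h
    have hl : l.length = k + 1 + 2 * m + 1 := by simp at hz; omega
    rw [← sub_eq_zero]
    have hpoly : PolyDeg (2 * (k + (m + 1)) + 1) fun t => bilin (k + (m + 1)) (t :: l) y y' -
        ε * δ * (edgeFac y y' * ddList (k + (m + 1)) (k + 1 + 2 * (m + 1)) (2 * k)
          ((t :: l) ++ y ++ y')) := by
      refine (bilin_polyDeg _ [] l y y').sub (PolyDeg.const_mul _ (PolyDeg.const_mul _ ?_))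
      have := ddList_polyDeg_head (k + (m + 1)) (k + 1 + 2 * m + 1) (2 * k) (by ring)
        (l ++ y ++ y')
      exact this.mono (by omega)
    have hGl : Gen (l ++ y ++ y') := (gen_cons.1 (by simpa using hG)).2.2
    have hnd : l.Nodup := by
      refine (hGl.sublist (by simp)).1.imp (S := fun x y => x ≠ y) ?_
      rintro x y h rfl
      exact h rfl
    have inj : ∀ c : ℂ, c ≠ 0 → Set.InjOn (fun y => c * y) (l.toFinset : Set ℂ) :=
      fun c hc y _ y' _ h => mul_left_cancel₀ hc h
    have hq2 : qc ^ 2 ≠ 0 := pow_ne_zero _ qc_ne_zero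
    have move : ∀ x t, x ∈ l → (∃ a b, b = qc ^ 2 * a ∧ a ^ 3 = x ^ 3 ∧
        (a = x ∧ b = t ∨ a = t ∧ b = x)) →
        bilin (k + (m + 1)) (t :: l) y y' -
          ε * δ * (edgeFac y y' * ddList (k + (m + 1)) (k + 1 + 2 * (m + 1)) (2 * k)
            ((t :: l) ++ y ++ y')) = 0 := by
      rintro x t hx ⟨a, b, rfl, hcube, hab⟩
      obtain ⟨C, D, rfl⟩ := List.append_of_mem hx
      have hperm : (t :: (C ++ x :: D)).Perm (a :: (qc ^ 2 * a) :: (C ++ D)) := by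
        rcases hab with ⟨rfl, rfl⟩ | ⟨rfl, rfl⟩
        · exact (List.perm_middle.cons _).trans (List.Perm.swap _ _ _)
        · exact List.perm_middle.cons _
      have hGa : Gen (a :: (C ++ D ++ y ++ y')) := by
        refine Gen.cons_of_cube (a := x) (hGl.perm ?_) hcube
        simp
      rw [sub_eq_zero, bilin_perm _ hperm y y' hyy, List.append_assoc (t :: _),
        ddList_perm _ _ _ hperm (y ++ y') (by simp at hl ⊢; omega), ← List.append_assoc]
      exact pair a (C ++ D) (by simp at hl ⊢; omega) hGa
    refine hpoly.eq_zero_of_roots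
      ((l.toFinset.image fun y => qc * y) ∪ l.toFinset.image fun y => qc ^ 2 * y) ?_ ?_ t
    · rw [Finset.card_union_of_disjoint, Finset.card_image_of_injOn (inj _ qc_ne_zero),
        Finset.card_image_of_injOn (inj _ hq2), List.toFinset_card_of_nodup hnd, hl]
      · omega
      · rw [Finset.disjoint_left]
        intro r hr hr'
        simp only [Finset.mem_image, List.mem_toFinset] at hr hr'
        obtain ⟨u, hu, rfl⟩ := hr
        obtain ⟨v, hv, hvu⟩ := hr'
        have hc : u ^ 3 = v ^ 3 := by
          linear_combination (qc ^ 3 * v ^ 3 + v ^ 3 - u ^ 3) * qc_cube -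
            ((qc ^ 2 * v) ^ 2 + qc ^ 2 * v * (qc * u) + (qc * u) ^ 2) * hvu
        have : u = v := by
          by_contra hne
          obtain ⟨C, D, rfl⟩ := List.append_of_mem hu
          have hg := gen_cons.1 ((hGl.sublist (by simp : (C ++ u :: D).Sublist _)).perm
            List.perm_middle)
          refine hg.2.1 v ?_ hc
          simp only [List.mem_append, List.mem_cons] at hv ⊢
          tauto
        subst this
        have hu0 := (hGl.sublist (by simp : l.Sublist _)).2 u hu
        have : qc = 1 := by
          have h1 : (qc * u) * (qc - 1) = 0 := by linear_combination hvu
          rcases mul_eq_zero.1 h1 with h2 | h2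
          · exact absurd h2 (mul_ne_zero qc_ne_zero hu0)
          · exact sub_eq_zero.1 h2
        have h3 := qc_rel
        rw [this] at h3
        norm_num at h3
    · intro r hr
      simp only [Finset.mem_union, Finset.mem_image, List.mem_toFinset] at hr
      rcases hr with ⟨x, hx, rfl⟩ | ⟨x, hx, rfl⟩
      · exact move x _ hx ⟨qc * x, x, by linear_combination -x * qc_cube,
          by linear_combination x ^ 3 * qc_cube, Or.inr ⟨rfl, rfl⟩⟩
      · exact move x _ hx ⟨x, qc ^ 2 * x, rfl, rfl, Or.inl ⟨rfl, rfl⟩⟩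

end Uniqueness

section Extension

/-- Polynomial dependence, with unspecified degree. -/
def IsPolyFun (g : ℂ → ℂ) : Prop := ∃ d, PolyDeg d g

lemma isPolyFun_const (c : ℂ) : IsPolyFun fun _ => c := ⟨0, polyDeg_const 0 c⟩

lemma isPolyFun_id : IsPolyFun fun t => t := ⟨1, by simpa using polyDeg_affine 1 0⟩

lemma IsPolyFun.mul {f g : ℂ → ℂ} (hf : IsPolyFun f) (hg : IsPolyFun g) :
    IsPolyFun fun t => f t * g t := by
  obtain ⟨d, hd⟩ := hf
  obtain ⟨e, he⟩ := hg
  exact ⟨_, hd.mul he⟩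

lemma IsPolyFun.sub {f g : ℂ → ℂ} (hf : IsPolyFun f) (hg : IsPolyFun g) :
    IsPolyFun fun t => f t - g t := by
  obtain ⟨d, hd⟩ := hf
  obtain ⟨e, he⟩ := hg
  exact ⟨max d e, (hd.mono (le_max_left _ _)).sub (he.mono (le_max_right _ _))⟩

lemma isPolyFun_list_prod (l : List ℂ) (f : ℂ → ℂ → ℂ) (h : ∀ x, IsPolyFun (f x)) :
    IsPolyFun fun t => (l.map fun x => f x t).prod := by
  induction l with
  | nil => simpa using isPolyFun_const 1
  | cons a l ih => simpa using (h a).mul ih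

lemma isPolyFun_qvan (A B : List ℂ) : IsPolyFun fun t => qvan (A ++ t :: B) := by
  simp only [qvan_append, qvan, List.map_cons, List.prod_cons]
  refine ((isPolyFun_const _).mul (isPolyFun_list_prod A _ fun x => ?_)).mul
    ((isPolyFun_list_prod B _ fun x => ?_).mul (isPolyFun_const _))
  · refine IsPolyFun.mul ⟨1, ?_⟩ (isPolyFun_const _)
    convert polyDeg_affine (-qc ^ 2) (qc * x) using 2
    ring
  · refine ⟨1, ?_⟩
    convert polyDeg_affine qc (-(qc ^ 2 * x)) using 2
    ring

lemma isPolyFun_edgeFac_left (A B y' : List ℂ) : IsPolyFun fun t => edgeFac (A ++ t :: B) y' :=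
  ((isPolyFun_qvan A B).mul (isPolyFun_const _)).mul (isPolyFun_const _)

lemma isPolyFun_edgeFac_right (y A B : List ℂ) : IsPolyFun fun t => edgeFac y (A ++ t :: B) := by
  refine ((isPolyFun_const _).mul ?_).mul ?_
  · simp only [List.prod_append, List.prod_cons]
    exact (isPolyFun_const _).mul (isPolyFun_id.mul (isPolyFun_const _))
  · simp only [List.reverse_append, List.reverse_cons, List.append_assoc, List.singleton_append]
    exact isPolyFun_qvan _ _

theorem bilin_eq_ddList (k m : ℕ) : ∃ ε : ℂ, ε ^ 2 = 1 ∧ ∀ z y y' : List ℂ,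
    z.length = k + 1 + 2 * m → y.length = k → y'.length = k →
    bilin (k + m) z y y' =
      ε * (edgeFac y y' * ddList (k + m) (k + 1 + 2 * m) (2 * k) (z ++ y ++ y')) := by
  obtain ⟨ε, h, H⟩ := bilin_eq_ddList_of_gen k m
  refine ⟨ε, h, fun z y y' hz hy hy' => ?_⟩
  let M := k + 1 + 2 * m
  let g : List ℂ → ℂ := fun l =>
    bilin (k + m) (l.take M) ((l.drop M).take k) (l.drop (M + k)) -
      ε * (edgeFac ((l.drop M).take k) (l.drop (M + k)) * ddList (k + m) M (2 * k) l)
  have split : ∀ l : List ℂ, l = l.take M ++ (l.drop M).take k ++ l.drop (M + k) := by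
    intro l
    rw [List.append_assoc, ← List.drop_drop (i := k) (j := M), List.take_append_drop, List.take_append_drop]
  have key := eq_zero_of_gen (N := M + k + k) (g := g) ?_ ?_ (z ++ y ++ y')
    (by simp [hz, hy, hy', M]; ring)
  · simp only [g] at key
    rw [← sub_eq_zero, ← key]
    have e₁ : (z ++ y ++ y').take M = z := by
      rw [List.append_assoc]; exact List.take_left' hz
    have e₂ : ((z ++ y ++ y').drop M).take k = y := by
      rw [List.append_assoc, List.drop_left' hz, List.take_left' hy]
    have e₃ : (z ++ y ++ y').drop (M + k) = y' := List.drop_left' (by simp [hz, hy, M])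
    rw [e₁, e₂, e₃]
  · intro A B hAB
    have hd := ddList_polyDeg (k + m) M (2 * k) (by simp only [M]; ring) A B
    suffices H : IsPolyFun (fun t => bilin (k + m) ((A ++ t :: B).take M)
        (((A ++ t :: B).drop M).take k) ((A ++ t :: B).drop (M + k))) ∧
        IsPolyFun (fun t => edgeFac (((A ++ t :: B).drop M).take k)
          ((A ++ t :: B).drop (M + k))) from
      H.1.sub ((isPolyFun_const _).mul (H.2.mul hd))
    by_cases h₁ : A.length < M
    · obtain ⟨i, hi⟩ := Nat.exists_eq_add_of_lt h₁
      have e₁ : ∀ t, (A ++ t :: B).take M = A ++ t :: B.take i := fun t => by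
        rw [List.take_append, List.take_of_length_le h₁.le,
          show M - A.length = i + 1 by omega, List.take_succ_cons]
      have e₂ : ∀ t, (A ++ t :: B).drop M = B.drop i := fun t => by
        rw [List.drop_append, List.drop_of_length_le h₁.le,
          show M - A.length = i + 1 by omega, List.drop_succ_cons, List.nil_append]
      have e₃ : ∀ t, (A ++ t :: B).drop (M + k) = B.drop (i + k) := fun t => by
        rw [← List.drop_drop, e₂, List.drop_drop]
      simp only [e₁, e₂, e₃]
      exact ⟨⟨_, bilin_polyDeg _ _ _ _ _⟩, isPolyFun_const _⟩
    · push Not at h₁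
      have e₁ : ∀ t, (A ++ t :: B).take M = A.take M := fun t => List.take_append_of_le_length h₁
      have e₂ : ∀ t, (A ++ t :: B).drop M = A.drop M ++ t :: B :=
        fun t => List.drop_append_of_le_length h₁
      have hl : (A.drop M).length = A.length - M := List.length_drop
      by_cases h₂ : A.length < M + k
      · obtain ⟨i, hi⟩ := Nat.exists_eq_add_of_lt h₂
        have e₃ : ∀ t, (A.drop M ++ t :: B).take k = A.drop M ++ t :: B.take i := fun t => by
          rw [List.take_append, List.take_of_length_le (by omega),
            show k - (A.drop M).length = i + 1 by omega, List.take_succ_cons]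
        have e₄ : ∀ t, (A ++ t :: B).drop (M + k) = B.drop i := fun t => by
          rw [List.drop_append, List.drop_of_length_le h₂.le,
            show M + k - A.length = i + 1 by omega, List.drop_succ_cons, List.nil_append]
        simp only [e₁, e₂, e₃, e₄]
        exact ⟨⟨_, bilin_polyDeg_left _ _ _ _ _⟩, isPolyFun_edgeFac_left _ _ _⟩
      · push Not at h₂
        have e₃ : ∀ t, (A.drop M ++ t :: B).take k = (A.drop M).take k :=
          fun t => List.take_append_of_le_length (by omega)
        have e₄ : ∀ t, (A ++ t :: B).drop (M + k) = A.drop (M + k) ++ t :: B :=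
          fun t => List.drop_append_of_le_length h₂
        simp only [e₁, e₂, e₃, e₄]
        exact ⟨⟨_, bilin_polyDeg_right _ _ _ _ _⟩, isPolyFun_edgeFac_right _ _ _⟩
  · intro l hl hG
    simp only [g]
    rw [sub_eq_zero, H]
    · rw [← split l]
    · simp [hl]; omega
    · simp [hl]; omega
    · simp [hl]
    · rwa [← split l]

/-- The linked determinant of binomial coefficients. -/
def chooseDet (n M K : ℕ) : ℂ := linkDet (fun j e => ((e.choose j : ℕ) : ℂ)) M K (expL n) (expR n)

lemma rowMat_congr {R τ : Type*} {γ : Type} {Φ Φ' : ℕ → τ → R} {M K : ℕ} (f : γ → τ)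
    (h : ∀ j < M + K, Φ j = Φ' j) : rowMat Φ M K f = rowMat Φ' M K f := by
  ext (i | i) c
  · exact congrFun (h i (by omega)) _
  · exact congrFun (h (M + i) (by omega)) _

theorem upSum_eq_chooseDet (k m : ℕ) : ∃ ε : ℂ, ε ^ 2 = 1 ∧
    upSum (k + m) k =
      ε * ((qc - qc ^ 2) ^ (k * (k - 1)) * chooseDet (k + m) (k + 1 + 2 * m) (2 * k)) := by
  obtain ⟨ε, h, H⟩ := bilin_eq_ddList k m
  refine ⟨ε, h, ?_⟩
  rw [← bilin_one (k + m) k (by omega), show 2 * (k + m) + 1 - k = k + 1 + 2 * m by omega,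
    H _ _ _ (by simp) (by simp) (by simp)]
  congr 2
  · simp only [edgeFac, List.prod_replicate, List.reverse_replicate, qvan_replicate, one_pow,
      mul_one]
    rw [← pow_add, ← two_mul, mul_comm 2, Nat.choose_two_right,
      Nat.div_mul_cancel (Nat.even_mul_pred_self k).two_dvd]
  · simp only [← List.replicate_add, ddList, ddDet, chooseDet, linkDet]
    have : ∀ j < k + 1 + 2 * m + 2 * k,
        (fun e => dd (fun i => (List.replicate (k + 1 + 2 * m + k + k) (1 : ℂ)).getD i 0) e j) =
          fun e => ((e.choose j : ℕ) : ℂ) := by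
      intro j hj
      funext e
      rw [← dd_one]
      refine dd_congr e j fun i hi => ?_
      rw [List.getD_replicate _ (by omega)]
    rw [rowMat_congr _ this, rowMat_congr _ this]

end Extension

section PowerRows

/-- The coefficients of `(e / 3 - c) ^ j` in the basis of binomial coefficients. -/
def powCoeff (c : ℂ) : ℕ → ℕ → ℂ
  | 0, 0 => 1
  | 0, _ + 1 => 0
  | j + 1, 0 => -c * powCoeff c j 0
  | j + 1, i + 1 => (i + 1) / 3 * powCoeff c j i + ((i + 1) / 3 - c) * powCoeff c j (i + 1)

lemma powCoeff_of_lt (c : ℂ) {j i : ℕ} (h : j < i) : powCoeff c j i = 0 := by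
  induction j generalizing i with
  | zero => obtain ⟨i, rfl⟩ := Nat.exists_eq_succ_of_ne_zero (by omega : i ≠ 0); rfl
  | succ j ih =>
    obtain ⟨i, rfl⟩ := Nat.exists_eq_succ_of_ne_zero (by omega : i ≠ 0)
    rw [Nat.succ_eq_add_one, powCoeff, ih (by omega), ih (by omega), mul_zero, mul_zero, zero_add]

lemma powCoeff_self (c : ℂ) (j : ℕ) : powCoeff c j j = Nat.factorial j / 3 ^ j := by
  induction j with
  | zero => simp [powCoeff]
  | succ j ih =>
    rw [powCoeff, ih, powCoeff_of_lt c (by omega), Nat.factorial_succ, pow_succ]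
    push_cast
    field_simp
    ring

lemma pow_eq_sum_powCoeff (c : ℂ) (j e : ℕ) :
    ((e : ℂ) / 3 - c) ^ j =
      ∑ i ∈ Finset.range (j + 1), powCoeff c j i * ((e.choose i : ℕ) : ℂ) := by
  induction j with
  | zero => simp [powCoeff]
  | succ j ih =>
    have h : ∀ i : ℕ, (e : ℂ) * (e.choose i : ℕ) =
        (i + 1) * (e.choose (i + 1) : ℕ) + i * (e.choose i : ℕ) := by
      intro i
      rcases le_or_gt i e with hi | hi
      · have := Nat.choose_succ_right_eq e i
        have h2 : ((e.choose (i + 1) * (i + 1) : ℕ) : ℂ) = (e.choose i * (e - i) : ℕ) := by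
          rw [this]
        push_cast [Nat.cast_sub hi] at h2
        linear_combination -h2
      · simp [Nat.choose_eq_zero_of_lt hi, Nat.choose_eq_zero_of_lt (Nat.lt_succ_of_lt hi)]
    rw [pow_succ, ih, Finset.sum_mul, Finset.sum_range_succ' _ (j + 1)]
    simp only [powCoeff, add_mul, Finset.sum_add_distrib]
    have e₁ : ∑ i ∈ Finset.range (j + 1), ((i + 1 : ℕ) / 3 - c) * powCoeff c j (i + 1) *
        ((e.choose (i + 1) : ℕ) : ℂ) + -c * powCoeff c j 0 * ((e.choose 0 : ℕ) : ℂ) =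
        ∑ i ∈ Finset.range (j + 1), ((i : ℕ) / 3 - c) * powCoeff c j i *
          ((e.choose i : ℕ) : ℂ) := by
      have := Finset.sum_range_succ' (fun i : ℕ => ((i : ℂ) / 3 - c) * powCoeff c j i *
          ((e.choose i : ℕ) : ℂ)) (j + 1)
      rw [Finset.sum_range_succ, powCoeff_of_lt c (Nat.lt_succ_self j)] at this
      simpa using this.symm
    push_cast at e₁
    rw [add_assoc, e₁, ← Finset.sum_add_distrib]
    refine Finset.sum_congr rfl fun i _ => ?_
    linear_combination powCoeff c j i / 3 * h i

/-- The linked determinant of powers, centred at the middle of the exponents. -/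
def powDet (n M K : ℕ) : ℂ :=
  linkDet (fun j e : ℕ => ((e : ℂ) / 3 - n / 2) ^ j) M K (expL n) (expR n)

lemma powDet_eq (n M K : ℕ) : powDet n M K =
    (∏ j ∈ Finset.range M, (Nat.factorial j : ℂ) / 3 ^ j) ^ 2 *
      (∏ l ∈ Finset.range K, (Nat.factorial (M + l) : ℂ) / 3 ^ (M + l)) * chooseDet n M K := by
  rw [powDet, linkDet_lower (fun j e => ((e.choose j : ℕ) : ℂ)) _ M K _ _ (powCoeff (n / 2))
    fun j _ e => pow_eq_sum_powCoeff _ j e]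
  simp only [powCoeff_self]
  rfl

end PowerRows

section ParitySplitting

open Matrix

/-- Even and odd indices. -/
def evenOdd (k : ℕ) : Fin k ⊕ Fin k ≃ Fin (2 * k) :=
  Equiv.ofBijective
    (Sum.elim (fun i => ⟨2 * i, by omega⟩) (fun i => ⟨2 * i + 1, by omega⟩))
    ((Fintype.bijective_iff_injective_and_card _).2 ⟨by
      rintro (i | i) (j | j) h <;> simp [Fin.ext_iff] at h ⊢ <;> omega, by
      simp [two_mul]⟩)

@[simp] lemma evenOdd_inl (k : ℕ) (i : Fin k) : (evenOdd k (Sum.inl i) : ℕ) = 2 * i := rfl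

@[simp] lemma evenOdd_inr (k : ℕ) (i : Fin k) : (evenOdd k (Sum.inr i) : ℕ) = 2 * i + 1 := rfl

variable {γ : Type} [Fintype γ] [DecidableEq γ]

/-- The rows `0, …, M - 1` of `Φ`, followed by the rows `M + d, M + d + 2, …`. -/
def lacMat (Φ : ℕ → γ → ℂ) (M k d : ℕ) : Matrix (Fin M ⊕ Fin k) γ ℂ :=
  Matrix.of fun r c =>
    Φ (Sum.elim (fun i : Fin M => (i : ℕ)) (fun i : Fin k => M + d + 2 * i) r) c

theorem linked_parity (Φ : ℕ → γ → ℂ) (τ : γ ≃ γ) (M k : ℕ) (hγ : Fintype.card γ = M + k) :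
    ∃ ε : ℂ, ε ^ 2 = 1 ∧
      mdet (linked (rowMat Φ M (2 * k) id)
        (rowMat (fun j c => (-1) ^ j * Φ j (τ c)) M (2 * k) id)) =
      ε * (2 ^ k * mdet (lacMat Φ M k 0) * mdet (lacMat Φ M k 1)) := by
  let e₁ : (Fin M ⊕ Fin k) ⊕ (Fin M ⊕ Fin k) ≃ (Fin M ⊕ Fin M) ⊕ Fin (2 * k) :=
    (Equiv.sumSumSumComm _ _ _ _).trans (Equiv.sumCongr (Equiv.refl _) (evenOdd k))
  let e₂ : γ ⊕ γ ≃ γ ⊕ γ := Equiv.sumCongr (Equiv.refl _) τ.symm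
  obtain ⟨ε, h, H⟩ := mdet_submatrix (R := ℂ) e₁ e₂
  obtain ⟨ε', h', H'⟩ := mdet_fromBlocks (R := ℂ) (α := Fin M ⊕ Fin k) (β := γ)
    (α' := Fin M ⊕ Fin k) (β' := γ) (by simp [hγ]) (by simp [hγ])
  let s : ℂ := (-1) ^ M
  have hs : s ^ 2 = 1 := by simp [s, ← pow_mul]
  let X : Matrix (Fin M ⊕ Fin k) (Fin M ⊕ Fin k) ℂ :=
    diagonal (Sum.elim (fun i : Fin M => -s * (-1) ^ (i : ℕ)) fun _ => 0)
  let Y : Matrix (Fin M ⊕ Fin k) (Fin M ⊕ Fin k) ℂ :=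
    diagonal (Sum.elim (fun i : Fin M => (-1) ^ (i : ℕ)) fun _ => -2 * s)
  let C : Matrix (Fin M ⊕ Fin k) γ ℂ :=
    fromRows 0 ((lacMat Φ M k 1).submatrix Sum.inr id)
  let L : Matrix ((Fin M ⊕ Fin k) ⊕ (Fin M ⊕ Fin k)) ((Fin M ⊕ Fin k) ⊕ (Fin M ⊕ Fin k)) ℂ :=
    fromBlocks 1 X 0 1
  let F : Matrix ((Fin M ⊕ Fin k) ⊕ (Fin M ⊕ Fin k)) (γ ⊕ γ) ℂ :=
    fromBlocks (lacMat Φ M k 0) 0 C (Y * lacMat Φ M k 1)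
  let U : Matrix (γ ⊕ γ) (γ ⊕ γ) ℂ := fromBlocks 1 (s • 1) 0 1
  have key : (linked (rowMat Φ M (2 * k) id)
      (rowMat (fun j c => (-1) ^ j * Φ j (τ c)) M (2 * k) id)).submatrix e₁ e₂ = L * F * U := by
    have sq : ∀ i : ℕ, ((-1 : ℂ) ^ i) * (-1) ^ i = 1 := fun i => by
      rw [← mul_pow]; simp
    simp only [L, F, U, fromBlocks_multiply, X, Y]
    ext ((i | i) | (i | i)) (j | j)
    · simp [linked, e₁, e₂, C, lacMat, rowMat_inl, diagonal_mul]
    · simp [linked, e₁, e₂, C, lacMat, diagonal_mul]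
      linear_combination (s * Φ i j) * sq i
    · simp [linked, e₁, e₂, C, lacMat, rowMat_inr, diagonal_mul]
    · simp [linked, e₁, e₂, C, lacMat, rowMat_inr, diagonal_mul, s, pow_add, pow_mul]
    · simp [linked, e₁, e₂, C, lacMat]
    · simp [linked, e₁, e₂, C, lacMat, rowMat_inl, diagonal_mul]
    · simp [linked, e₁, e₂, C, lacMat, rowMat_inr, add_assoc, add_comm 1]
    · simp [linked, e₁, e₂, C, lacMat, rowMat_inr, diagonal_mul, s, pow_add, pow_mul, add_assoc,
        add_comm 1]
      ring
  have hL : L.det = 1 := by simp [L]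
  have hU : U.det = 1 := by simp [U]
  have hY : Y.det ^ 2 = (2 ^ k) ^ 2 := by
    simp only [Y, det_diagonal, Fintype.prod_sum_type, Sum.elim_inl, Sum.elim_inr, mul_pow,
      ← Finset.prod_pow]
    simp [← pow_mul, hs, mul_comm]
  have h2 : ((2 : ℂ) ^ k) ^ 2 ≠ 0 := by simp
  refine ⟨ε * ε' * (Y.det / 2 ^ k), ?_, ?_⟩
  · rw [mul_pow, mul_pow, div_pow, h, h', hY, div_self h2]; ring
  · have := H (linked (rowMat Φ M (2 * k) id)
      (rowMat (fun j c => (-1) ^ j * Φ j (τ c)) M (2 * k) id))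
    rw [key, mdet_mul_right, mdet_mul_left, hL, hU, H', mdet_mul_left] at this
    have h3 : (2 : ℂ) ^ k ≠ 0 := by simp
    field_simp
    linear_combination (-ε) * this - h * mdet (linked (rowMat Φ M (2 * k) id)
      (rowMat (fun j c => (-1) ^ j * Φ j (τ c)) M (2 * k) id))

end ParitySplitting

section LacunaryPowers

open Matrix Polynomial

/-- Polynomials that are even or odd, according to the parity of `a`. -/
def HasParity (a : ℕ) (p : ℂ[X]) : Prop := p.comp (-X) = C ((-1) ^ a) * p

lemma HasParity.mul {a b : ℕ} {p r : ℂ[X]} (hp : HasParity a p) (hr : HasParity b r) :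
    HasParity (a + b) (p * r) := by
  unfold HasParity at *
  rw [mul_comp, hp, hr, pow_add, C_mul]
  ring

lemma hasParity_X_pow (a : ℕ) : HasParity a (X ^ a) := by
  unfold HasParity
  rw [pow_comp, X_comp, neg_pow]
  simp

lemma HasParity.coeff_eq_zero {a : ℕ} {p : ℂ[X]} (hp : HasParity a p) {e : ℕ}
    (he : e % 2 ≠ a % 2) : p.coeff e = 0 := by
  have h := congrArg (fun r => coeff r e) hp
  simp only [show (-X : ℂ[X]) = C (-1) * X by simp, comp_C_mul_X_coeff, coeff_C_mul] at h
  rcases Nat.mod_two_eq_zero_or_one e with h1 | h1 <;>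
    rcases Nat.mod_two_eq_zero_or_one a with h2 | h2
  · omega
  · rw [Even.neg_one_pow (Nat.even_iff.2 h1), Odd.neg_one_pow (Nat.odd_iff.2 h2)] at h
    linear_combination h / 2
  · rw [Even.neg_one_pow (Nat.even_iff.2 h2), Odd.neg_one_pow (Nat.odd_iff.2 h1)] at h
    linear_combination -h / 2
  · omega

/-- The central difference of a polynomial. -/
def centralDiff (p : ℂ[X]) : ℂ[X] := p.comp (X + C (1 / 2)) - p.comp (X + C (-1 / 2))

lemma HasParity.centralDiff {a : ℕ} {p : ℂ[X]} (hp : HasParity a p) :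
    HasParity (a + 1) (centralDiff p) := by
  unfold HasParity at *
  have h : ∀ c : ℂ, (p.comp (X + C c)).comp (-X) = C ((-1) ^ a) * p.comp (X + C (-c)) := by
    intro c
    rw [← C_comp (a := (-1 : ℂ) ^ a) (p := X + C (-c)), ← mul_comp, ← hp, comp_assoc, comp_assoc]
    congr 1
    simp
    ring
  rw [_root_.centralDiff, sub_comp, h, h, pow_succ, C_mul,
    show (-(-1 / 2) : ℂ) = 1 / 2 by norm_num, show (-(1 / 2) : ℂ) = -1 / 2 by norm_num]
  simp
  ring

lemma centralDiff_coeff {d e : ℕ} {p : ℂ[X]} (hp : p.natDegree ≤ d + 1) (he : d ≤ e) :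
    (centralDiff p).coeff e = (e + 1) * p.coeff (e + 1) := by
  have h : ∀ c : ℂ, (p.comp (X + C c)).coeff e = p.coeff e + (e + 1) * p.coeff (e + 1) * c := by
    intro c
    rw [← taylor_apply, taylor_coeff, eval_eq_sum_range' (n := 2)
      (lt_of_le_of_lt (natDegree_hasseDeriv_le _ _) (by omega))]
    simp [Finset.sum_range_succ, hasseDeriv_coeff, add_comm 1 e]
  rw [centralDiff, coeff_sub, h, h]
  ring

lemma centralDiff_iter (s : ℕ) {D a : ℕ} {p : ℂ[X]} (hp : p.natDegree ≤ D + s)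
    (ha : HasParity a p) :
    (centralDiff^[s] p).natDegree ≤ D ∧ HasParity (a + s) (centralDiff^[s] p) ∧
      (centralDiff^[s] p).coeff D = (D + s).factorial / D.factorial * p.coeff (D + s) := by
  induction s generalizing D with
  | zero =>
    have : (D.factorial : ℂ) ≠ 0 := by exact_mod_cast D.factorial_ne_zero
    simp [this, ha]
    exact hp
  | succ s ih =>
    obtain ⟨h₁, h₂, h₃⟩ := ih (D := D + 1) (by omega)
    rw [Function.iterate_succ_apply']
    refine ⟨?_, h₂.centralDiff, ?_⟩
    · rw [natDegree_le_iff_coeff_eq_zero]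
      intro e he
      rw [centralDiff_coeff h₁ he.le, coeff_eq_zero_of_natDegree_lt (by omega), mul_zero]
    · rw [centralDiff_coeff h₁ le_rfl, h₃, Nat.factorial_succ D, show D + 1 + s = D + (s + 1) by ring]
      have : (D.factorial : ℂ) ≠ 0 := by exact_mod_cast D.factorial_ne_zero
      have : (D : ℂ) + 1 ≠ 0 := by exact_mod_cast D.succ_ne_zero
      push_cast
      field_simp

lemma centralDiff_iter_eq_zero {s : ℕ} {p : ℂ[X]} (hp : p.natDegree < s) :
    centralDiff^[s] p = 0 := by
  induction s generalizing p with
  | zero => omega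
  | succ s ih =>
    rw [Function.iterate_succ_apply]
    rcases Nat.eq_zero_or_pos s with rfl | hs
    · rw [eq_C_of_natDegree_eq_zero (by omega : p.natDegree = 0)]
      simp [centralDiff]
    · apply ih
      rw [Nat.lt_iff_le_pred hs, natDegree_le_iff_coeff_eq_zero]
      intro e he
      rw [centralDiff_coeff (d := s - 1) (by omega) (by omega),
        coeff_eq_zero_of_natDegree_lt (by omega), mul_zero]

lemma eval_centralDiff_iter (s : ℕ) (p : ℂ[X]) (y : ℂ) :
    (centralDiff^[s] p).eval (y + s / 2) = ∑ l ∈ Finset.range (s + 1),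
      ((-1) ^ (s - l) * (s.choose l : ℂ)) * p.eval (y + l) := by
  have h : ∀ (s : ℕ) (y : ℂ), (centralDiff^[s] p).eval (y + s / 2) =
      (fwdDiff (1 : ℂ))^[s] (fun y => p.eval y) y := by
    intro s
    induction s with
    | zero => simp
    | succ s ih =>
      intro y
      rw [Function.iterate_succ_apply', Function.iterate_succ_apply', fwdDiff, ← ih, ← ih,
        centralDiff]
      simp only [eval_sub, eval_comp, eval_add, eval_X, eval_C]
      push_cast
      congr 2 <;> ring
  rw [h, fwdDiff_iter_eq_sum_shift]
  refine Finset.sum_congr rfl fun l _ => ?_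
  simp

/-- The exponents `0, …, R - 1`, followed by `R + d, R + d + 2, …`. -/
def lacExp (R d i : ℕ) : ℕ := if i < R then i else R + d + 2 * (i - R)

lemma lacExp_of_lt {R d i : ℕ} (h : i < R) : lacExp R d i = i := if_pos h

lemma lacExp_add (R d i : ℕ) : lacExp R d (R + i) = R + d + 2 * i := by
  simp [lacExp]

lemma lacExp_injective (R d : ℕ) : Function.Injective (lacExp R d) := by
  intro i j h
  unfold lacExp at h
  split_ifs at h <;> omega

theorem mdet_eval_lacExp {N R d : ℕ} {γ : Type} [Fintype γ] [DecidableEq γ] (hd : d ≤ 1)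
    (f : Fin N → ℂ[X]) (hf : ∀ i : Fin N, (f i).natDegree ≤ lacExp R d i)
    (hp : ∀ i : Fin N, R ≤ i → HasParity (lacExp R d i) (f i)) (x : γ → ℂ) :
    mdet (Matrix.of fun (i : Fin N) c => (f i).eval (x c)) =
      (∏ i : Fin N, (f i).coeff (lacExp R d i)) *
        mdet (Matrix.of fun (i : Fin N) c => x c ^ lacExp R d i) := by
  let L : Matrix (Fin N) (Fin N) ℂ := Matrix.of fun i j => (f i).coeff (lacExp R d j)
  have hL : L.det = ∏ i : Fin N, (f i).coeff (lacExp R d i) := by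
    refine Matrix.det_of_isLowerTriangular _ fun i j hij => ?_
    have hij' : (i : ℕ) < j := hij
    refine coeff_eq_zero_of_natDegree_lt (lt_of_le_of_lt (hf i) ?_)
    unfold lacExp
    split_ifs <;> omega
  rw [← hL, ← mdet_mul_left]
  congr 1
  ext i c
  simp only [Matrix.of_apply, Matrix.mul_apply, L]
  rw [eval_eq_sum_range]
  have e : ∑ j : Fin N, (f i).coeff (lacExp R d j) * x c ^ lacExp R d j =
      ∑ e ∈ (Finset.range N).map ⟨lacExp R d, lacExp_injective R d⟩,
        (f i).coeff e * x c ^ e := by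
    rw [Finset.sum_map, Finset.sum_range]
    rfl
  rw [e]
  have h0 : ∀ e, (e ∉ (Finset.range N).map ⟨lacExp R d, lacExp_injective R d⟩) →
      (f i).coeff e = 0 := by
    intro e he
    by_contra hne
    apply he
    have h1 : e ≤ lacExp R d i := (le_natDegree_of_ne_zero hne).trans (hf i)
    simp only [Finset.mem_map, Finset.mem_range, Function.Embedding.coeFn_mk]
    by_cases heR : e < R
    · refine ⟨e, ?_, lacExp_of_lt heR⟩
      by_cases hi : (i : ℕ) < R
      · rw [lacExp_of_lt hi] at h1
        omega
      · omega
    · have hi : R ≤ i := by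
        by_contra hi
        rw [lacExp_of_lt (by omega)] at h1
        omega
      have h2 : e % 2 = lacExp R d i % 2 := by
        by_contra h3
        exact hne ((hp i hi).coeff_eq_zero h3)
      obtain ⟨l, hl⟩ := Nat.exists_eq_add_of_le hi
      rw [hl, lacExp_add] at h1 h2
      refine ⟨R + (e - R) / 2, by omega, ?_⟩
      rw [lacExp_add]
      omega
  exact Finset.sum_congr_of_eq_on_inter
    (fun e _ he => by rw [h0 e he, zero_mul])
    (fun e _ he => by
      rw [coeff_eq_zero_of_natDegree_lt (by simpa using he), zero_mul])
    (fun _ _ _ => rfl)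

end LacunaryPowers

section LacunaryDeterminants

open Matrix Polynomial

/-- The points `j + 1/3`, shifted by `n/2`. -/
def shiftPt (n j : ℕ) : ℂ := j + 1 / 3 - n / 2

/-- The determinant of the lacunary powers of the shifted points. -/
def lacDet (n r d : ℕ) : ℂ :=
  (Matrix.of fun i j : Fin n => shiftPt n j ^ lacExp r d i).det

lemma lacDet_centralDiff (n r d : ℕ) : lacDet n r d =
    (Matrix.of fun i o : Fin n => (centralDiff^[min (o : ℕ) r] (X ^ lacExp r d i)).eval
      (shiftPt n (o - min (o : ℕ) r) + (min (o : ℕ) r : ℕ) / 2)).det := by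
  let T : Matrix (Fin n) (Fin n) ℂ := Matrix.of fun c o =>
    if o - min (o : ℕ) r ≤ c ∧ (c : ℕ) ≤ o then
      (-1) ^ ((o : ℕ) - c) * ((min (o : ℕ) r).choose (c - (o - min (o : ℕ) r)) : ℂ) else 0
  have hT : T.det = 1 := by
    rw [Matrix.det_of_isUpperTriangular]
    · refine Finset.prod_eq_one fun i _ => ?_
      have : (i : ℕ) - (i - min (i : ℕ) r) = min (i : ℕ) r := by omega
      simp [T, this]
    · intro i j hij
      have : (j : ℕ) < i := hij
      simp only [T, Matrix.of_apply]
      rw [if_neg (by omega)]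
  rw [lacDet, ← mul_one (det _), ← hT, ← det_mul]
  congr 1
  ext i o
  simp only [Matrix.mul_apply, Matrix.of_apply, T]
  rw [eval_centralDiff_iter,
    ← Finset.sum_range fun c : ℕ => shiftPt n c ^ lacExp r d i *
      if o - min (o : ℕ) r ≤ c ∧ (c : ℕ) ≤ o then
        (-1) ^ ((o : ℕ) - c) * ((min (o : ℕ) r).choose (c - (o - min (o : ℕ) r)) : ℂ) else 0,
    ← Finset.sum_subset (s₁ := Finset.Ico (o - min (o : ℕ) r) (o + 1))]
  · rw [Finset.sum_Ico_eq_sum_range]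
    refine Finset.sum_congr (by congr 1; omega) fun l hl => ?_
    rw [Finset.mem_range] at hl
    rw [if_pos (by omega), show (o : ℕ) - (o - min (o : ℕ) r + l) = min (o : ℕ) r - l by omega,
      Nat.add_sub_cancel_left, eval_pow, eval_X, shiftPt, shiftPt]
    push_cast
    ring
  · intro c hc
    have := o.isLt
    simp only [Finset.mem_Ico, Finset.mem_range] at hc ⊢
    omega
  · intro c _ hc
    rw [Finset.mem_Ico] at hc
    rw [if_neg (by omega), mul_zero]

lemma lacDet_eq (k r d : ℕ) (hd : d ≤ 1) : lacDet (r + k) r d =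
    (∏ l ∈ Finset.range r, (l.factorial : ℂ)) *
      (∏ i ∈ Finset.range k, ((r + (d + 2 * i)).factorial : ℂ) / (d + 2 * i).factorial) *
      (Matrix.of fun i j : Fin k => shiftPt k j ^ (d + 2 * (i : ℕ))).det := by
  rw [lacDet_centralDiff, ← det_submatrix_equiv_self (finSumFinEquiv (m := r) (n := k)),
    ← fromBlocks_toBlocks (submatrix _ _ _)]
  have hlow : ∀ (i o : Fin r), (i : ℕ) ≤ o →
      ((centralDiff^[(o : ℕ)] (X ^ (i : ℕ))).eval (shiftPt (r + k) 0 + ((o : ℕ) : ℂ) / 2)) =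
        if i = o then (i : ℕ).factorial else 0 := by
    intro i o h
    split_ifs with hio
    · subst hio
      obtain ⟨h₁, -, h₃⟩ := centralDiff_iter (i : ℕ) (D := 0) (p := X ^ (i : ℕ)) (by simp)
        (hasParity_X_pow _)
      rw [eq_C_of_natDegree_le_zero h₁, h₃]
      simp
    · have : (i : ℕ) ≠ o := fun h => hio (Fin.ext h)
      rw [centralDiff_iter_eq_zero (by simp; omega), eval_zero, Nat.cast_zero]
  have h12 : toBlocks₁₂ (submatrix (Matrix.of fun i o : Fin (r + k) =>
      (centralDiff^[min (o : ℕ) r] (X ^ lacExp r d i)).eval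
      (shiftPt (r + k) (o - min (o : ℕ) r) + (min (o : ℕ) r : ℕ) / 2))
      (finSumFinEquiv (m := r) (n := k)) (finSumFinEquiv (m := r) (n := k))) = 0 := by
    ext i j
    have := i.isLt
    simp only [toBlocks₁₂, Matrix.of_apply, submatrix_apply, finSumFinEquiv_apply_left,
      finSumFinEquiv_apply_right, Fin.val_castAdd, Fin.val_natAdd, Matrix.zero_apply]
    rw [lacExp_of_lt this, centralDiff_iter_eq_zero (by simp), eval_zero]
  have h11 : ∀ i o : Fin r, toBlocks₁₁ (submatrix (Matrix.of fun i o : Fin (r + k) =>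
      (centralDiff^[min (o : ℕ) r] (X ^ lacExp r d i)).eval
      (shiftPt (r + k) (o - min (o : ℕ) r) + (min (o : ℕ) r : ℕ) / 2))
      (finSumFinEquiv (m := r) (n := k)) (finSumFinEquiv (m := r) (n := k))) i o =
      (centralDiff^[(o : ℕ)] (X ^ (i : ℕ))).eval (shiftPt (r + k) 0 + ((o : ℕ) : ℂ) / 2) := by
    intro i o
    simp only [toBlocks₁₁, Matrix.of_apply, submatrix_apply, finSumFinEquiv_apply_left,
      Fin.val_castAdd]
    rw [lacExp_of_lt i.isLt, min_eq_left o.isLt.le, Nat.sub_self]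
  have h22 : toBlocks₂₂ (submatrix (Matrix.of fun i o : Fin (r + k) =>
      (centralDiff^[min (o : ℕ) r] (X ^ lacExp r d i)).eval
      (shiftPt (r + k) (o - min (o : ℕ) r) + (min (o : ℕ) r : ℕ) / 2))
      (finSumFinEquiv (m := r) (n := k)) (finSumFinEquiv (m := r) (n := k))) =
      Matrix.of fun i j : Fin k =>
        (centralDiff^[r] (X ^ (r + d + 2 * (i : ℕ)))).eval (shiftPt k j) := by
    ext i j
    simp only [toBlocks₂₂, Matrix.of_apply, submatrix_apply, finSumFinEquiv_apply_right,
      Fin.val_natAdd]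
    rw [lacExp_add, min_eq_right (Nat.le_add_right _ _), Nat.add_sub_cancel_left, shiftPt, shiftPt]
    congr 1
    push_cast
    ring
  rw [h12, det_fromBlocks_zero₁₂, h22, Matrix.det_of_isLowerTriangular]
  swap
  · intro i j hij
    have : (i : ℕ) < j := hij
    rw [h11, hlow i j this.le, if_neg (fun h => by simp [h] at this), Nat.cast_zero]
  have e₁ : ∀ i : Fin r, (centralDiff^[(i : ℕ)] (X ^ (i : ℕ))).eval
      (shiftPt (r + k) 0 + ((i : ℕ) : ℂ) / 2) = (i : ℕ).factorial := fun i => by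
    rw [hlow i i le_rfl, if_pos rfl]
  simp only [h11, e₁]
  rw [mul_assoc, Finset.prod_range fun l => (l.factorial : ℂ)]
  congr 1
  have hf : ∀ i : Fin k, r + d + 2 * (i : ℕ) = d + 2 * i + r := fun i => by ring
  have hx : ∀ i : Fin k, lacExp 0 d i = d + 2 * i := fun i => by
    have := lacExp_add 0 d i
    simpa using this
  obtain ⟨ε, h, H⟩ := mdet_eq_det (R := ℂ) (Equiv.refl (Fin k))
  have := mdet_eval_lacExp (N := k) (R := 0) (d := d) hd
    (fun i : Fin k => centralDiff^[r] (X ^ (r + d + 2 * (i : ℕ))))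
    (fun i => by
      rw [hx]
      exact (centralDiff_iter r (by simp [hf]) (hasParity_X_pow _)).1)
    (fun i _ => by
      have h2 := (centralDiff_iter r (D := d + 2 * i) (by simp [hf])
        (hasParity_X_pow (r + d + 2 * (i : ℕ)))).2.1
      unfold HasParity at h2 ⊢
      rw [h2, hx, show r + d + 2 * (i : ℕ) + r = d + 2 * i + 2 * r by ring, pow_add _ _ (2 * r),
        pow_mul _ 2 r]
      simp)
    (fun j : Fin k => shiftPt k j)
  rw [H, H, Finset.prod_congr rfl fun i _ => by
    rw [hx, (centralDiff_iter r (D := d + 2 * i) (by simp [hf])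
        (hasParity_X_pow (r + d + 2 * (i : ℕ)))).2.2]] at this
  simp only [hx, Equiv.coe_refl, submatrix_id_id] at this
  have hε : ε ≠ 0 := fun h0 => by simp [h0] at h
  apply mul_left_cancel₀ hε
  rw [this, Finset.prod_range fun i => ((r + (d + 2 * i)).factorial : ℂ) / (d + 2 * i).factorial]
  have e₂ : ∀ i : Fin k, (((d + 2 * (i : ℕ) + r).factorial : ℂ) / (d + 2 * (i : ℕ)).factorial *
      (X ^ (r + d + 2 * (i : ℕ)) : ℂ[X]).coeff (d + 2 * (i : ℕ) + r)) =
      ((r + (d + 2 * i)).factorial : ℂ) / (d + 2 * i).factorial := fun i => by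
    rw [hf, coeff_X_pow, if_pos rfl, mul_one, add_comm r]
  simp only [e₂]
  ring

end LacunaryDeterminants

section LacunaryReduction

open Matrix Polynomial

/-- The monic polynomial vanishing at the points `i - n/2` for `i ≤ n`. -/
def centredPoly (n : ℕ) : ℂ[X] := ∏ i ∈ Finset.range (n + 1), (X - C ((i : ℂ) - n / 2))

lemma centredPoly_monic (n : ℕ) : (centredPoly n).Monic :=
  monic_prod_of_monic _ _ fun _ _ => monic_X_sub_C _

lemma centredPoly_natDegree (n : ℕ) : (centredPoly n).natDegree = n + 1 := by
  rw [centredPoly, natDegree_prod_of_monic _ _ fun _ _ => monic_X_sub_C _]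
  simp only [natDegree_X_sub_C, Finset.sum_const, Finset.card_range, smul_eq_mul, mul_one]

lemma centredPoly_hasParity (n : ℕ) : HasParity (n + 1) (centredPoly n) := by
  unfold HasParity centredPoly
  rw [Polynomial.prod_comp, ← Finset.prod_range_reflect]
  have : C ((-1 : ℂ) ^ (n + 1)) = ∏ _i ∈ Finset.range (n + 1), C (-1 : ℂ) := by simp
  rw [this, ← Finset.prod_mul_distrib]
  refine Finset.prod_congr rfl fun i hi => ?_
  rw [Finset.mem_range] at hi
  rw [Nat.add_sub_cancel, Nat.cast_sub (by omega), sub_comp, X_comp, C_comp,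
    show ((n : ℂ) - i - n / 2) = -(i - n / 2) by ring, C_neg]
  simp
  ring

lemma centredPoly_eval {n i : ℕ} (hi : i ≤ n) : (centredPoly n).eval ((i : ℂ) - n / 2) = 0 := by
  rw [centredPoly, eval_prod]
  exact Finset.prod_eq_zero (Finset.mem_range.2 (Nat.lt_succ_of_le hi)) (by simp)

/-- The part of the lacunary determinants that does not depend on the gap. -/
def commonDet (n : ℕ) : ℂ :=
  (Matrix.of fun i j : Fin (n + 1) => ((j : ℂ) - n / 2) ^ (i : ℕ)).det *
    ∏ j : Fin n, (centredPoly n).eval (shiftPt n j)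

/-- The centred points of the first family of columns. -/
def centredExp (n : ℕ) (c : Fin (n + 1) ⊕ Fin n) : ℂ := (expL n c : ℂ) / 3 - n / 2

lemma centredExp_inl (n : ℕ) (i : Fin (n + 1)) : centredExp n (Sum.inl i) = (i : ℂ) - n / 2 := by
  simp [centredExp, expL]

lemma centredExp_inr (n : ℕ) (i : Fin n) : centredExp n (Sum.inr i) = shiftPt n i := by
  simp [centredExp, expL, shiftPt]
  ring

lemma lacExp_split {n r d i : ℕ} : lacExp (n + 1 + r) d i =
    if i < n + 1 then i else n + 1 + lacExp r d (i - (n + 1)) := by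
  unfold lacExp
  split_ifs <;> omega

theorem mdet_lacMat (k r d : ℕ) (hd : d ≤ 1) : ∃ ε : ℂ, ε ^ 2 = 1 ∧
    mdet (lacMat (fun j c => centredExp (r + k) c ^ j) (r + k + 1 + r) k d) =
      ε * (commonDet (r + k) * lacDet (r + k) r d) := by
  obtain ⟨n, hn⟩ : ∃ n, n = r + k := ⟨_, rfl⟩
  rw [← hn]
  let e₁ : Fin (n + 1 + r) ⊕ Fin k ≃ Fin (n + 1 + n) :=
    finSumFinEquiv.trans (finCongr (by omega))
  obtain ⟨ε, h, H⟩ := mdet_submatrix (R := ℂ) e₁ (Equiv.refl (Fin (n + 1) ⊕ Fin n))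
  obtain ⟨ε', h', H'⟩ := mdet_submatrix (R := ℂ) (finSumFinEquiv (m := n + 1) (n := n))
    (Equiv.refl (Fin (n + 1) ⊕ Fin n))
  obtain ⟨ε'', h'', H''⟩ := mdet_eq_det (R := ℂ) (Equiv.refl (Fin (n + 1) ⊕ Fin n))
  let f : Fin (n + 1 + n) → ℂ[X] := fun i =>
    if (i : ℕ) < n + 1 then X ^ (i : ℕ) else
      centredPoly n * X ^ lacExp r d (i - (n + 1))
  have hf : ∀ i, (f i).Monic := by
    intro i
    simp only [f]
    split_ifs
    · exact monic_X_pow _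
    · exact (centredPoly_monic n).mul (monic_X_pow _)
  have hfd : ∀ i, (f i).natDegree = lacExp (n + 1 + r) d i := by
    intro i
    rw [lacExp_split]
    simp only [f]
    split_ifs
    · simp
    · rw [(centredPoly_monic n).natDegree_mul (monic_X_pow _), centredPoly_natDegree,
        natDegree_X_pow]
  have key := mdet_eval_lacExp (N := n + 1 + n) (R := n + 1 + r) (d := d) hd f
    (fun i => (hfd i).le)
    (fun i hi => by
      rw [lacExp_split, if_neg (by omega)]
      simp only [f]
      rw [if_neg (by omega)]
      exact (centredPoly_hasParity n).mul (hasParity_X_pow _)) (centredExp n)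
  have hf₁ : ∀ i : Fin (n + 1), f (Fin.castAdd n i) = X ^ (i : ℕ) := fun i => by
    simp only [f, Fin.val_castAdd, if_pos i.isLt]
  have hf₂ : ∀ i : Fin n, f (Fin.natAdd (n + 1) i) = centredPoly n * X ^ lacExp r d i := fun i => by
    simp only [f, Fin.val_natAdd, Nat.add_sub_cancel_left]
    rw [if_neg (by omega)]
  rw [Finset.prod_eq_one fun i _ => by rw [← hfd]; exact hf i, one_mul] at key
  have h₁ := H (Matrix.of fun (i : Fin (n + 1 + n)) c => centredExp n c ^ lacExp (n + 1 + r) d i)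
  have e : (Matrix.of fun (i : Fin (n + 1 + n)) c =>
      centredExp n c ^ lacExp (n + 1 + r) d i).submatrix e₁ (Equiv.refl _) =
      lacMat (fun j c => centredExp n c ^ j) (n + 1 + r) k d := by
    ext (i | i) c
    · simp [lacMat, e₁, lacExp_of_lt]
    · simp [lacMat, e₁, lacExp_add]
  rw [e, ← key] at h₁
  have h₂ := H' (Matrix.of fun i c => (f i).eval (centredExp n c))
  have e' : (Matrix.of fun i c => (f i).eval (centredExp n c)).submatrix
      (finSumFinEquiv (m := n + 1) (n := n)) (Equiv.refl _) = fromBlocks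
        (Matrix.of fun i j : Fin (n + 1) => ((j : ℂ) - n / 2) ^ (i : ℕ))
        (Matrix.of fun (i : Fin (n + 1)) (j : Fin n) => shiftPt n j ^ (i : ℕ)) 0
        (Matrix.of fun i j : Fin n => (centredPoly n).eval (shiftPt n j) *
          (Matrix.of fun i j : Fin n => shiftPt n j ^ lacExp r d i) i j) := by
    ext (i | i) (j | j)
    · simp [hf₁, centredExp_inl]
    · simp [hf₁, centredExp_inr]
    · simp [hf₂, centredExp_inl, centredPoly_eval (Nat.lt_succ_iff.1 j.isLt)]
    · simp [hf₂, centredExp_inr]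
  rw [e', H'', Equiv.coe_refl, submatrix_id_id, det_fromBlocks_zero₂₁,
    det_mul_row (fun j : Fin n => (centredPoly n).eval (shiftPt n j))] at h₂
  refine ⟨ε * ε' * ε'', by simp [mul_pow, h, h', h''], ?_⟩
  rw [h₁, commonDet, lacDet]
  linear_combination (-ε * ε') * h₂ -
    ε * h' * mdet (Matrix.of fun i c => (f i).eval (centredExp n c))

/-- Reversal of both families of columns. -/
def revCols (n : ℕ) : Fin (n + 1) ⊕ Fin n ≃ Fin (n + 1) ⊕ Fin n :=
  Equiv.sumCongr Fin.revPerm Fin.revPerm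

lemma expR_eq (n : ℕ) (c : Fin (n + 1) ⊕ Fin n) :
    (expR n c : ℂ) / 3 - n / 2 = -centredExp n (revCols n c) := by
  rcases c with i | i
  · have : ((n - i : ℕ) : ℂ) = n - i := Nat.cast_sub (Nat.lt_succ_iff.1 i.isLt)
    simp [centredExp_inl, revCols, expR, Fin.val_rev, this]
    ring
  · have : ((n - (i + 1) : ℕ) : ℂ) = n - (i + 1) := by rw [Nat.cast_sub i.isLt]; push_cast; rfl
    simp [centredExp_inr, revCols, expR, Fin.val_rev, this, shiftPt]
    ring

theorem powDet_eq_lacDet (k r : ℕ) : ∃ ε : ℂ, ε ^ 2 = 1 ∧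
    powDet (r + k) (r + k + 1 + r) (2 * k) = ε * (commonDet (r + k) ^ 2 *
      (2 ^ k * lacDet (r + k) r 0 * lacDet (r + k) r 1)) := by
  obtain ⟨ε₀, h₀, H₀⟩ := mdet_lacMat k r 0 (by omega)
  obtain ⟨ε₁, h₁, H₁⟩ := mdet_lacMat k r 1 (by omega)
  obtain ⟨ε, h, H⟩ := linked_parity (fun j c => centredExp (r + k) c ^ j) (revCols (r + k))
    (r + k + 1 + r) k (by simp; omega)
  refine ⟨ε * ε₀ * ε₁, by simp [mul_pow, h, h₀, h₁], ?_⟩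
  rw [H₀, H₁] at H
  rw [powDet, linkDet]
  have e : rowMat (fun j e : ℕ => ((e : ℂ) / 3 - (r + k : ℕ) / 2) ^ j) (r + k + 1 + r) (2 * k)
      (expR (r + k)) = rowMat (fun j c => (-1) ^ j * centredExp (r + k) (revCols (r + k) c) ^ j)
        (r + k + 1 + r) (2 * k) id := by
    ext i c
    simp only [rowMat, Matrix.of_apply, id]
    rw [expR_eq, ← neg_pow]
  rw [e]
  refine Eq.trans H ?_
  ring

end LacunaryReduction

section EvenOddPowers

open Matrix

/-- The product of the first `k` factorials. -/
def factProd (k : ℕ) : ℂ := ∏ j ∈ Finset.range k, (j.factorial : ℂ)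

/-- The product of all `i - j - 1/3` with `i, j < k`. -/
def thirdProd (k : ℕ) : ℂ :=
  ∏ i ∈ Finset.range k, ∏ j ∈ Finset.range k, ((i : ℂ) - j - 1 / 3)

lemma prod_Ioi_comm {k : ℕ} (g : Fin k → Fin k → ℂ) :
    ∏ i, ∏ j ∈ Finset.Ioi i, g i j = ∏ j, ∏ i ∈ Finset.Iio j, g i j :=
  Finset.prod_comm' fun i j => by simp

lemma prod_Ioi_sub (k : ℕ) :
    ∏ i : Fin k, ∏ j ∈ Finset.Ioi i, ((j : ℂ) - i) = factProd k := by
  rw [prod_Ioi_comm fun i j : Fin k => ((j : ℂ) - i), factProd, Finset.prod_range]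
  refine Finset.prod_congr rfl fun j _ => ?_
  have : ∏ i ∈ Finset.Iio j, ((j : ℂ) - (i : ℕ)) =
      ∏ i ∈ (Finset.Iio j).map Fin.valEmbedding, ((j : ℂ) - (i : ℕ)) := by
    rw [Finset.prod_map]; rfl
  rw [this, Fin.map_valEmbedding_Iio, Nat.Iio_eq_range, ← Finset.prod_range_reflect,
    ← Finset.prod_range_add_one_eq_factorial, Nat.cast_prod]
  refine Finset.prod_congr rfl fun i hi => ?_
  rw [Finset.mem_range] at hi
  rw [Nat.cast_sub (by omega), Nat.cast_sub (by omega)]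
  push_cast
  ring

lemma prod_Ioi_sq_mul_diag {k : ℕ} (g : Fin k → Fin k → ℂ) (hg : ∀ i j, g i j = g j i) :
    (∏ i, ∏ j ∈ Finset.Ioi i, g i j) ^ 2 * ∏ i, g i i = ∏ i, ∏ j, g i j := by
  have h : ∀ i, ∏ j, g i j =
      (∏ j ∈ Finset.Ioi i, g i j) * g i i * ∏ j ∈ Finset.Iio i, g j i := by
    intro i
    have e : (Finset.univ : Finset (Fin k)) =
        (Finset.Ioi i).disjUnion (Finset.Iic i) (by
          rw [Finset.disjoint_left]; intro a ha hb; simp at ha hb; omega) := by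
      ext a
      simp [lt_or_ge]
    rw [e, Finset.prod_disjUnion, ← Finset.Iio_insert, Finset.prod_insert (by simp), mul_assoc]
    congr 2
    exact Finset.prod_congr rfl fun j _ => hg i j
  simp only [h, Finset.prod_mul_distrib]
  rw [← prod_Ioi_comm]
  ring

/-- The determinant of the even powers of the shifted points, multiplied by the `d`-th ones. -/
def parityDet (k d : ℕ) : ℂ := (Matrix.of fun i j : Fin k => shiftPt k j ^ (d + 2 * (i : ℕ))).det

lemma parityDet_zero (k : ℕ) : parityDet k 0 = factProd k *
    ∏ i : Fin k, ∏ j ∈ Finset.Ioi i, ((i : ℂ) + j + 2 / 3 - k) := by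
  have : (Matrix.of fun i j : Fin k => shiftPt k j ^ (0 + 2 * (i : ℕ))) =
      (vandermonde fun j : Fin k => shiftPt k j ^ 2)ᵀ := by
    ext i j
    simp [vandermonde_apply, pow_mul]
  rw [parityDet, this, det_transpose, det_vandermonde, ← prod_Ioi_sub, ← Finset.prod_mul_distrib]
  refine Finset.prod_congr rfl fun i _ => ?_
  rw [← Finset.prod_mul_distrib]
  refine Finset.prod_congr rfl fun j _ => ?_
  rw [shiftPt, shiftPt]
  ring

lemma parityDet_one (k : ℕ) : parityDet k 1 = (∏ j : Fin k, shiftPt k j) * parityDet k 0 := by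
  rw [parityDet, parityDet, ← det_mul_row]
  congr 1
  ext i j
  simp [pow_add]

lemma parityDet_mul (k : ℕ) :
    2 ^ k * parityDet k 0 * parityDet k 1 = factProd k ^ 2 * thirdProd k := by
  have h₁ := prod_Ioi_sq_mul_diag (fun i j : Fin k => ((i : ℂ) + j + 2 / 3 - k))
    fun i j => by ring
  have h₂ : 2 ^ k * ∏ j : Fin k, shiftPt k j = ∏ i : Fin k, ((i : ℂ) + i + 2 / 3 - k) := by
    have : (2 : ℂ) ^ k = ∏ _j : Fin k, (2 : ℂ) := by simp
    rw [this, ← Finset.prod_mul_distrib]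
    refine Finset.prod_congr rfl fun j _ => ?_
    rw [shiftPt]
    ring
  have h₃ : ∏ i : Fin k, ∏ j : Fin k, ((i : ℂ) + j + 2 / 3 - k) = thirdProd k := by
    rw [thirdProd, Finset.prod_range]
    refine Finset.prod_congr rfl fun i _ => ?_
    rw [← Finset.prod_range fun j : ℕ => ((i : ℂ) + j + 2 / 3 - k), ← Finset.prod_range_reflect]
    refine Finset.prod_congr rfl fun j hj => ?_
    rw [Finset.mem_range] at hj
    rw [Nat.cast_sub (by omega), Nat.cast_sub (by omega)]
    push_cast
    ring
  rw [parityDet_one, parityDet_zero, ← h₃, ← h₁, ← h₂]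
  ring

lemma thirdProd_succ (k : ℕ) : thirdProd (k + 1) =
    (-1) ^ (k + 1) * ((3 * k + 1).factorial : ℂ) / (k.factorial * 3 ^ (3 * k + 1)) *
      thirdProd k := by
  have h : ∀ k : ℕ, ((k.factorial : ℂ) * 3 ^ (3 * k + 1)) *
      ((∏ i ∈ Finset.range k, ((i : ℂ) - k - 1 / 3)) *
        (∏ j ∈ Finset.range k, ((k : ℂ) - j - 1 / 3)) * (-1 / 3)) =
      (-1) ^ (k + 1) * ((3 * k + 1).factorial : ℂ) := by
    intro k
    have e₁ : ∏ i ∈ Finset.range k, ((i : ℂ) - k - 1 / 3) =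
        ∏ i ∈ Finset.range k, (-(i : ℂ) - 4 / 3) := by
      rw [← Finset.prod_range_reflect]
      refine Finset.prod_congr rfl fun i hi => ?_
      rw [Finset.mem_range] at hi
      rw [Nat.cast_sub (by omega), Nat.cast_sub (by omega)]
      push_cast
      ring
    have e₂ : ∏ i ∈ Finset.range k, ((k : ℂ) - i - 1 / 3) =
        ∏ i ∈ Finset.range k, ((i : ℂ) + 2 / 3) := by
      rw [← Finset.prod_range_reflect]
      refine Finset.prod_congr rfl fun i hi => ?_
      rw [Finset.mem_range] at hi
      rw [Nat.cast_sub (by omega), Nat.cast_sub (by omega)]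
      push_cast
      ring
    rw [e₁, e₂]
    clear e₁ e₂
    induction k with
    | zero => norm_num
    | succ k ih =>
      rw [Finset.prod_range_succ, Finset.prod_range_succ, Nat.factorial_succ k,
        show 3 * (k + 1) + 1 = 3 * k + 1 + 1 + 1 + 1 by ring, Nat.factorial_succ,
        Nat.factorial_succ, Nat.factorial_succ (3 * k + 1)]
      push_cast
      rw [pow_succ (-1 : ℂ) (k + 1)]
      linear_combination (-(3 * (k : ℂ) + 4) * (3 * k + 3) * (3 * k + 2)) * ih
  have h' := h k
  have hk : (k.factorial : ℂ) ≠ 0 := by exact_mod_cast k.factorial_ne_zero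
  have e : thirdProd (k + 1) = thirdProd k * ((∏ i ∈ Finset.range k, ((i : ℂ) - k - 1 / 3)) *
        (∏ j ∈ Finset.range k, ((k : ℂ) - j - 1 / 3)) * (-1 / 3)) := by
    rw [thirdProd, Finset.prod_range_succ, Finset.prod_range_succ]
    simp only [Finset.prod_range_succ, Finset.prod_mul_distrib]
    rw [thirdProd]
    ring
  rw [e, ← h', mul_div_cancel_left₀ _ (mul_ne_zero hk (by simp)), mul_comm]

end EvenOddPowers

section FinalRatio

/-- The product of the first `a` leading coefficients of the power-to-binomial change of basis. -/
def leadProd (a : ℕ) : ℂ := ∏ j ∈ Finset.range a, (j.factorial : ℂ) / 3 ^ j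

lemma factorial_ne_zero' (a : ℕ) : (a.factorial : ℂ) ≠ 0 := by exact_mod_cast a.factorial_ne_zero

lemma leadProd_ne_zero (a : ℕ) : leadProd a ≠ 0 :=
  Finset.prod_ne_zero_iff.2 fun j _ => div_ne_zero (factorial_ne_zero' j) (by simp)

lemma factProd_ne_zero (a : ℕ) : factProd a ≠ 0 :=
  Finset.prod_ne_zero_iff.2 fun j _ => factorial_ne_zero' j

lemma factProd_succ (a : ℕ) : factProd (a + 1) = factProd a * a.factorial :=
  Finset.prod_range_succ _ _

lemma leadProd_succ (a : ℕ) : leadProd (a + 1) = leadProd a * (a.factorial / 3 ^ a) :=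
  Finset.prod_range_succ _ _

lemma prod_even_mul_odd (g : ℕ → ℂ) (k : ℕ) :
    (∏ i ∈ Finset.range k, g (0 + 2 * i)) * ∏ i ∈ Finset.range k, g (1 + 2 * i) =
      ∏ s ∈ Finset.range (2 * k), g s := by
  induction k with
  | zero => simp
  | succ k ih =>
    rw [show 2 * (k + 1) = 2 * k + 1 + 1 by ring, Finset.prod_range_succ g,
      Finset.prod_range_succ g, ← ih, Finset.prod_range_succ, Finset.prod_range_succ, zero_add,
      add_comm 1]
    ring

lemma two_pow_mul_lacDet (k r : ℕ) :
    2 ^ k * lacDet (r + k) r 0 * lacDet (r + k) r 1 * factProd (2 * k) =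
      factProd r * factProd (r + 2 * k) * factProd k ^ 2 * thirdProd k := by
  have h₁ : (∏ s ∈ Finset.range (2 * k), ((r + s).factorial : ℂ) / s.factorial) *
      factProd (2 * k) * factProd r = factProd (r + 2 * k) := by
    rw [factProd, factProd, factProd, Finset.prod_range_add, ← Finset.prod_mul_distrib, mul_comm]
    congr 1
    exact Finset.prod_congr rfl fun s _ => div_mul_cancel₀ _ (factorial_ne_zero' s)
  have h₂ := prod_even_mul_odd (fun s => ((r + s).factorial : ℂ) / s.factorial) k
  rw [lacDet_eq k r 0 (by omega), lacDet_eq k r 1 le_rfl, ← parityDet, ← parityDet, ← factProd,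
    ← h₁, ← h₂]
  linear_combination (factProd r ^ 2 * factProd (2 * k) *
    (∏ i ∈ Finset.range k, ((r + (0 + 2 * i)).factorial : ℂ) / (0 + 2 * i).factorial) *
    (∏ i ∈ Finset.range k, ((r + (1 + 2 * i)).factorial : ℂ) / (1 + 2 * i).factorial)) *
    parityDet_mul k

theorem upSum_sq (k r : ℕ) :
    (upSum (k + r) k * (leadProd (k + 1 + 2 * r) * leadProd (k + 1 + 2 * r + 2 * k) *
      factProd (2 * k))) ^ 2 =
    3 ^ (k * (k - 1)) * (commonDet (k + r) ^ 2 *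
      (factProd r * factProd (r + 2 * k) * factProd k ^ 2 * thirdProd k)) ^ 2 := by
  obtain ⟨ε, h, H⟩ := upSum_eq_chooseDet k r
  obtain ⟨ε', h', H'⟩ := powDet_eq_lacDet k r
  have hp := powDet_eq (r + k) (r + k + 1 + r) (2 * k)
  rw [H', ← leadProd] at hp
  have hl : leadProd (r + k + 1 + r) * (∏ l ∈ Finset.range (2 * k),
      ((r + k + 1 + r + l).factorial : ℂ) / 3 ^ (r + k + 1 + r + l)) =
      leadProd (r + k + 1 + r + 2 * k) := by
    exact (Finset.prod_range_add _ _ _).symm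
  have hq : ((qc - qc ^ 2) ^ (k * (k - 1))) ^ 2 = 3 ^ (k * (k - 1)) := by
    rw [← pow_mul, mul_comm _ 2, pow_mul, show (qc - qc ^ 2) ^ 2 = -3 by
      have := qc_rel
      clear * - this
      grind, Even.neg_pow (Nat.even_mul_pred_self k)]
  rw [sq (leadProd _), mul_assoc (leadProd _), hl] at hp
  rw [H, ← two_pow_mul_lacDet, add_comm k r, show k + 1 + 2 * r = r + k + 1 + r by ring, ← hq]
  generalize leadProd (r + k + 1 + r) = a at *
  generalize leadProd (r + k + 1 + r + 2 * k) = b at *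
  generalize chooseDet (r + k) (r + k + 1 + r) (2 * k) = c at *
  generalize (qc - qc ^ 2) ^ (k * (k - 1)) = z at *
  generalize factProd (2 * k) = f at *
  generalize 2 ^ k * lacDet (r + k) r 0 * lacDet (r + k) r 1 = v at *
  generalize commonDet (r + k) = w at *
  have e : (ε * (z * c) * (a * b * f)) ^ 2 = ε ^ 2 * (z * f) ^ 2 * (a * b * c) ^ 2 := by ring
  rw [e, h, ← hp, mul_pow ε', h']
  ring

theorem upSum_ratio_sq (k r : ℕ) (h₀ : upSum (k + 1 + r) k ≠ 0) (h₁ : upSum (k + 1 + r) (k + 1) ≠ 0) :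
    (upSum (k + 1 + r) k / upSum (k + 1 + r) (k + 1)) ^ 2 =
      (((2 * k).factorial * (2 * k + 1).factorial * (2 * (k + 1 + r) + k + 1).factorial *
        r.factorial : ℂ) /
      (k.factorial * (3 * k + 1).factorial * (k + 2 + 2 * r).factorial *
        (2 * k + 1 + r).factorial)) ^ 2 := by
  have E₀ := upSum_sq k (r + 1)
  have E₁ := upSum_sq (k + 1) r
  rw [show k + 1 + 2 * (r + 1) = k + 2 + 2 * r + 1 by ring,
    show k + 2 + 2 * r + 1 + 2 * k = 3 * k + 3 + 2 * r by ring, leadProd_succ, factProd_succ,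
    show r + 1 + 2 * k = r + 2 * k + 1 by ring, show k + (r + 1) = k + 1 + r by ring] at E₀
  rw [show k + 1 + 1 + 2 * r = k + 2 + 2 * r by ring,
    show k + 2 + 2 * r + 2 * (k + 1) = 3 * k + 3 + 2 * r + 1 by ring, leadProd_succ (3 * k + _ + _),
    show 2 * (k + 1) = 2 * k + 1 + 1 by ring, factProd_succ, factProd_succ,
    show r + (2 * k + 1 + 1) = r + 2 * k + 1 + 1 by ring, factProd_succ (r + 2 * k + 1),
    factProd_succ k, thirdProd_succ, Nat.add_sub_cancel,
    show (k + 1) * k = k * (k - 1) + 2 * k by cases k <;> simp; ring,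
    pow_add _ (k * (k - 1)) (2 * k), pow_mul' 3 2 k,
    show r + 2 * k + 1 = 2 * k + 1 + r by ring] at E₁
  rw [show r + 2 * k + 1 = 2 * k + 1 + r by ring] at E₀
  rw [show 2 * (k + 1 + r) + k + 1 = 3 * k + 3 + 2 * r by ring]
  have n₁ := leadProd_ne_zero (k + 2 + 2 * r)
  have n₂ := leadProd_ne_zero (3 * k + 3 + 2 * r)
  have n₃ := factProd_ne_zero (2 * k)
  have f₁ := factorial_ne_zero' (k + 2 + 2 * r)
  have f₂ := factorial_ne_zero' (3 * k + 1)
  have f₃ := factorial_ne_zero' k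
  have f₄ := factorial_ne_zero' (2 * k + 1 + r)
  have y₁ : (3 : ℂ) ^ (k + 2 + 2 * r) ≠ 0 := by simp
  have y₂ : (3 : ℂ) ^ k ≠ 0 := by simp
  have hs : ((-1 : ℂ) ^ (k + 1)) ^ 2 = 1 := by simp [← pow_mul]
  rw [show 3 * k + 3 + 2 * r = k + 2 + 2 * r + (2 * k + 1) by ring] at *
  rw [show 3 * k + 1 = k + (2 * k + 1) by ring] at *
  have y₃ : (3 : ℂ) ^ (2 * k + 1) ≠ 0 := by simp
  rw [pow_add 3 (k + 2 + 2 * r) (2 * k + 1), pow_add 3 k (2 * k + 1)] at E₁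
  generalize (3 : ℂ) ^ (k + 2 + 2 * r) = P at *
  generalize (3 : ℂ) ^ k = t at *
  generalize (3 : ℂ) ^ (2 * k + 1) = y at *
  generalize (3 : ℂ) ^ (k * (k - 1)) = T at *
  generalize (-1 : ℂ) ^ (k + 1) = s at *
  generalize upSum (k + 1 + r) k = U₀ at *
  generalize upSum (k + 1 + r) (k + 1) = U₁ at *
  generalize commonDet (k + 1 + r) = w at *
  generalize thirdProd k = Q at *
  generalize leadProd (k + 2 + 2 * r) = G at *
  generalize leadProd (k + 2 + 2 * r + (2 * k + 1)) = H at *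
  generalize factProd (2 * k) = F at *
  generalize factProd r = F' at *
  generalize factProd (2 * k + 1 + r) = F'' at *
  generalize factProd k = V at *
  generalize ((k + 2 + 2 * r).factorial : ℂ) = c at *
  generalize ((k + (2 * k + 1)).factorial : ℂ) = B at *
  generalize (k.factorial : ℂ) = K at *
  generalize ((2 * k + 1 + r).factorial : ℂ) = N at *
  generalize ((k + 2 + 2 * r + (2 * k + 1)).factorial : ℂ) = A at *
  generalize ((2 * k).factorial : ℂ) = X at *
  generalize ((2 * k + 1).factorial : ℂ) = Y at *
  generalize (r.factorial : ℂ) = Z at *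
  have e₀ : (U₀ * c * (G * H * F)) ^ 2 =
      T * P ^ 2 * (w ^ 2 * F' * F'' * V ^ 2 * Q) ^ 2 * Z ^ 2 := by
    field_simp at E₀
    linear_combination E₀
  have e₁ : (U₁ * A * X * Y * (G * H * F)) ^ 2 =
      T * P ^ 2 * (w ^ 2 * F' * F'' * V ^ 2 * Q) ^ 2 * (N * K * B) ^ 2 := by
    field_simp at E₁
    linear_combination E₁ + P ^ 2 * T * w ^ 4 * F' ^ 2 * F'' ^ 2 * N ^ 2 * V ^ 4 * K ^ 2 * B ^ 2 *
      Q ^ 2 * hs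
  rw [div_pow, div_pow, div_eq_div_iff (pow_ne_zero 2 h₁) (by simp [*])]
  apply mul_left_cancel₀ (pow_ne_zero 2 (mul_ne_zero (mul_ne_zero n₁ n₂) n₃))
  linear_combination (N * K * B) ^ 2 * e₀ - Z ^ 2 * e₁

end FinalRatio

theorem EFP_ratio_minus (n k : ℕ) (hn : 1 ≤ n) (hk : 1 ≤ k) (hkn : k ≤ n)
    (Ψ : Cfg (2*n+1) → ℂ) (hΨ : Ψ ≠ 0) (E₀ : ℝ)
    (hground : (Hper (2*n+1)).mulVec Ψ = (E₀ : ℂ) • Ψ)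
    (hmin : ∀ (E : ℂ) (v : Cfg (2*n+1) → ℂ), v ≠ 0 →
      (Hper (2*n+1)).mulVec v = E • v → E₀ ≤ E.re)
    (hSz : (Sz (2*n+1)).mulVec Ψ = (-(1/2) : ℂ) • Ψ) :
    EFP Ψ (k-1) ≠ 0 ∧ EFP Ψ k ≠ 0 ∧
      EFP Ψ (k-1) / EFP Ψ k =
        (((2*k-2).factorial : ℂ) * ((2*k-1).factorial : ℂ) * ((2*n+k).factorial : ℂ) *
          ((n-k).factorial : ℂ)) /
        (((k-1).factorial : ℂ) * ((3*k-2).factorial : ℂ) * ((2*n-k+1).factorial : ℂ) *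
          ((n+k-1).factorial : ℂ)) := by
  obtain ⟨S, d, hd, hS⟩ := EFP_reduction n hn Ψ hΨ E₀ hground hmin hSz
  have hS₀ : (S 0 : ℂ) ≠ 0 := by exact_mod_cast (hS 0 n.zero_le).1.ne'
  obtain ⟨pos₀, up₀, E_pred⟩ := hS (k - 1) (by omega)
  obtain ⟨pos₁, up₁, E_k⟩ := hS k hkn
  have hne₀ : (S (k - 1) : ℂ) ≠ 0 := by exact_mod_cast pos₀.ne'
  have hne₁ : (S k : ℂ) ≠ 0 := by exact_mod_cast pos₁.ne'
  refine ⟨E_pred ▸ div_ne_zero hne₀ hS₀, E_k ▸ div_ne_zero hne₁ hS₀, ?_⟩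
  rw [E_pred, E_k, div_div_div_cancel_right₀ hS₀]
  obtain ⟨k, rfl⟩ : ∃ j, k = j + 1 := ⟨k - 1, by omega⟩
  obtain ⟨r, rfl⟩ : ∃ r, n = k + 1 + r := ⟨n - (k + 1), by omega⟩
  rw [show k + 1 - 1 = k by omega] at *
  have hsq := upSum_ratio_sq k r (up₀ ▸ mul_ne_zero hd hne₀) (up₁ ▸ mul_ne_zero hd hne₁)
  rw [up₀, up₁, mul_div_mul_left _ _ hd] at hsq
  rw [show 2 * (k + 1) - 2 = 2 * k by omega, show 2 * (k + 1) - 1 = 2 * k + 1 by omega,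
    show k + 1 + r - (k + 1) = r by omega, show 3 * (k + 1) - 2 = 3 * k + 1 by omega,
    show 2 * (k + 1 + r) - (k + 1) + 1 = k + 2 + 2 * r by omega,
    show k + 1 + r + (k + 1) - 1 = 2 * k + 1 + r by omega,
    show 2 * (k + 1 + r) + (k + 1) = 2 * (k + 1 + r) + k + 1 by omega]
  have hsq_real : (S k / S (k + 1)) ^ 2 =
      (((2 * k).factorial * (2 * k + 1).factorial * (2 * (k + 1 + r) + k + 1).factorial *
        r.factorial : ℝ) /
      (k.factorial * (3 * k + 1).factorial * (k + 2 + 2 * r).factorial *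
        (2 * k + 1 + r).factorial)) ^ 2 := by
    apply Complex.ofReal_injective
    push_cast
    exact hsq
  have h := (sq_eq_sq₀ (div_pos pos₀ pos₁).le (by positivity)).1 hsq_real
  rw [← Complex.ofReal_div, h]
  push_cast
  rfl
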